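/- Let D be a bounded domain in ℂ and let w ∈ ∂D be a regular boundary point. Then the Bergman metric blows up at w: β_D(z; 1) → ∞ as D ∋ z → w. -/

import Mathlib

open MeasureTheory Filter Topology Metric Set
open scoped ENNReal NNReal

/-- Truncated circle average of an `EReal`-valued function: the average over the circle of
center `c` and radius `R` of the function truncated below at `-n`. -/
noncomputable def circleAvgTrunc (u : ℂ → EReal) (c : ℂ) (R : ℝ) (n : ℕ) : ℝ :=
  (2 * Real.pi)⁻¹ * ∫ θ in (0:ℝ)..(2 * Real.pi),
    (max (u (c + R * Complex.exp (θ * Complex.I))) (-(n : ℝ) : EReal)).toReal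

/-- `u` is subharmonic on `Ω ⊆ ℂ`: values in `[-∞, ∞)`, upper semicontinuous on `Ω`, and for
every closed disc contained in `Ω` the value at the center is at most the mean over the
boundary circle (in the extended sense, via decreasing truncations). -/
def SubharmonicOn (u : ℂ → EReal) (Ω : Set ℂ) : Prop :=
  UpperSemicontinuousOn u Ω ∧ (∀ z ∈ Ω, u z < ⊤) ∧
    ∀ c ∈ Ω, ∀ R : ℝ, 0 < R → Metric.closedBall c R ⊆ Ω →
      u c ≤ ⨅ n : ℕ, (circleAvgTrunc u c R n : EReal)

/-- `u` is plurisubharmonic on `Ω`: values in `[-∞, ∞)`, upper semicontinuous on `Ω`, and its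
restriction to every complex line is subharmonic. -/
def PlurisubharmonicOn {E : Type*} [NormedAddCommGroup E] [NormedSpace ℂ E]
    (u : E → EReal) (Ω : Set E) : Prop :=
  UpperSemicontinuousOn u Ω ∧ (∀ z ∈ Ω, u z < ⊤) ∧
    ∀ a b : E, SubharmonicOn (fun lam : ℂ => u (a + lam • b)) {lam : ℂ | a + lam • b ∈ Ω}

/-- A set `P ⊆ ℂ` is polar. -/
def PolarSet (P : Set ℂ) : Prop :=
  ∀ z ∈ P, ∃ U : Set ℂ, IsOpen U ∧ IsConnected U ∧ z ∈ U ∧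
    ∃ u : ℂ → EReal, SubharmonicOn u U ∧ (∃ x ∈ U, u x ≠ ⊥) ∧ ∀ x ∈ P ∩ U, u x = ⊥

/-- A set `P ⊆ ℂⁿ` is pluripolar. -/
def PluripolarSet {E : Type*} [NormedAddCommGroup E] [NormedSpace ℂ E] (P : Set E) : Prop :=
  ∀ z ∈ P, ∃ U : Set E, IsOpen U ∧ IsConnected U ∧ z ∈ U ∧
    ∃ u : E → EReal, PlurisubharmonicOn u U ∧ (∃ x ∈ U, u x ≠ ⊥) ∧ ∀ x ∈ P ∩ U, u x = ⊥

/-- A domain `D` is pseudoconvex if `z ↦ -log dist(z, ∂D)` is plurisubharmonic on `D`. -/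
def IsPseudoconvex {E : Type*} [NormedAddCommGroup E] [NormedSpace ℂ E] (D : Set E) : Prop :=
  PlurisubharmonicOn (fun z => ((- Real.log (Metric.infDist z Dᶜ) : ℝ) : EReal)) D

/-- The square-integrable holomorphic functions on an open set `Ω`. -/
def L2h {E : Type*} [NormedAddCommGroup E] [NormedSpace ℂ E] [MeasureSpace E]
    (Ω : Set E) : Set (E → ℂ) :=
  {f | DifferentiableOn ℂ f Ω ∧ (∫⁻ z in Ω, (‖f z‖₊ : ℝ≥0∞) ^ 2) < ⊤}

/-- The Bergman kernel of `Ω` on the diagonal,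
`K_Ω(z) = sup { |f(z)|²/‖f‖²_{L²(Ω)} : f ∈ L²ₕ(Ω), f ≢ 0 }`. -/
noncomputable def bergmanKernel {E : Type*} [NormedAddCommGroup E] [NormedSpace ℂ E]
    [MeasureSpace E] (Ω : Set E) (z : E) : ℝ≥0∞ :=
  ⨆ (f : E → ℂ) (_ : f ∈ L2h Ω) (_ : ∃ w ∈ Ω, f w ≠ 0),
    (‖f z‖₊ : ℝ≥0∞) ^ 2 / ∫⁻ w in Ω, (‖f w‖₊ : ℝ≥0∞) ^ 2

/-- `D` is an `L²ₕ`-domain of holomorphy: there are no domains `D₀, D₁` with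
`∅ ≠ D₀ ⊆ D₁ ∩ D`, `D₁ ⊄ D`, such that every `f ∈ L²ₕ(D)` extends holomorphically to `D₁`
(agreeing with `f` on `D₀`). -/
def IsL2hDomainOfHolomorphy {E : Type*} [NormedAddCommGroup E] [NormedSpace ℂ E]
    [MeasureSpace E] (D : Set E) : Prop :=
  ¬ ∃ D0 D1 : Set E, IsOpen D0 ∧ IsConnected D0 ∧ IsOpen D1 ∧ IsConnected D1 ∧
      D0 ⊆ D1 ∩ D ∧ ¬ (D1 ⊆ D) ∧
      ∀ f ∈ L2h D, ∃ F : E → ℂ, DifferentiableOn ℂ F D1 ∧ Set.EqOn F f D0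

/-- `w` is a regular boundary point of the domain `D ⊆ ℂ`. -/
def RegularBoundaryPt (D : Set ℂ) (w : ℂ) : Prop :=
  ∃ U : Set ℂ, IsOpen U ∧ w ∈ U ∧ ∃ u : ℂ → EReal, SubharmonicOn u (U ∩ D) ∧
    (∀ z ∈ U ∩ D, u z < 0) ∧ Tendsto u (𝓝[U ∩ D] w) (𝓝 (0 : EReal))

/-- The (pluricomplex) Green function of a domain `D ⊆ ℂ` with logarithmic pole at `p`. -/
noncomputable def greenFn (D : Set ℂ) (p z : ℂ) : EReal :=
  sSup {v : EReal | ∃ u : ℂ → EReal, SubharmonicOn u D ∧ (∀ x ∈ D, u x < 0) ∧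
    (∃ C : ℝ, ∀ᶠ x in 𝓝 p, u x ≤ ((Real.log ‖x - p‖ + C : ℝ) : EReal)) ∧ v = u z}

/-- A polydisc in `ℂⁿ` with centre `c` and multiradius `r`. -/
def polydisc {n : ℕ} (c : Fin n → ℂ) (r : Fin n → ℝ) : Set (Fin n → ℂ) :=
  {z | ∀ i, ‖z i - c i‖ < r i}

/-- The Bergman metric of a domain `D ⊆ ℂ` evaluated at the vector `X = 1`:
`β_D(z;1) = √(∂² log K_D(z) / ∂z ∂z̄)`, where `∂²/∂z∂z̄ = (1/4)(∂²/∂x² + ∂²/∂y²)`. -/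
noncomputable def bergmanMetricOne (D : Set ℂ) (z : ℂ) : ℝ :=
  Real.sqrt ((1 / 4) *
    (fderiv ℝ (fun w => fderiv ℝ (fun v => Real.log (bergmanKernel D v).toReal) w 1) z 1 +
     fderiv ℝ (fun w => fderiv ℝ (fun v => Real.log (bergmanKernel D v).toReal) w
       Complex.I) z Complex.I))


section BrgAux
open scoped ContDiff
noncomputable section
namespace Brg


/-- d-bar operator -/
def dbar (f : ℂ → ℂ) (a : ℂ) : ℂ := (1/2) * (fderiv ℝ f a 1 + Complex.I * fderiv ℝ f a Complex.I)
/-- d operator -/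
def dee (f : ℂ → ℂ) (a : ℂ) : ℂ := (1/2) * (fderiv ℝ f a 1 - Complex.I * fderiv ℝ f a Complex.I)

/-- test functions -/
structure IsTest (D : Set ℂ) (η : ℂ → ℂ) : Prop where
  smooth : ContDiff ℝ ∞ η
  cpt : HasCompactSupport η
  supp : tsupport η ⊆ D

lemma IsTest.mono {D E : Set ℂ} (h : D ⊆ E) {η : ℂ → ℂ} (hη : IsTest D η) : IsTest E η :=
  ⟨hη.smooth, hη.cpt, hη.supp.trans h⟩

lemma fderiv_apply_contDiff {f : ℂ → ℂ} (hf : ContDiff ℝ ∞ f) (v : ℂ) :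
    ContDiff ℝ ∞ (fun a => fderiv ℝ f a v) :=
  (hf.fderiv_right (m := ∞) (by simp)).clm_apply contDiff_const

lemma dbar_contDiff {f : ℂ → ℂ} (hf : ContDiff ℝ ∞ f) : ContDiff ℝ ∞ (dbar f) := by
  unfold dbar
  exact contDiff_const.mul ((fderiv_apply_contDiff hf 1).add
    (contDiff_const.mul (fderiv_apply_contDiff hf _)))

lemma dee_contDiff {f : ℂ → ℂ} (hf : ContDiff ℝ ∞ f) : ContDiff ℝ ∞ (dee f) := by
  unfold dee
  exact contDiff_const.mul ((fderiv_apply_contDiff hf 1).sub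
    (contDiff_const.mul (fderiv_apply_contDiff hf _)))

lemma tsupport_fderiv_apply (f : ℂ → ℂ) (v : ℂ) :
    tsupport (fun a => fderiv ℝ f a v) ⊆ tsupport f := by
  refine (closure_mono ?_).trans (tsupport_fderiv_subset ℝ (f := f))
  intro a ha h
  apply ha
  simp [h]

lemma dbar_zero_of_notMem {f : ℂ → ℂ} {a : ℂ} (ha : a ∉ tsupport f) : dbar f a = 0 := by
  have : fderiv ℝ f a = 0 := by
    by_contra h
    exact ha (support_fderiv_subset ℝ h)
  simp [dbar, this]

lemma dee_zero_of_notMem {f : ℂ → ℂ} {a : ℂ} (ha : a ∉ tsupport f) : dee f a = 0 := by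
  have : fderiv ℝ f a = 0 := by
    by_contra h
    exact ha (support_fderiv_subset ℝ h)
  simp [dee, this]

lemma tsupport_dbar (f : ℂ → ℂ) : tsupport (dbar f) ⊆ tsupport f := by
  refine closure_minimal (fun a ha => ?_) (isClosed_tsupport f)
  by_contra h
  exact ha (dbar_zero_of_notMem h)

lemma tsupport_dee (f : ℂ → ℂ) : tsupport (dee f) ⊆ tsupport f := by
  refine closure_minimal (fun a ha => ?_) (isClosed_tsupport f)
  by_contra h
  exact ha (dee_zero_of_notMem h)

lemma IsTest.of_tsupport {D : Set ℂ} {η ξ : ℂ → ℂ} (hη : IsTest D η) (h : ContDiff ℝ ∞ ξ)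
    (hs : tsupport ξ ⊆ tsupport η) : IsTest D ξ :=
  ⟨h, hη.cpt.of_isClosed_subset (isClosed_tsupport _) hs, hs.trans hη.supp⟩

lemma IsTest.dbar {D : Set ℂ} {η : ℂ → ℂ} (hη : IsTest D η) : IsTest D (dbar η) :=
  hη.of_tsupport (dbar_contDiff hη.smooth) (tsupport_dbar η)
lemma IsTest.dee {D : Set ℂ} {η : ℂ → ℂ} (hη : IsTest D η) : IsTest D (dee η) :=
  hη.of_tsupport (dee_contDiff hη.smooth) (tsupport_dee η)
lemma IsTest.mul_left {D : Set ℂ} {χ η : ℂ → ℂ} (hη : IsTest D η) (hχ : ContDiff ℝ ∞ χ) :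
    IsTest D (fun a => χ a * η a) :=
  hη.of_tsupport (hχ.mul hη.smooth) (tsupport_mul_subset_right)

/-- conj as a function -/
abbrev cj (z : ℂ) : ℂ := (starRingEnd ℂ) z

lemma fderiv_cj {f : ℂ → ℂ} {a : ℂ} (hf : DifferentiableAt ℝ f a) (v : ℂ) :
    fderiv ℝ (fun x => cj (f x)) a v = cj (fderiv ℝ f a v) := by
  have := (Complex.conjCLE.toContinuousLinearMap.hasFDerivAt.comp a hf.hasFDerivAt).fderiv
  have h2 : (fun x => cj (f x)) = (Complex.conjCLE.toContinuousLinearMap ∘ f) := by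
    ext; simp
  rw [h2, this]; simp

lemma cj_contDiff {f : ℂ → ℂ} (hf : ContDiff ℝ ∞ f) : ContDiff ℝ ∞ (fun x => cj (f x)) :=
  Complex.conjCLE.contDiff.comp hf

lemma dbar_cj {f : ℂ → ℂ} {a : ℂ} (hf : DifferentiableAt ℝ f a) :
    dbar (fun x => cj (f x)) a = cj (dee f a) := by
  simp only [dbar, dee, fderiv_cj hf]; simp [cj]
  left; exact (map_ofNat (starRingEnd ℂ) 2).symm
lemma dee_cj {f : ℂ → ℂ} {a : ℂ} (hf : DifferentiableAt ℝ f a) :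
    dee (fun x => cj (f x)) a = cj (dbar f a) := by
  simp only [dbar, dee, fderiv_cj hf]; simp [cj, sub_eq_add_neg]
  left; exact (map_ofNat (starRingEnd ℂ) 2).symm

lemma IsTest.cj {D : Set ℂ} {η : ℂ → ℂ} (hη : IsTest D η) : IsTest D (fun x => cj (η x)) :=
  hη.of_tsupport (cj_contDiff hη.smooth) (closure_mono (by
    intro a ha h; apply ha; simp [h]))

lemma IsTest.diff {D : Set ℂ} {η : ℂ → ℂ} (hη : IsTest D η) (a : ℂ) : DifferentiableAt ℝ η a :=
  (hη.smooth.differentiable (by simp)) a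

lemma fderiv_mul_apply {f g : ℂ → ℂ} {a : ℂ} (hf : DifferentiableAt ℝ f a)
    (hg : DifferentiableAt ℝ g a) (v : ℂ) :
    fderiv ℝ (fun x => f x * g x) a v = f a * fderiv ℝ g a v + fderiv ℝ f a v * g a := by
  have : (fun x => f x * g x) = f * g := rfl
  rw [this, fderiv_mul hf hg]; simp; ring

lemma dbar_mul {f g : ℂ → ℂ} {a : ℂ} (hf : DifferentiableAt ℝ f a)
    (hg : DifferentiableAt ℝ g a) :
    dbar (fun x => f x * g x) a = f a * dbar g a + dbar f a * g a := by
  simp only [dbar, fderiv_mul_apply hf hg]; ring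
lemma dee_mul {f g : ℂ → ℂ} {a : ℂ} (hf : DifferentiableAt ℝ f a)
    (hg : DifferentiableAt ℝ g a) :
    dee (fun x => f x * g x) a = f a * dee g a + dee f a * g a := by
  simp only [dee, fderiv_mul_apply hf hg]; ring

lemma dbar_hol {f : ℂ → ℂ} {a : ℂ} (hf : DifferentiableAt ℂ f a) : dbar f a = 0 := by
  have h : fderiv ℝ f a = (fderiv ℂ f a).restrictScalars ℝ :=
    (hf.hasFDerivAt.restrictScalars ℝ).fderiv
  have h1 : fderiv ℂ f a Complex.I = Complex.I * fderiv ℂ f a 1 := by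
    conv_lhs => rw [show Complex.I = Complex.I • (1:ℂ) by simp]
    rw [map_smul]; simp
  simp [dbar, h, h1, ← mul_assoc]

lemma dbar_conj_sub (c a : ℂ) : dbar (fun x => cj x - c) a = 1 := by
  have : ∀ v, fderiv ℝ (fun x => cj x - c) a v = cj v := by
    intro v
    rw [fderiv_sub_const]
    simpa using fderiv_cj (f := fun x => x) (a := a) (by fun_prop) v
  simp [dbar, this, cj]; norm_num

lemma contDiff_conj_sub (c : ℂ) : ContDiff ℝ ∞ (fun x => cj x - c) :=
  (cj_contDiff (f := fun x => x) contDiff_id).sub contDiff_const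

/-- continuity of a product with compact support in the open set -/
lemma cont_mul_of_supp {D : Set ℂ} (hD : IsOpen D) {f η : ℂ → ℂ} (hf : ContinuousOn f D)
    (hη : Continuous η) (hs : tsupport η ⊆ D) : Continuous (fun a => f a * η a) := by
  rw [continuous_iff_continuousAt]
  intro a
  by_cases ha : a ∈ tsupport η
  · exact (hf.continuousAt (hD.mem_nhds (hs ha))).mul hη.continuousAt
  · have : (fun a => f a * η a) =ᶠ[𝓝 a] fun _ => 0 := by
      filter_upwards [notMem_tsupport_iff_eventuallyEq.1 ha] with x hx
      simp [hx]
    exact (continuousAt_const (y := (0:ℂ))).congr this.symm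

lemma integrable_mul_of_supp {D : Set ℂ} (hD : IsOpen D) {f η : ℂ → ℂ} (hf : ContinuousOn f D)
    (hη : Continuous η) (hc : HasCompactSupport η) (hs : tsupport η ⊆ D) :
    Integrable (fun a => f a * η a) :=
  (cont_mul_of_supp hD hf hη hs).integrable_of_hasCompactSupport hc.mul_left

lemma IsTest.integrable {D : Set ℂ} {η : ℂ → ℂ} (hη : IsTest D η) : Integrable η :=
  hη.smooth.continuous.integrable_of_hasCompactSupport hη.cpt

lemma parts_aux {D : Set ℂ} (hD : IsOpen D) {f η : ℂ → ℂ} (hf : ContDiffOn ℝ 1 f D)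
    (hη : IsTest D η) (v : ℂ) :
    Integrable (fun a => f a * fderiv ℝ η a v) ∧ Integrable (fun a => fderiv ℝ f a v * η a) ∧
    ∫ a, f a * fderiv ℝ η a v = - ∫ a, fderiv ℝ f a v * η a := by
  have hc := (hf.continuousOn_fderiv_of_isOpen hD le_rfl)
  have i1 : Integrable (fun a => f a * fderiv ℝ η a v) :=
    integrable_mul_of_supp hD hf.continuousOn (fderiv_apply_contDiff hη.smooth v).continuous
      (hη.cpt.of_isClosed_subset (isClosed_tsupport _) (tsupport_fderiv_apply η v))
      ((tsupport_fderiv_apply η v).trans hη.supp)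
  have i2 : Integrable (fun a => fderiv ℝ f a v * η a) :=
    integrable_mul_of_supp hD (hc.clm_apply continuousOn_const) hη.smooth.continuous
      hη.cpt hη.supp
  have i3 := integrable_mul_of_supp hD hf.continuousOn hη.smooth.continuous
      hη.cpt hη.supp
  refine ⟨i1, i2, integral_mul_fderiv_eq_neg_fderiv_mul_of_integrable i2 i1 i3 ?_ ?_⟩
  · intro x hx
    exact (hf.contDiffAt (hD.mem_nhds (hη.supp hx))).differentiableAt (by simp)
  · intro x _
    exact hη.diff x

lemma parts_dbar {D : Set ℂ} (hD : IsOpen D) {f η : ℂ → ℂ} (hf : ContDiffOn ℝ 1 f D)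
    (hη : IsTest D η) : ∫ a, f a * dbar η a = - ∫ a, dbar f a * η a := by
  obtain ⟨a1, b1, c1⟩ := parts_aux hD hf hη 1
  obtain ⟨a2, b2, c2⟩ := parts_aux hD hf hη Complex.I
  have e1 : ∀ a, f a * dbar η a = (1/2) * (f a * fderiv ℝ η a 1) +
      (Complex.I/2) * (f a * fderiv ℝ η a Complex.I) := by intro a; simp only [dbar]; ring
  have e2 : ∀ a, dbar f a * η a = (1/2) * (fderiv ℝ f a 1 * η a) +
      (Complex.I/2) * (fderiv ℝ f a Complex.I * η a) := by intro a; simp only [dbar]; ring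
  simp_rw [e1, e2]
  rw [integral_add (a1.const_mul _) (a2.const_mul _), integral_add (b1.const_mul _) (b2.const_mul _)]
  simp_rw [integral_const_mul]
  rw [c1, c2]; ring

lemma parts_dee {D : Set ℂ} (hD : IsOpen D) {f η : ℂ → ℂ} (hf : ContDiffOn ℝ 1 f D)
    (hη : IsTest D η) : ∫ a, f a * dee η a = - ∫ a, dee f a * η a := by
  obtain ⟨a1, b1, c1⟩ := parts_aux hD hf hη 1
  obtain ⟨a2, b2, c2⟩ := parts_aux hD hf hη Complex.I
  have e1 : ∀ a, f a * dee η a = (1/2) * (f a * fderiv ℝ η a 1) +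
      (-Complex.I/2) * (f a * fderiv ℝ η a Complex.I) := by intro a; simp only [dee]; ring
  have e2 : ∀ a, dee f a * η a = (1/2) * (fderiv ℝ f a 1 * η a) +
      (-Complex.I/2) * (fderiv ℝ f a Complex.I * η a) := by intro a; simp only [dee]; ring
  simp_rw [e1, e2]
  rw [integral_add (a1.const_mul _) (a2.const_mul _), integral_add (b1.const_mul _) (b2.const_mul _)]
  simp_rw [integral_const_mul]
  rw [c1, c2]; ring

lemma fderiv_comm {f : ℂ → ℂ} (hf : ContDiff ℝ ∞ f) (a v w : ℂ) :
    fderiv ℝ (fun x => fderiv ℝ f x v) a w = fderiv ℝ (fun x => fderiv ℝ f x w) a v := by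
  have hd : DifferentiableAt ℝ (fderiv ℝ f) a :=
    ((hf.fderiv_right (m := ∞) (by simp)).differentiable (by simp)) a
  have h : ∀ v w, fderiv ℝ (fun x => fderiv ℝ f x v) a w = fderiv ℝ (fderiv ℝ f) a w v := by
    intro v w
    rw [fderiv_clm_apply hd (by fun_prop)]; simp
  rw [h, h]
  have := (hf.contDiffAt (x := a)).isSymmSndFDerivAt (by simp; exact WithTop.coe_le_coe.2 (le_top (a := (2:ℕ∞))))
  exact this w v

lemma dee_dbar_comm {f : ℂ → ℂ} (hf : ContDiff ℝ ∞ f) (a : ℂ) :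
    dee (dbar f) a = dbar (dee f) a := by
  have h : ∀ v, DifferentiableAt ℝ (fun x => fderiv ℝ f x v) a := fun v =>
    ((fderiv_apply_contDiff hf v).differentiable (by simp)) a
  have e : ∀ (c v : ℂ), fderiv ℝ (fun x => (1/2:ℂ) * (fderiv ℝ f x 1 + c * fderiv ℝ f x Complex.I)) a v
     = (1/2) * (fderiv ℝ (fun x => fderiv ℝ f x 1) a v + c * fderiv ℝ (fun x => fderiv ℝ f x Complex.I) a v) := by
    intro c v
    rw [fderiv_const_mul (by exact (h 1).add ((h _).const_mul c)),
      fderiv_fun_add (h 1) ((h _).const_mul c), fderiv_const_mul (h _)]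
    simp; ring
  have e1 := fun v => e Complex.I v
  have e2 := fun v => e (-Complex.I) v
  have d2 : dee f = fun x => (1/2:ℂ) * (fderiv ℝ f x 1 + (-Complex.I) * fderiv ℝ f x Complex.I) := by
    ext x; simp [dee]; ring
  have d1 : dbar f = fun x => (1/2:ℂ) * (fderiv ℝ f x 1 + (Complex.I) * fderiv ℝ f x Complex.I) := rfl
  rw [d1, d2]
  unfold dee dbar
  rw [e1, e1, e2, e2, fderiv_comm hf a 1 Complex.I]
  ring


/-- the kernel `1/|x|` -/
def ke (x : ℂ) : ℝ≥0∞ := ENNReal.ofReal ‖x‖⁻¹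

lemma ke_meas : Measurable ke := by unfold ke; fun_prop

lemma ke_neg (x : ℂ) : ke (-x) = ke x := by simp [ke]

lemma ke_ball (ρ : ℝ) : ∫⁻ x in ball (0:ℂ) ρ, ke x ≤ ENNReal.ofReal (2 * Real.pi * ρ) := by
  rw [← lintegral_indicator measurableSet_ball, ← Complex.lintegral_comp_polarCoord_symm]
  have h1 : ∀ p ∈ polarCoord.target, ENNReal.ofReal p.1 • (ball (0:ℂ) ρ).indicator ke
      (Complex.polarCoord.symm p) ≤ (Ioo (0:ℝ) ρ ×ˢ Ioo (-Real.pi) Real.pi).indicator (fun _ => 1) p := by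
    rintro ⟨r, θ⟩ hp
    simp only [polarCoord_target, mem_prod, mem_Ioi] at hp
    have hn : ‖(Complex.polarCoord.symm (r, θ))‖ = r := by
      rw [Complex.norm_polarCoord_symm]; exact abs_of_pos hp.1
    by_cases hr : r < ρ
    · rw [indicator_of_mem (mem_ball_zero_iff.2 (by rw [hn]; exact hr)), indicator_of_mem (by simp [hp.1, hr, hp.2.1, hp.2.2])]
      simp only [ke, hn, smul_eq_mul]
      rw [← ENNReal.ofReal_mul hp.1.le, mul_inv_cancel₀ hp.1.ne']; simp
    · rw [indicator_of_notMem (fun h => hr (by have := mem_ball_zero_iff.1 h; rwa [hn] at this))]; simp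
  refine (setLIntegral_mono' polarCoord.open_target.measurableSet h1).trans ?_
  refine (setLIntegral_le_lintegral _ _).trans ?_
  rw [lintegral_indicator (measurableSet_Ioo.prod measurableSet_Ioo)]
  simp only [lintegral_const, one_mul, MeasurableSet.univ, Measure.restrict_apply, univ_inter]
  rw [Measure.volume_eq_prod, Measure.prod_prod, Real.volume_Ioo, Real.volume_Ioo,
    ← ENNReal.ofReal_mul' (by linarith [Real.pi_pos])]
  apply ENNReal.ofReal_le_ofReal
  apply le_of_eq; ring

lemma ke_ball' (a : ℂ) (ρ : ℝ) :
    ∫⁻ x in ball a ρ, ke (a - x) ≤ ENNReal.ofReal (2 * Real.pi * ρ) := by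
  refine le_trans (le_of_eq ?_) (ke_ball ρ)
  rw [← lintegral_indicator measurableSet_ball, ← lintegral_indicator measurableSet_ball,
    ← lintegral_sub_left_eq_self ((ball (0:ℂ) ρ).indicator ke) a]
  congr 1; ext x
  by_cases hx : x ∈ ball a ρ
  · have : a - x ∈ ball (0:ℂ) ρ := by simpa [dist_eq_norm, norm_sub_rev] using hx
    simp [hx, this]
  · have : a - x ∉ ball (0:ℂ) ρ := by simpa [dist_eq_norm, norm_sub_rev] using hx
    simp only [indicator_of_notMem hx, indicator_of_notMem this]

lemma ke_set (E : Set ℂ) (a : ℂ) {ρ : ℝ} (hρ : 0 < ρ) :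
    ∫⁻ x in E, ke (a - x) ≤ ENNReal.ofReal (2 * Real.pi * ρ) + ENNReal.ofReal ρ⁻¹ * volume E := by
  have h : ∀ x, ke (a - x) ≤ (ball a ρ).indicator (fun x => ke (a - x)) x + ENNReal.ofReal ρ⁻¹ := by
    intro x
    by_cases hx : x ∈ ball a ρ
    · simp [hx]
    · rw [indicator_of_notMem hx, zero_add]
      apply ENNReal.ofReal_le_ofReal
      have : ρ ≤ ‖a - x‖ := by simpa [dist_eq_norm, norm_sub_rev] using hx
      gcongr
  refine (lintegral_mono h).trans ?_
  have hm : Measurable (fun x => ke (a - x)) := ke_meas.comp (by fun_prop)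
  rw [lintegral_add_right _ measurable_const]
  refine add_le_add ?_ (by simp)
  refine (setLIntegral_le_lintegral _ _).trans ?_
  rw [lintegral_indicator measurableSet_ball]
  exact ke_ball' a ρ

/-- Cauchy-Schwarz for lintegral -/
lemma lint_cs {α : Type*} [MeasurableSpace α] (μ : Measure α) {f g : α → ℝ≥0∞}
    (hf : AEMeasurable f μ) (hg : AEMeasurable g μ) :
    (∫⁻ x, f x * g x ∂μ) ^ 2 ≤ (∫⁻ x, f x ^ 2 ∂μ) * ∫⁻ x, g x ^ 2 ∂μ := by
  have h := ENNReal.lintegral_mul_le_Lp_mul_Lq μ (p := 2) (q := 2) (by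
    constructor <;> norm_num) hf hg
  have h2 := pow_le_pow_left' h 2
  refine h2.trans (le_of_eq ?_)
  rw [mul_pow, ← ENNReal.rpow_natCast, ← ENNReal.rpow_natCast, ← ENNReal.rpow_mul,
    ← ENNReal.rpow_mul]
  norm_num

/-- Schur test -/
lemma schur {α β : Type*} [MeasurableSpace α] [MeasurableSpace β] (μ : Measure α) (ν : Measure β)
    [SFinite μ] [SFinite ν] {κ : α → β → ℝ≥0∞} (hκ : Measurable (Function.uncurry κ))
    {g : β → ℝ≥0∞} (hg : AEMeasurable g ν) {M1 M2 : ℝ≥0∞} (h1 : ∀ a, ∫⁻ b, κ a b ∂ν ≤ M1)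
    (h2 : ∀ b, ∫⁻ a, κ a b ∂μ ≤ M2) :
    ∫⁻ a, (∫⁻ b, κ a b * g b ∂ν) ^ 2 ∂μ ≤ M1 * M2 * ∫⁻ b, g b ^ 2 ∂ν := by
  have step : ∀ a, (∫⁻ b, κ a b * g b ∂ν) ^ 2 ≤ M1 * ∫⁻ b, κ a b * g b ^ 2 ∂ν := by
    intro a
    have hk : Measurable (κ a) := hκ.comp measurable_prodMk_left
    have hs : Measurable fun b => (κ a b) ^ (1/2:ℝ) := hk.pow_const _
    have e : ∀ b, κ a b = (κ a b) ^ (1/2:ℝ) * (κ a b) ^ (1/2:ℝ) := by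
      intro b; rw [← ENNReal.rpow_add_of_nonneg _ _ (by norm_num) (by norm_num)]; norm_num
    have e2 : ∀ b, ((κ a b) ^ (1/2:ℝ))^2 = κ a b := by
      intro b; rw [pow_two, ← e]
    have := lint_cs ν (f := fun b => (κ a b) ^ (1/2:ℝ)) (g := fun b => (κ a b) ^ (1/2:ℝ) * g b)
      hs.aemeasurable (hs.aemeasurable.mul hg)
    simp only [← mul_assoc, ← e, mul_pow, e2] at this
    exact this.trans (by gcongr; exact h1 a)
  calc ∫⁻ a, (∫⁻ b, κ a b * g b ∂ν) ^ 2 ∂μ ≤ ∫⁻ a, M1 * ∫⁻ b, κ a b * g b ^ 2 ∂ν ∂μ :=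
        lintegral_mono step
    _ = M1 * ∫⁻ a, ∫⁻ b, κ a b * g b ^ 2 ∂ν ∂μ := by
        rw [lintegral_const_mul'']
        apply AEMeasurable.lintegral_prod_right' (f := fun p : α × β => κ p.1 p.2 * g p.2 ^ 2)
        exact (hκ.aemeasurable).mul ((hg.comp_snd).pow_const 2)
    _ = M1 * ∫⁻ b, ∫⁻ a, κ a b * g b ^ 2 ∂μ ∂ν := by
        rw [lintegral_lintegral_swap]
        exact (hκ.aemeasurable).mul ((hg.comp_snd).pow_const 2)
    _ ≤ M1 * ∫⁻ b, M2 * g b ^ 2 ∂ν := by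
        gcongr with b
        rw [lintegral_mul_const]
        · gcongr; exact h2 b
        · exact hκ.comp measurable_prodMk_right
    _ = M1 * M2 * ∫⁻ b, g b ^ 2 ∂ν := by
        rw [lintegral_const_mul'' _ (hg.pow_const 2), mul_assoc]

lemma log_sq_le {t : ℝ} (ht : 0 < t) : (Real.log t) ^ 2 ≤ 4 * (t + t⁻¹) := by
  have key : ∀ t : ℝ, 1 ≤ t → (Real.log t) ^ 2 ≤ 4 * t := by
    intro t h
    have h0 : 0 < Real.sqrt t := Real.sqrt_pos.2 (by linarith)
    have h1 : Real.log t = 2 * Real.log (Real.sqrt t) := by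
      rw [Real.log_sqrt (by linarith)]; ring
    have h2 := Real.log_le_sub_one_of_pos h0
    have h3 : 0 ≤ Real.log t := Real.log_nonneg h
    have h4 : Real.log t ≤ 2 * Real.sqrt t := by linarith
    nlinarith [Real.sq_sqrt (show 0 ≤ t by linarith)]
  have hi : 0 < t⁻¹ := inv_pos.2 ht
  rcases le_total 1 t with h | h
  · have := key t h; linarith
  · have := key t⁻¹ ((one_le_inv₀ ht).2 h)
    rw [Real.log_inv] at this
    nlinarith

lemma integrableOn_inv (a : ℂ) {E : Set ℂ} (hE : volume E < ⊤) :
    IntegrableOn (fun x => (a - x)⁻¹) E := by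
  refine ⟨(by fun_prop : Measurable _).aestronglyMeasurable, ?_⟩
  rw [hasFiniteIntegral_iff_norm]
  have := ke_set E a (ρ := 1) one_pos
  simp only [ke] at this
  simp only [norm_inv]
  refine this.trans_lt ?_
  simp only [ENNReal.add_lt_top, ENNReal.ofReal_lt_top, true_and]
  simpa using hE

lemma locInt_of_bdd {f : ℂ → ℂ} (h : ∀ R : ℝ, IntegrableOn f (ball 0 R)) : LocallyIntegrable f := by
  intro x
  refine ⟨ball 0 (‖x‖ + 1), isOpen_ball.mem_nhds (by simp), h _⟩

lemma locInt_inv : LocallyIntegrable (fun x : ℂ => x⁻¹) := by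
  apply locInt_of_bdd
  intro R
  have := (integrableOn_inv 0 (E := ball 0 R) measure_ball_lt_top).neg
  refine this.congr (ae_of_all _ fun x => ?_)
  simp

lemma log_sq_ke (x : ℂ) : ENNReal.ofReal ((Real.log ‖x‖)^2) ≤ 4 * (ENNReal.ofReal ‖x‖ + ke x) := by
  rcases eq_or_ne x 0 with h | h
  · simp [h]
  · have := log_sq_le (norm_pos_iff.2 h)
    refine (ENNReal.ofReal_le_ofReal this).trans ?_
    rw [ENNReal.ofReal_mul (by norm_num), ENNReal.ofReal_add (by positivity) (by positivity)]
    simp [ke]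

lemma locInt_log : LocallyIntegrable (fun x : ℂ => ((Real.log ‖x‖ : ℝ) : ℂ)) := by
  apply locInt_of_bdd
  intro R
  have hb : IntegrableOn (fun x : ℂ => 1 + 4 * (‖x‖ + ‖x‖⁻¹)) (ball 0 R) := by
    have h1 : IntegrableOn (fun x : ℂ => ‖x‖⁻¹) (ball (0:ℂ) R) := by
      have := (integrableOn_inv 0 (E := ball 0 R) measure_ball_lt_top).norm
      refine this.congr (ae_of_all _ fun x => ?_)
      simp
    have h2 : IntegrableOn (fun x : ℂ => ‖x‖) (ball (0:ℂ) R) :=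
      (continuous_norm.continuousOn.integrableOn_compact (isCompact_closedBall 0 R)).mono_set
        ball_subset_closedBall
    exact (integrableOn_const (by exact measure_ball_lt_top.ne)).add ((h2.add h1).const_mul 4)
  refine Integrable.mono' hb (Measurable.aestronglyMeasurable (by fun_prop)) (ae_of_all _ fun x => ?_)
  rcases eq_or_ne x 0 with h | h
  · simp [h]
  · have := log_sq_le (norm_pos_iff.2 h)
    have h2 : |Real.log ‖x‖| ≤ 1 + (Real.log ‖x‖)^2 := by
      rw [← sq_abs]; nlinarith [abs_nonneg (Real.log ‖x‖), sq_nonneg (|Real.log ‖x‖| - 1)]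
    simp only [Complex.norm_real, Real.norm_eq_abs]; linarith


lemma pompeiu_aux {v : ℂ → ℂ} (hv : IsTest univ v) : ∫ t, t⁻¹ * dbar v t = - Real.pi * v 0 := by
  obtain ⟨R, hR0, hR⟩ : ∃ R : ℝ, 0 < R ∧ ∀ x, x ∈ tsupport v → ‖x‖ < R := by
    obtain ⟨R, hR⟩ := hv.cpt.isCompact.isBounded.subset_ball 0
    refine ⟨max R 1, by positivity, fun x hx => ?_⟩
    have := hR hx
    simp at this
    exact lt_max_of_lt_left this
  set e : ℝ → ℂ := fun θ => Complex.exp (θ * Complex.I) with he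
  have hec : Continuous e := by fun_prop
  have hen : ∀ θ, ‖e θ‖ = 1 := fun θ => Complex.norm_exp_ofReal_mul_I θ
  set A : ℝ × ℝ → ℂ := fun p => fderiv ℝ v (p.1 * e p.2) (e p.2)
  set B : ℝ × ℝ → ℂ := fun p => fderiv ℝ v (p.1 * e p.2) (Complex.I * e p.2)
  have hfc : Continuous (fderiv ℝ v) := hv.smooth.continuous_fderiv (by simp)
  have hA : Continuous A := by
    refine Continuous.clm_apply (hfc.comp ?_) ?_ <;> fun_prop
  have hB : Continuous B := by
    refine Continuous.clm_apply (hfc.comp ?_) ?_ <;> fun_prop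
  have hz : ∀ r θ, R ≤ r → fderiv ℝ v ((r:ℂ) * e θ) = 0 := by
    intro r θ h
    by_contra h2
    have := hR _ (support_fderiv_subset ℝ h2)
    rw [norm_mul, hen, mul_one, Complex.norm_real, Real.norm_eq_abs] at this
    linarith [le_abs_self r]
  have hint : ∀ F : ℝ × ℝ → ℂ, Continuous F → (∀ r θ, R ≤ r → F (r, θ) = 0) →
      IntegrableOn F (Ioi (0:ℝ) ×ˢ Ioo (-Real.pi) Real.pi) := by
    intro F hF h0
    have h1 : IntegrableOn F (Icc 0 R ×ˢ Icc (-Real.pi) Real.pi) :=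
      hF.continuousOn.integrableOn_compact (isCompact_Icc.prod isCompact_Icc)
    refine IntegrableOn.of_forall_sdiff_eq_zero h1 (measurableSet_Ioi.prod measurableSet_Ioo) ?_
    rintro ⟨r, θ⟩ ⟨⟨h2, h3⟩, h4⟩
    apply h0
    by_contra h5
    exact h4 ⟨⟨le_of_lt h2, by simp at h5; exact h5.le⟩, Ioo_subset_Icc_self h3⟩
  have iA := hint A hA (fun r θ h => by simp [A, hz r θ h])
  have iB := hint B hB (fun r θ h => by simp [B, hz r θ h])
  have key : ∀ p ∈ polarCoord.target, p.1 • ((Complex.polarCoord.symm p)⁻¹ *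
      dbar v (Complex.polarCoord.symm p)) = (1/2) * A p + (Complex.I/2) * B p := by
    rintro ⟨r, θ⟩ hp
    simp only [polarCoord_target, mem_prod, mem_Ioi] at hp
    have hr : (r:ℂ) ≠ 0 := by exact_mod_cast hp.1.ne'
    have hps : Complex.polarCoord.symm (r, θ) = r * e θ := by
      rw [Complex.polarCoord_symm_apply, he]; simp [Complex.exp_mul_I]
    rw [hps]
    have hL : ∀ (L : ℂ →L[ℝ] ℂ) (x y : ℝ), L (x + y * Complex.I) = x * L 1 + y * L Complex.I := by
      intro L x y
      have : (x + y * Complex.I : ℂ) = x • (1:ℂ) + y • Complex.I := by simp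
      rw [this, map_add, map_smul, map_smul]; simp
    have e1 : e θ = (Real.cos θ : ℝ) + (Real.sin θ : ℝ) * Complex.I := by
      simp [he, Complex.exp_mul_I]
    have e2 : Complex.I * e θ = ((-Real.sin θ : ℝ) : ℂ) + (Real.cos θ : ℝ) * Complex.I := by
      rw [e1]; push_cast; ring_nf; simp; ring
    have e3 : (e θ)⁻¹ = (Real.cos θ : ℝ) - (Real.sin θ : ℝ) * Complex.I := by
      rw [he]; simp only []; rw [← Complex.exp_neg, ← neg_mul, ← Complex.ofReal_neg, Complex.exp_mul_I]
      simp; ring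
    simp only [A, B]
    rw [e2]
    conv_rhs => rw [show (fderiv ℝ v (r * e θ)) (e θ) = (fderiv ℝ v (r * e θ)) ((Real.cos θ : ℝ) + (Real.sin θ : ℝ) * Complex.I) by rw [← e1]]
    rw [hL, hL, dbar, mul_inv, e3, Complex.real_smul]
    field_simp
    push_cast
    ring_nf
    simp only [Complex.I_sq]
    ring
  rw [← Complex.integral_comp_polarCoord_symm]
  rw [setIntegral_congr_fun polarCoord.open_target.measurableSet key, polarCoord_target]
  rw [integral_add (iA.const_mul _) (iB.const_mul _), integral_const_mul, integral_const_mul]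
  have hvd : ∀ x, HasFDerivAt v (fderiv ℝ v x) x := fun x => (hv.diff x).hasFDerivAt
  have hBz : ∫ p in Ioi (0:ℝ) ×ˢ Ioo (-Real.pi) Real.pi, B p = 0 := by
    rw [Measure.volume_eq_prod, setIntegral_prod _ (by rw [← Measure.volume_eq_prod]; exact iB)]
    rw [setIntegral_eq_zero_of_forall_eq_zero]
    intro r hr
    have hr0 : (r:ℂ) ≠ 0 := by exact_mod_cast (ne_of_gt hr)
    have hd : ∀ θ ∈ uIcc (-Real.pi) Real.pi, HasDerivAt (fun θ : ℝ => v (r * e θ)) (r * B (r, θ)) θ := by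
      intro θ _
      have h1 : HasDerivAt (fun θ : ℝ => (r:ℂ) * e θ) (r * (Complex.I * e θ)) θ := by
        have : HasDerivAt (fun θ : ℝ => (θ:ℂ) * Complex.I) (1 * Complex.I) θ :=
          (Complex.ofRealCLM.hasDerivAt).mul_const _
        have := (this.cexp).const_mul (r:ℂ)
        exact this.congr_deriv (by simp only [he]; ring)
      have h2 := (hvd (r * e θ)).comp_hasDerivAt θ h1
      refine HasDerivAt.congr_deriv h2 ?_
      change fderiv ℝ v (r * e θ) (r * (Complex.I * e θ)) = r * fderiv ℝ v (r * e θ) (Complex.I * e θ)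
      rw [show (r:ℂ) * (Complex.I * e θ) = r • (Complex.I * e θ) by simp, map_smul]; simp
    have h3 := intervalIntegral.integral_eq_sub_of_hasDerivAt hd
      (Continuous.intervalIntegrable (by fun_prop) _ _)
    have h4 : e Real.pi = e (-Real.pi) := by
      simp [he, Complex.exp_pi_mul_I, Complex.exp_neg]
    rw [h4, sub_self, intervalIntegral.integral_const_mul] at h3
    have h5 := (mul_eq_zero.1 h3).resolve_left hr0
    rw [intervalIntegral.integral_of_le (by linarith [Real.pi_pos]), integral_Ioc_eq_integral_Ioo] at h5
    exact h5
  have hAz : ∫ p in Ioi (0:ℝ) ×ˢ Ioo (-Real.pi) Real.pi, A p = -(2 * Real.pi) * v 0 := by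
    rw [Measure.volume_eq_prod, ← setIntegral_prod_swap, setIntegral_prod]
    · have : ∀ θ : ℝ, ∫ r in Ioi (0:ℝ), A (r, θ) = - v 0 := by
        intro θ
        have hd : ∀ r : ℝ, HasDerivAt (fun r : ℝ => v (r * e θ)) (A (r, θ)) r := by
          intro r
          have h1 : HasDerivAt (fun r : ℝ => (r:ℂ) * e θ) (1 * (e θ)) r :=
            (Complex.ofRealCLM.hasDerivAt).mul_const _
          have h2 := (hvd (r * e θ)).comp_hasDerivAt r h1
          exact HasDerivAt.congr_deriv h2 (by simp [A])
        have hi : IntegrableOn (fun r : ℝ => A (r, θ)) (Ioi 0) := by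
          have h1 : IntegrableOn (fun r : ℝ => A (r, θ)) (Icc 0 R) :=
            ContinuousOn.integrableOn_compact isCompact_Icc (by fun_prop)
          refine IntegrableOn.of_forall_sdiff_eq_zero h1 measurableSet_Ioi ?_
          rintro r ⟨h2, h4⟩
          have : R ≤ r := by
            by_contra h5
            exact h4 ⟨le_of_lt h2, by simp at h5; exact h5.le⟩
          simp [A, hz r θ this]
        have ht : Tendsto (fun r : ℝ => v (r * e θ)) atTop (𝓝 0) := by
          refine tendsto_const_nhds.congr' ?_
          filter_upwards [eventually_ge_atTop R] with r hr
          by_contra h2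
          have := hR _ (subset_tsupport v (Ne.symm h2))
          rw [norm_mul, hen, mul_one, Complex.norm_real, Real.norm_eq_abs] at this
          linarith [le_abs_self r]
        have := integral_Ioi_of_hasDerivAt_of_tendsto (hd 0).continuousAt.continuousWithinAt
          (fun x _ => hd x) hi ht
        rw [this]; simp
      simp only [Prod.swap]
      simp only [this]
      rw [setIntegral_const]
      simp [Measure.real, Real.volume_Ioo]
      rw [ENNReal.toReal_ofReal (by linarith [Real.pi_pos])]
      left; push_cast; ring
    · rw [← Measure.volume_eq_prod] at *
      exact iA.swap
  rw [hAz, hBz]; ring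


/-- convolution with a locally integrable kernel -/
def cv (k η : ℂ → ℂ) (x : ℂ) : ℂ := ∫ t, k t * η (x - t)

lemma cv_eq (k η : ℂ → ℂ) : cv k η = convolution k η (ContinuousLinearMap.mul ℝ ℂ) volume := by
  ext x; simp [cv, convolution]

lemma cv_eq' (k η : ℂ → ℂ) (x : ℂ) : cv k η x = ∫ t, k (x - t) * η t := by
  unfold cv
  rw [← integral_sub_left_eq_self (fun t => k (x - t) * η t) volume x]
  simp

lemma cv_smooth {k η : ℂ → ℂ} (hk : LocallyIntegrable k) (hη : IsTest univ η) :
    ContDiff ℝ ∞ (cv k η) := by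
  rw [cv_eq]
  exact hη.cpt.contDiff_convolution_right (n := ⊤) _ hk hη.smooth

lemma cv_int {k η : ℂ → ℂ} (hk : LocallyIntegrable k) (hc : HasCompactSupport η)
    (hη : Continuous η) (x : ℂ) : Integrable (fun t => k t * η (x - t)) := by
  have := (hc.convolutionExists_right (ContinuousLinearMap.mul ℝ ℂ) hk hη) x
  simpa [ConvolutionExistsAt] using this

lemma cv_fderiv {k η : ℂ → ℂ} (hk : LocallyIntegrable k) (hη : IsTest univ η) (x v : ℂ) :
    fderiv ℝ (cv k η) x v = cv k (fun y => fderiv ℝ η y v) x := by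
  rw [cv_eq]
  have hs : ContDiff ℝ 1 η := hη.smooth.of_le (by simp)
  rw [(hη.cpt.hasFDerivAt_convolution_right (ContinuousLinearMap.mul ℝ ℂ) hk hs x).fderiv]
  unfold convolution cv
  have hi : Integrable (fun t => (((ContinuousLinearMap.mul ℝ ℂ).precompR ℂ) (k t)) (fderiv ℝ η (x - t))) :=
    ((hη.cpt.fderiv ℝ).convolutionExists_right ((ContinuousLinearMap.mul ℝ ℂ).precompR ℂ) hk
      (hs.continuous_fderiv one_ne_zero)) x
  rw [ContinuousLinearMap.integral_apply hi]
  rfl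

lemma cv_lin {k : ℂ → ℂ} (hk : LocallyIntegrable k) {η ξ : ℂ → ℂ} (hη : IsTest univ η)
    (hξ : IsTest univ ξ) (a b x : ℂ) :
    cv k (fun y => a * η y + b * ξ y) x = a * cv k η x + b * cv k ξ x := by
  unfold cv
  rw [← integral_const_mul, ← integral_const_mul, ← integral_add]
  · congr 1; ext t; ring
  · exact (cv_int hk hη.cpt hη.smooth.continuous x).const_mul _
  · exact (cv_int hk hξ.cpt hξ.smooth.continuous x).const_mul _

lemma IsTest.fd {D : Set ℂ} {η : ℂ → ℂ} (hη : IsTest D η) (v : ℂ) :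
    IsTest D (fun y => fderiv ℝ η y v) :=
  hη.of_tsupport (fderiv_apply_contDiff hη.smooth v) (tsupport_fderiv_apply η v)

lemma cv_dbar {k η : ℂ → ℂ} (hk : LocallyIntegrable k) (hη : IsTest univ η) (x : ℂ) :
    dbar (cv k η) x = cv k (dbar η) x := by
  have : dbar η = fun y => (1/2) * fderiv ℝ η y 1 + (Complex.I/2) * fderiv ℝ η y Complex.I := by
    ext y; simp only [dbar]; ring
  rw [this, cv_lin hk (hη.fd _) (hη.fd _), dbar, cv_fderiv hk hη, cv_fderiv hk hη]; ring

lemma cv_dee {k η : ℂ → ℂ} (hk : LocallyIntegrable k) (hη : IsTest univ η) (x : ℂ) :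
    dee (cv k η) x = cv k (dee η) x := by
  have : dee η = fun y => (1/2) * fderiv ℝ η y 1 + (-Complex.I/2) * fderiv ℝ η y Complex.I := by
    ext y; simp only [dee]; ring
  rw [this, cv_lin hk (hη.fd _) (hη.fd _), dee, cv_fderiv hk hη, cv_fderiv hk hη]; ring

lemma fderiv_refl {η : ℂ → ℂ} (hη : IsTest univ η) (x t v : ℂ) :
    fderiv ℝ (fun t => η (x - t)) t v = - fderiv ℝ η (x - t) v := by
  have h := (hη.diff (x - t)).hasFDerivAt.comp t ((hasFDerivAt_id (𝕜 := ℝ) t).const_sub x)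
  have h2 : fderiv ℝ (fun t => η (x - t)) t = _ := h.fderiv
  rw [h2]; simp

lemma IsTest.reflect {η : ℂ → ℂ} (hη : IsTest univ η) (x : ℂ) : IsTest univ (fun t => η (x - t)) :=
  ⟨hη.smooth.comp (contDiff_const.sub contDiff_id),
   hη.cpt.comp_homeomorph (Homeomorph.subLeft x), subset_univ _⟩

lemma cv_inv_dbar {η : ℂ → ℂ} (hη : IsTest univ η) (x : ℂ) :
    cv (fun t => t⁻¹) (dbar η) x = Real.pi * η x := by
  have h := pompeiu_aux (hη.reflect x)
  have e : ∀ t, dbar (fun t => η (x - t)) t = - dbar η (x - t) := by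
    intro t; simp only [dbar, fderiv_refl hη]; ring
  simp only [e, mul_neg, integral_neg, sub_zero] at h
  unfold cv
  linear_combination -h

lemma log_parts {v : ℂ → ℂ} (hv : IsTest univ v) :
    ∫ t : ℂ, ((Real.log ‖t‖ : ℝ) : ℂ) * dee v t = -(1/2) * ∫ t, t⁻¹ * v t := by
  set δ : ℕ → ℝ := fun n => 1 / ((n:ℝ) + 1) with hδ
  have hδ0 : ∀ n, 0 < δ n := fun n => by simp only [hδ]; positivity
  have hδ1 : ∀ n, δ n ≤ 1 := fun n => by
    simp only [hδ]; rw [div_le_one (by positivity)]; linarith [(Nat.cast_nonneg n : (0:ℝ) ≤ n)]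
  have hδt : Tendsto δ atTop (𝓝 0) := tendsto_one_div_add_atTop_nhds_zero_nat
  set F : ℕ → ℂ → ℂ := fun n t => (((1/2) * Real.log (‖t‖^2 + δ n) : ℝ) : ℂ)
  have hpos : ∀ n (t : ℂ), 0 < ‖t‖^2 + δ n := fun n t => by have := hδ0 n; positivity
  have hFs : ∀ n, ContDiff ℝ 1 (F n) := by
    intro n
    refine Complex.ofRealCLM.contDiff.comp (contDiff_const.mul ?_)
    exact ((contDiff_norm_sq ℝ).add contDiff_const).log (fun t => (hpos n t).ne')
  have hFd : ∀ n t, dee (F n) t = (1/2) * (cj t / ((‖t‖^2 + δ n : ℝ) : ℂ)) := by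
    intro n t
    have h0 : HasFDerivAt (fun x : ℂ => ‖x‖^2) (2 • (innerSL ℝ t)) t := (hasStrictFDerivAt_norm_sq t).hasFDerivAt
    have h1 : HasFDerivAt (fun x : ℂ => ‖x‖^2 + δ n) (2 • (innerSL ℝ t)) t := h0.add_const _
    have h2 := (h1.log (hpos n t).ne').const_mul (1/2)
    have h3 := Complex.ofRealCLM.hasFDerivAt.comp t h2
    have h4 : fderiv ℝ (F n) t = _ := h3.fderiv
    have hc : cj t = t.re - t.im * Complex.I := by
      simp [cj, Complex.ext_iff]
    simp only [dee, h4, hc]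
    simp [Complex.inner, innerSL_apply_apply]
    have := (hpos n t).ne'
    have h5 : ((‖t‖:ℂ)^2 + δ n) ≠ 0 := by exact_mod_cast this
    field_simp
  have hp : ∀ n, ∫ t, F n t * dee v t = - ∫ t, (1/2) * (cj t / ((‖t‖^2 + δ n : ℝ) : ℂ)) * v t := by
    intro n
    rw [parts_dee isOpen_univ (hFs n).contDiffOn hv]
    simp only [hFd]
  have hlim1 : Tendsto (fun n => ∫ t, F n t * dee v t) atTop
      (𝓝 (∫ t : ℂ, ((Real.log ‖t‖ : ℝ) : ℂ) * dee v t)) := by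
    have hi : Integrable (fun t : ℂ => (((Real.log ‖t‖ : ℝ) : ℂ)) * dee v t) := by
      have := cv_int locInt_log (hv.dee.reflect 0).cpt (hv.dee.reflect 0).smooth.continuous 0
      simpa using this
    have hi2 : Integrable (fun t : ℂ => (((‖t‖ + 1 : ℝ) : ℂ)) * dee v t) :=
      integrable_mul_of_supp isOpen_univ (by fun_prop) hv.dee.smooth.continuous hv.dee.cpt (subset_univ _)
    refine tendsto_integral_of_dominated_convergence _ (fun n => ?_) (hi.norm.add hi2.norm) (fun n => ?_) ?_
    · exact ((hFs n).continuous.mul hv.dee.smooth.continuous).aestronglyMeasurable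
    · have h0 : ∀ᵐ t : ℂ, t ≠ 0 := by simp [ae_iff]
      filter_upwards [h0] with t ht
      have ht0 : 0 < ‖t‖ := norm_pos_iff.2 ht
      simp only [Pi.add_apply, norm_mul, ← add_mul]
      gcongr
      simp only [F, Complex.norm_real, Real.norm_eq_abs]
      rw [abs_of_nonneg (show 0 ≤ ‖t‖ + 1 by positivity)]
      have hl : Real.log ‖t‖ ≤ (1/2) * Real.log (‖t‖^2 + δ n) := by
        have : Real.log (‖t‖^2) ≤ Real.log (‖t‖^2 + δ n) :=
          Real.log_le_log (by positivity) (by linarith [hδ0 n])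
        rw [Real.log_pow] at this; push_cast at this; linarith
      have hu : (1/2) * Real.log (‖t‖^2 + δ n) ≤ ‖t‖ + 1 := by
        have h1 : Real.log (‖t‖^2 + δ n) ≤ Real.log ((‖t‖+1)^2) :=
          Real.log_le_log (hpos n t) (by nlinarith [hδ1 n])
        rw [Real.log_pow] at h1; push_cast at h1
        have := Real.log_le_sub_one_of_pos (show 0 < ‖t‖ + 1 by positivity)
        linarith
      rw [abs_le]
      constructor
      · have := neg_abs_le (Real.log ‖t‖); linarith
      · have := abs_nonneg (Real.log ‖t‖); linarith
    · have h0 : ∀ᵐ t : ℂ, t ≠ 0 := by simp [ae_iff]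
      filter_upwards [h0] with t ht
      have ht0 : 0 < ‖t‖ := norm_pos_iff.2 ht
      refine Tendsto.mul_const _ ?_
      refine (Complex.continuous_ofReal.tendsto _).comp ?_
      have h1 : Tendsto (fun n => ‖t‖^2 + δ n) atTop (𝓝 (‖t‖^2)) := by
        simpa using tendsto_const_nhds.add hδt
      have h2 := ((Real.continuousAt_log (by positivity : ‖t‖^2 ≠ 0)).tendsto.comp h1).const_mul (1/2)
      rw [Real.log_pow] at h2
      have h3 : (1/2 : ℝ) * (((2:ℕ):ℝ) * Real.log ‖t‖) = Real.log ‖t‖ := by push_cast; ring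
      rw [h3] at h2
      exact h2
  have hlim2 : Tendsto (fun n => - ∫ t, (1/2) * (cj t / ((‖t‖^2 + δ n : ℝ) : ℂ)) * v t) atTop
      (𝓝 (- ∫ t : ℂ, (1/2) * t⁻¹ * v t)) := by
    refine Tendsto.neg ?_
    have hi : Integrable (fun t : ℂ => t⁻¹ * v t) := by
      have := cv_int locInt_inv (hv.reflect 0).cpt (hv.reflect 0).smooth.continuous 0
      simpa using this
    refine tendsto_integral_of_dominated_convergence _ (fun n => ?_) hi.norm (fun n => ?_) ?_
    · refine Measurable.aestronglyMeasurable ?_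
      have : Measurable v := hv.smooth.continuous.measurable
      have h2 : Continuous cj := Complex.continuous_conj
      have h3 := h2.measurable
      fun_prop
    · refine ae_of_all _ fun t => ?_
      rw [norm_mul, norm_mul, norm_mul]
      refine mul_le_mul_of_nonneg_right ?_ (norm_nonneg _)
      rw [norm_div (cj t), norm_inv, RCLike.norm_conj, Complex.norm_real, Real.norm_eq_abs,
        abs_of_pos (hpos n t)]
      rcases eq_or_ne t 0 with h | h
      · simp [h]
      have ht0 : 0 < ‖t‖ := norm_pos_iff.2 h
      have h1 : ‖t‖ / (‖t‖^2 + δ n) ≤ ‖t‖⁻¹ := by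
        rw [div_le_iff₀ (hpos n t)]
        field_simp
        linarith [hδ0 n]
      have h2 : ‖(1/2 : ℂ)‖ ≤ 1 := by norm_num
      have h3 : 0 ≤ ‖t‖ / (‖t‖^2 + δ n) := div_nonneg ht0.le (hpos n t).le
      calc _ ≤ 1 * (‖t‖ / (‖t‖^2 + δ n)) := by gcongr
        _ ≤ _ := by simpa using h1
    · have h0 : ∀ᵐ t : ℂ, t ≠ 0 := by simp [ae_iff]
      filter_upwards [h0] with t ht
      have ht0 : 0 < ‖t‖ := norm_pos_iff.2 ht
      refine Tendsto.mul_const _ (Tendsto.const_mul _ ?_)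
      have h1 : Tendsto (fun n => ‖t‖^2 + δ n) atTop (𝓝 (‖t‖^2)) := by
        simpa using tendsto_const_nhds.add hδt
      have h2 := (Complex.continuous_ofReal.tendsto _).comp h1
      have h3 : ((‖t‖^2 : ℝ) : ℂ) ≠ 0 := by exact_mod_cast (by positivity : ‖t‖^2 ≠ 0)
      have h4 := (tendsto_const_nhds (x := cj t)).div h2 h3
      have h5 : cj t / ((‖t‖^2 : ℝ) : ℂ) = t⁻¹ := by
        symm
        rw [eq_div_iff h3, inv_mul_eq_div, div_eq_iff ht, mul_comm (cj t), Complex.mul_conj']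
        push_cast; rfl
      rw [h5] at h4
      exact h4
  have := tendsto_nhds_unique hlim1 (by simpa only [hp] using hlim2)
  rw [this]
  simp_rw [mul_assoc]
  rw [integral_const_mul]; ring

/-- log kernel -/
def lg (x : ℂ) : ℂ := (((2 / Real.pi) * Real.log ‖x‖ : ℝ) : ℂ)

lemma locInt_lg : LocallyIntegrable lg := by
  have := locInt_log.smul (c := (2 / Real.pi : ℝ))
  convert this using 1
  ext x; simp [lg]

lemma cv_lg_dee_dbar {η : ℂ → ℂ} (hη : IsTest univ η) (x : ℂ) :
    dee (dbar (cv lg η)) x = η x := by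
  have h1 : dbar (cv lg η) = cv lg (dbar η) := funext fun y => cv_dbar locInt_lg hη y
  rw [h1, cv_dee locInt_lg hη.dbar]
  have h := log_parts (hη.dbar.reflect x)
  have e : ∀ t, dee (fun t => dbar η (x - t)) t = - dee (dbar η) (x - t) := by
    intro t; simp only [dee, fderiv_refl hη.dbar]; ring
  have h2 := cv_inv_dbar hη x
  unfold cv at h2
  rw [h2] at h
  simp only [e, mul_neg, integral_neg] at h
  have hpi : (Real.pi : ℂ) ≠ 0 := by exact_mod_cast Real.pi_pos.ne'
  have h3 : cv lg (dee (dbar η)) x = (2 / Real.pi) * ∫ t : ℂ, ((Real.log ‖t‖ : ℝ) : ℂ) * dee (dbar η) (x - t) := by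
    unfold cv
    rw [← integral_const_mul]; congr 1; ext t; simp [lg]; ring
  rw [h3, show ∫ t : ℂ, ((Real.log ‖t‖ : ℝ) : ℂ) * dee (dbar η) (x - t) = (1/2) * (Real.pi * η x) by
    linear_combination -h]
  field_simp


lemma exists_bump (c : ℂ) {r R : ℝ} (hr : 0 < r) (hR : r < R) :
    ∃ χ : ℂ → ℂ, ContDiff ℝ ∞ χ ∧ tsupport χ ⊆ closedBall c R ∧ (∀ x ∈ closedBall c r, χ x = 1) ∧
      (∀ x, ‖χ x‖ ≤ 1) ∧ HasCompactSupport χ := by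
  let b : ContDiffBump c := ⟨r, R, hr, hR⟩
  have hts : tsupport (fun x => ((b x : ℝ) : ℂ)) ⊆ tsupport b := closure_mono (by
    intro a ha h; apply ha; simp [h])
  refine ⟨fun x => ((b x : ℝ) : ℂ), Complex.ofRealCLM.contDiff.comp b.contDiff, ?_, ?_, ?_, ?_⟩
  · exact hts.trans b.tsupport_eq.subset
  · intro x hx
    simp [b.one_of_mem_closedBall hx]
  · intro x
    rw [Complex.norm_real, Real.norm_eq_abs, abs_of_nonneg b.nonneg]
    exact b.le_one
  · exact b.hasCompactSupport.of_isClosed_subset (isClosed_tsupport _) hts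

lemma fub {k η g : ℂ → ℂ} (hk : LocallyIntegrable k) (hkm : Measurable k) (hη : Continuous η)
    (hc : HasCompactSupport η) (hg : Integrable g) {R : ℝ} (hR : ∀ x, R ≤ ‖x‖ → g x = 0) :
    Integrable (fun p : ℂ × ℂ => k (p.1 - p.2) * η p.1 * g p.2) (volume.prod volume) := by
  obtain ⟨R', hR'⟩ := hc.isCompact.isBounded.subset_ball 0
  obtain ⟨M, hM⟩ := hη.bounded_above_of_compact_support hc
  refine ⟨?_, ?_⟩
  · refine AEStronglyMeasurable.mul ?_ hg.1.comp_snd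
    exact ((hkm.comp (measurable_fst.sub measurable_snd)).mul
      (hη.measurable.comp measurable_fst)).aestronglyMeasurable
  · rw [HasFiniteIntegral, lintegral_prod_symm]
    swap
    · refine AEMeasurable.enorm ?_
      exact (((hkm.comp (measurable_fst.sub measurable_snd)).mul
        (hη.measurable.comp measurable_fst)).aemeasurable.mul hg.1.comp_snd.aemeasurable)
    have hb : ∀ y, ∫⁻ x, ‖k (x - y) * η x * g y‖ₑ ≤
        (ENNReal.ofReal M * ∫⁻ x in ball (0:ℂ) (R' + R), ‖k x‖ₑ) * ‖g y‖ₑ := by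
      intro y
      by_cases hy : R ≤ ‖y‖
      · simp [hR y hy]
      push Not at hy
      simp_rw [enorm_mul]
      rw [lintegral_mul_const' _ _ enorm_ne_top]
      gcongr
      rw [← lintegral_indicator measurableSet_ball, ← lintegral_const_mul' _ _ ENNReal.ofReal_ne_top,
        ← lintegral_sub_right_eq_self (fun x => ENNReal.ofReal M * (ball (0:ℂ) (R' + R)).indicator
          (fun x => ‖k x‖ₑ) x) y]
      refine lintegral_mono fun x => ?_
      by_cases hx : x ∈ tsupport η
      · have h1 := hR' hx
        have h2 : x - y ∈ ball (0:ℂ) (R' + R) := by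
          simp only [mem_ball, dist_zero_right] at h1 ⊢
          linarith [norm_sub_le x y]
        rw [indicator_of_mem h2, mul_comm]
        gcongr
        rw [← ofReal_norm_eq_enorm]
        exact ENNReal.ofReal_le_ofReal (hM x)
      · simp [image_eq_zero_of_notMem_tsupport hx]
    refine (lintegral_mono hb).trans_lt ?_
    have h3 : IntegrableOn k (ball (0:ℂ) (R' + R)) :=
      (hk.integrableOn_isCompact (isCompact_closedBall 0 (R'+R))).mono_set ball_subset_closedBall
    rw [lintegral_const_mul'' _ hg.1.enorm]
    exact ENNReal.mul_lt_top (ENNReal.mul_lt_top ENNReal.ofReal_lt_top h3.2) hg.2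

/-- swap identity -/
lemma fub_swap {k η g : ℂ → ℂ} (hk : LocallyIntegrable k) (hkm : Measurable k) (hη : Continuous η)
    (hc : HasCompactSupport η) (hg : Integrable g) {R : ℝ} (hR : ∀ x, R ≤ ‖x‖ → g x = 0) :
    ∫ x, (∫ y, k (x - y) * g y) * η x = ∫ y, (∫ x, k (x - y) * η x) * g y := by
  have h := integral_integral_swap (f := fun x y => k (x - y) * η x * g y)
    (fub hk hkm hη hc hg hR)
  simp_rw [← integral_mul_const]
  refine Eq.trans ?_ h
  congr 1; ext x; congr 1; ext y; ring

lemma fub_int {k η g : ℂ → ℂ} (hk : LocallyIntegrable k) (hkm : Measurable k) (hη : Continuous η)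
    (hc : HasCompactSupport η) (hg : Integrable g) {R : ℝ} (hR : ∀ x, R ≤ ‖x‖ → g x = 0) :
    Integrable (fun x => (∫ y, k (x - y) * g y) * η x) := by
  have h := (fub hk hkm hη hc hg hR).integral_prod_left
  refine h.congr (ae_of_all _ fun x => ?_)
  simp only []
  rw [← integral_mul_const]
  congr 1; ext y; ring

lemma fub_locInt {k g : ℂ → ℂ} (hk : LocallyIntegrable k) (hkm : Measurable k)
    (hg : Integrable g) {R : ℝ} (hR : ∀ x, R ≤ ‖x‖ → g x = 0) :
    LocallyIntegrable (fun x => (∫ y, k (x - y) * g y)) := by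
  apply locInt_of_bdd
  intro r
  obtain ⟨χ, h1, h2, h3, h4, h5⟩ := exists_bump 0 (r := max r 1) (R := max r 1 + 1) (by positivity) (by simp)
  have := (fub_int hk hkm h1.continuous h5 hg hR).integrableOn (s := ball (0:ℂ) r)
  refine this.congr_fun (fun x hx => ?_) measurableSet_ball
  simp only []
  rw [h3 x, mul_one]
  simp only [mem_ball, dist_zero_right] at hx
  simp [hx.le]

/-- Cauchy transform -/
def Cau (g : ℂ → ℂ) (a : ℂ) : ℂ := (Real.pi : ℂ)⁻¹ * ∫ ζ, (a - ζ)⁻¹ * g ζ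

lemma Cau_locInt {g : ℂ → ℂ} (hg : Integrable g) {R : ℝ} (hR : ∀ x, R ≤ ‖x‖ → g x = 0) :
    LocallyIntegrable (Cau g) := by
  have := (fub_locInt locInt_inv (by fun_prop) hg hR).smul (c := (Real.pi : ℂ)⁻¹)
  exact this

/-- dual of Cau: v = - Cau' -/
lemma Cau_swap {g η : ℂ → ℂ} (hg : Integrable g) {R : ℝ} (hR : ∀ x, R ≤ ‖x‖ → g x = 0)
    (hη : Continuous η) (hc : HasCompactSupport η) :
    ∫ x, Cau g x * η x = - ∫ x, Cau η x * g x := by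
  unfold Cau
  simp_rw [mul_assoc, integral_const_mul]
  rw [fub_swap locInt_inv (by fun_prop) hη hc hg hR, ← mul_neg, ← integral_neg]
  congr 2; ext y
  rw [← neg_mul, ← integral_neg]
  congr 2; ext x
  rw [← neg_mul, ← inv_neg]; congr 2; ring

lemma Cau_test {η : ℂ → ℂ} (hη : IsTest univ η) : ContDiff ℝ ∞ (Cau η) ∧ ∀ x, dbar (Cau η) x = η x := by
  have e : Cau η = fun x => (Real.pi : ℂ)⁻¹ * cv (fun t => t⁻¹) η x := by
    ext x; rw [cv_eq']; rfl
  have hs := cv_smooth locInt_inv hη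
  constructor
  · rw [e]; exact contDiff_const.mul hs
  · intro x
    rw [e, dbar_mul (by fun_prop) ((hs.differentiable (by simp)) x), cv_dbar locInt_inv hη,
      cv_inv_dbar hη, dbar_hol (by fun_prop)]
    have : (Real.pi : ℂ) ≠ 0 := by exact_mod_cast Real.pi_ne_zero
    field_simp; simp

/-- Pompeiu -/
lemma Cau_dbar {η : ℂ → ℂ} (hη : IsTest univ η) (x : ℂ) : Cau (dbar η) x = η x := by
  have : Cau (dbar η) x = (Real.pi : ℂ)⁻¹ * cv (fun t => t⁻¹) (dbar η) x := by
    rw [cv_eq']; rfl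
  rw [this, cv_inv_dbar hη]
  have : (Real.pi : ℂ) ≠ 0 := by exact_mod_cast Real.pi_ne_zero
  field_simp


/-- weakly holomorphic -/
def WH (D : Set ℂ) (f : ℂ → ℂ) : Prop := ∀ η, IsTest D η → ∫ a, f a * dbar η a = 0

lemma int_mul_cont {f χ : ℂ → ℂ} (hf : Integrable f) (hχ : Continuous χ) {R : ℝ}
    (hR : ∀ x, R ≤ ‖x‖ → f x = 0) : Integrable (fun x => f x * χ x) := by
  obtain ⟨C, hC⟩ := (isCompact_closedBall (0:ℂ) R).exists_bound_of_continuousOn hχ.continuousOn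
  refine (hf.norm.mul_const C).mono' (hf.1.mul hχ.aestronglyMeasurable) (ae_of_all _ fun x => ?_)
  rw [norm_mul]
  by_cases hx : R ≤ ‖x‖
  · simp [hR x hx]
  · gcongr
    exact hC x (by simp; linarith)

/-- Lemma H -/
lemma lemH {D' D'' : Set ℂ} {f χ : ℂ → ℂ} (hf : Integrable f) {R : ℝ}
    (hR : ∀ x, R ≤ ‖x‖ → f x = 0) (hw : WH D' f) (hχ : ContDiff ℝ ∞ χ)
    (hs : tsupport χ ∩ D'' ⊆ D') :
    WH D'' (fun x => χ x * f x - Cau (fun x => f x * dbar χ x) x) := by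
  intro η hη
  have hη' : IsTest univ η := hη.mono (subset_univ _)
  have ht : IsTest D' (fun x => χ x * η x) := by
    refine ⟨hχ.mul hη.smooth, hη.cpt.mul_left, fun x hx => hs ⟨?_, hη.supp ?_⟩⟩
    · exact tsupport_mul_subset_left hx
    · exact tsupport_mul_subset_right hx
  have h1 := hw _ ht
  have hg : Integrable (fun x => f x * dbar χ x) :=
    int_mul_cont hf (dbar_contDiff hχ).continuous hR
  have hgR : ∀ x, R ≤ ‖x‖ → f x * dbar χ x = 0 := fun x hx => by simp [hR x hx]
  have h2 := Cau_swap hg hgR (dbar_contDiff hη.smooth).continuous (hη.dbar.cpt)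
  have i1 : Integrable (fun x => f x * (χ x * dbar η x)) :=
    int_mul_cont hf (hχ.continuous.mul (dbar_contDiff hη.smooth).continuous) hR
  have i2 : Integrable (fun x => f x * (dbar χ x * η x)) :=
    int_mul_cont hf ((dbar_contDiff hχ).continuous.mul hη.smooth.continuous) hR
  have h3 : ∀ x, f x * dbar (fun x => χ x * η x) x = f x * (χ x * dbar η x) + f x * (dbar χ x * η x) := by
    intro x
    rw [dbar_mul ((hχ.differentiable (by simp)) x) (hη.diff x)]; ring
  simp_rw [h3] at h1
  rw [integral_add i1 i2] at h1
  simp_rw [Cau_dbar hη'] at h2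
  have i3 : Integrable (fun x => Cau (fun x => f x * dbar χ x) x * dbar η x) := by
    have := (fub_int locInt_inv (by fun_prop) (dbar_contDiff hη.smooth).continuous (hη.dbar.cpt) hg hgR).const_mul (Real.pi : ℂ)⁻¹
    refine this.congr (ae_of_all _ fun x => ?_)
    simp only [Cau]; ring
  have e : ∀ x, (χ x * f x - Cau (fun x => f x * dbar χ x) x) * dbar η x =
    f x * (χ x * dbar η x) - Cau (fun x => f x * dbar χ x) x * dbar η x := fun x => by ring
  simp_rw [e]
  rw [integral_sub i1 i3, h2, sub_neg_eq_add, ← h1]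
  congr 2; ext x; ring

lemma weyl_loc {D : Set ℂ} {f χ : ℂ → ℂ} (hf : Integrable f) {R : ℝ}
    (hR : ∀ x, R ≤ ‖x‖ → f x = 0) (hw : WH D f) (hχ : IsTest D χ) :
    (fun x => χ x * f x) =ᵐ[volume] Cau (fun x => f x * dbar χ x) := by
  have hg : Integrable (fun x => f x * dbar χ x) :=
    int_mul_cont hf (dbar_contDiff hχ.smooth).continuous hR
  have hgR : ∀ x, R ≤ ‖x‖ → f x * dbar χ x = 0 := fun x hx => by simp [hR x hx]
  have hi : Integrable (fun x => χ x * f x) := by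
    refine (int_mul_cont hf hχ.smooth.continuous hR).congr (ae_of_all _ fun x => by simp [mul_comm])
  have key : ∀ᵐ x, (χ x * f x - Cau (fun x => f x * dbar χ x) x) = 0 := by
    refine ae_eq_zero_of_integral_contDiff_smul_eq_zero
      (hi.locallyIntegrable.sub (Cau_locInt hg hgR)) ?_
    intro g0 hg0 hgc
    set η : ℂ → ℂ := fun x => ((g0 x : ℝ) : ℂ) with hη0
    have hη : IsTest univ η := ⟨Complex.ofRealCLM.contDiff.comp hg0,
      hgc.comp_left (g := fun x : ℝ => (x : ℂ)) (by simp), subset_univ _⟩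
    obtain ⟨hus, hud⟩ := Cau_test hη
    have ht : IsTest D (fun x => χ x * Cau η x) :=
      ⟨hχ.smooth.mul hus, hχ.cpt.mul_right, (tsupport_mul_subset_left).trans hχ.supp⟩
    have h1 := hw _ ht
    have h3 : ∀ x, f x * dbar (fun x => χ x * Cau η x) x =
        f x * (χ x * η x) + f x * (dbar χ x * Cau η x) := by
      intro x
      rw [dbar_mul (hχ.diff x) ((hus.differentiable (by simp)) x), hud]; ring
    have i1 : Integrable (fun x => f x * (χ x * η x)) :=
      int_mul_cont hf (hχ.smooth.continuous.mul hη.smooth.continuous) hR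
    have i2 : Integrable (fun x => f x * (dbar χ x * Cau η x)) :=
      int_mul_cont hf ((dbar_contDiff hχ.smooth).continuous.mul hus.continuous) hR
    simp_rw [h3] at h1
    rw [integral_add i1 i2] at h1
    have h2 := Cau_swap hg hgR hη.smooth.continuous hη.cpt
    have i3 : Integrable (fun x => Cau (fun x => f x * dbar χ x) x * η x) := by
      have := (fub_int locInt_inv (by fun_prop) hη.smooth.continuous (hη.cpt) hg hgR).const_mul (Real.pi : ℂ)⁻¹
      refine this.congr (ae_of_all _ fun x => ?_)
      simp only [Cau]; ring
    have e : ∀ x, g0 x • (χ x * f x - Cau (fun x => f x * dbar χ x) x) =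
      f x * (χ x * η x) - Cau (fun x => f x * dbar χ x) x * η x := fun x => by
        simp only [hη0, Complex.real_smul]; ring
    simp_rw [e]
    rw [integral_sub i1 i3, h2, sub_neg_eq_add, ← h1]
    congr 2; ext x; ring
  filter_upwards [key] with x hx
  linear_combination hx

lemma Cau_hol {g : ℂ → ℂ} (hg : Integrable g) {c : ℂ} {r : ℝ} (h0 : ∀ x ∈ ball c r, g x = 0) :
    DifferentiableOn ℂ (Cau g) (ball c r) := by
  intro a ha
  apply DifferentiableAt.differentiableWithinAt
  unfold Cau
  refine DifferentiableAt.const_mul ?_ _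
  set ε := (r - dist a c) / 2 with hε
  have hε0 : 0 < ε := by rw [mem_ball] at ha; simp only [hε]; linarith
  have hfar : ∀ x ∈ ball a ε, ∀ ζ, g ζ ≠ 0 → ε ≤ ‖x - ζ‖ := by
    intro x hx ζ hζ
    have h1 : ζ ∉ ball c r := fun h => hζ (h0 ζ h)
    rw [mem_ball, not_lt] at h1
    rw [mem_ball] at hx
    have := dist_triangle ζ x c
    have := dist_triangle x a c
    rw [← dist_eq_norm, dist_comm]
    simp only [hε] at hx ⊢; linarith
  refine (hasDerivAt_integral_of_dominated_loc_of_deriv_le (𝕜 := ℂ)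
    (F := fun a ζ => (a - ζ)⁻¹ * g ζ) (F' := fun a ζ => -((a - ζ)^2)⁻¹ * g ζ) (s := ball a ε)
    (bound := fun ζ => (ε^2)⁻¹ * ‖g ζ‖) (ball_mem_nhds a hε0) ?_ ?_ ?_ ?_ ?_ ?_).2.differentiableAt
  · refine Eventually.of_forall fun x => ?_
    exact (by fun_prop : Measurable (fun ζ => (x - ζ)⁻¹)).aestronglyMeasurable.mul hg.1
  · refine (hg.norm.const_mul ε⁻¹).mono'
      ((by fun_prop : Measurable (fun ζ => (a - ζ)⁻¹)).aestronglyMeasurable.mul hg.1)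
      (ae_of_all _ fun ζ => ?_)
    by_cases hz : g ζ = 0
    · simp [hz]
    rw [norm_mul, norm_inv]
    gcongr
    exact hfar a (mem_ball_self hε0) ζ hz
  · exact (by fun_prop : Measurable (fun ζ => -((a - ζ)^2)⁻¹)).aestronglyMeasurable.mul hg.1
  · refine ae_of_all _ fun ζ x hx => ?_
    by_cases hz : g ζ = 0
    · simp [hz]
    rw [norm_mul, norm_neg, norm_inv, norm_pow]
    have := hfar x hx ζ hz
    gcongr
  · exact hg.norm.const_mul _
  · refine ae_of_all _ fun ζ x hx => ?_
    by_cases hz : g ζ = 0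
    · simp [hz, hasDerivAt_const]
    have hne : x - ζ ≠ 0 := by
      intro h
      have := hfar x hx ζ hz
      rw [h, norm_zero] at this; linarith
    have := (((hasDerivAt_id x).sub_const ζ).inv hne).mul_const (g ζ)
    simpa [neg_div] using this

lemma weyl {D : Set ℂ} (hD : IsOpen D) {f : ℂ → ℂ} (hf : Integrable f) {R : ℝ}
    (hR : ∀ x, R ≤ ‖x‖ → f x = 0) (hw : WH D f) :
    ∃ F : ℂ → ℂ, DifferentiableOn ℂ F D ∧ f =ᵐ[volume.restrict D] F := by
  have loc : ∀ x ∈ D, ∃ r > 0, ball x r ⊆ D ∧ ∃ G : ℂ → ℂ, DifferentiableOn ℂ G (ball x r) ∧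
      f =ᵐ[volume.restrict (ball x r)] G := by
    intro x hx
    obtain ⟨ρ, hρ, hb⟩ := Metric.isOpen_iff.1 hD x hx
    obtain ⟨χ, h1, h2, h3, h4, h5⟩ := exists_bump x (r := ρ/4) (R := ρ/2) (by positivity) (by linarith)
    have hχ : IsTest D χ := ⟨h1, h5, h2.trans ((closedBall_subset_ball (by linarith)).trans hb)⟩
    refine ⟨ρ/4, by positivity, (ball_subset_ball (by linarith)).trans hb,
      Cau (fun x => f x * dbar χ x), Cau_hol (int_mul_cont hf (dbar_contDiff h1).continuous hR) ?_, ?_⟩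
    · intro y hy
      have : χ =ᶠ[𝓝 y] fun _ => 1 := by
        filter_upwards [isOpen_ball.mem_nhds hy] with t ht using h3 t (ball_subset_closedBall ht)
      have : dbar χ y = 0 := by
        simp [dbar, this.fderiv_eq]
      simp [this]
    · filter_upwards [ae_restrict_of_ae (weyl_loc hf hR hw hχ), ae_restrict_mem measurableSet_ball] with y hy hm
      rw [← hy, h3 y (ball_subset_closedBall hm), one_mul]
  choose! r hr hrD G hG hfG using loc
  have hcomp : ∀ x ∈ D, ∀ y ∈ D, EqOn (G x) (G y) (ball x (r x) ∩ ball y (r y)) := by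
    intro x hx y hy
    refine Measure.eqOn_open_of_ae_eq (μ := volume) ?_ (isOpen_ball.inter isOpen_ball)
      ((hG x hx).continuousOn.mono inter_subset_left) ((hG y hy).continuousOn.mono inter_subset_right)
    have a1 := ae_restrict_of_ae_restrict_of_subset (inter_subset_left (s := ball x (r x)) (t := ball y (r y))) (hfG x hx)
    have a2 := ae_restrict_of_ae_restrict_of_subset (inter_subset_right (s := ball x (r x)) (t := ball y (r y))) (hfG y hy)
    filter_upwards [a1, a2] with t h1 h2
    rw [← h1, h2]
  have hloc : ∀ x ∈ D, EqOn (fun t => G t t) (G x) (ball x (r x)) := by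
    intro x hx t ht
    have htD := hrD x hx ht
    exact hcomp t htD x hx ⟨mem_ball_self (hr t htD), ht⟩
  refine ⟨fun t => G t t, ?_, ?_⟩
  · intro x hx
    have h1 := ((hG x hx) x (mem_ball_self (hr x hx))).differentiableAt (ball_mem_nhds x (hr x hx))
    refine (h1.congr_of_eventuallyEq ?_).differentiableWithinAt
    filter_upwards [ball_mem_nhds x (hr x hx)] with t ht using hloc x hx ht
  · rw [Filter.EventuallyEq, ae_restrict_iff' hD.measurableSet, ae_iff]
    refine measure_null_of_locally_null _ fun x hx => ?_
    have hxD : x ∈ D := by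
      simp only [mem_setOf_eq, Classical.not_imp] at hx; exact hx.1
    refine ⟨{a | ¬(a ∈ D → f a = G a a)} ∩ ball x (r x),
      inter_mem_nhdsWithin _ (ball_mem_nhds x (hr x hxD)), ?_⟩
    have := hfG x hxD
    rw [Filter.EventuallyEq, ae_restrict_iff' measurableSet_ball, ae_iff] at this
    refine measure_mono_null ?_ this
    rintro t ⟨h1, h2⟩ h3
    apply h1; intro _
    rw [h3 h2]; exact (hloc x hxD h2).symm

/-- converse -/
lemma hol_WH {D : Set ℂ} (hD : IsOpen D) {f F : ℂ → ℂ} (hF : DifferentiableOn ℂ F D)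
    (h : ∀ᵐ x, x ∈ D → f x = F x) : WH D f := by
  intro η hη
  have hc : ContDiffOn ℝ 1 F D := ((hF.contDiffOn hD (n := 1)).restrict_scalars ℝ)
  have h1 := parts_dbar hD hc hη
  have h2 : ∀ a, dbar F a * η a = 0 := by
    intro a
    by_cases ha : a ∈ D
    · rw [dbar_hol ((hF a ha).differentiableAt (hD.mem_nhds ha)), zero_mul]
    · rw [image_eq_zero_of_notMem_tsupport (fun h => ha (hη.supp h)), mul_zero]
  simp_rw [h2] at h1
  rw [integral_zero, neg_zero] at h1
  rw [← h1]
  refine integral_congr_ae ?_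
  filter_upwards [h] with x hx
  by_cases ha : x ∈ D
  · simp only [hx ha]
  · simp only [dbar_zero_of_notMem (fun h => ha (hη.supp h)), mul_zero]


lemma polar_disc {E : Type*} [NormedAddCommGroup E] [NormedSpace ℝ E] [CompleteSpace E] {g : ℂ → E}
    (hg : StronglyMeasurable g) {c : ℂ} {r : ℝ} (hi : IntegrableOn g (ball c r)) :
    IntegrableOn (fun ρ : ℝ => (2 * Real.pi * ρ) • Real.circleAverage g c ρ) (Ioo 0 r) ∧
    ∫ x in ball c r, g x = ∫ ρ in Ioo 0 r, (2 * Real.pi * ρ) • Real.circleAverage g c ρ := by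
  set G : ℂ → E := fun x => (ball (0:ℂ) r).indicator (fun x => g (c + x)) x with hG
  have hGm : StronglyMeasurable G :=
    (hg.comp_measurable (by fun_prop)).indicator measurableSet_ball
  have eG : (fun x => G (x - c)) = (ball c r).indicator g := by
    ext x
    have : x - c ∈ ball (0:ℂ) r ↔ x ∈ ball c r := by simp [dist_eq_norm]
    by_cases h : x ∈ ball c r
    · simp only [hG, indicator_of_mem h, indicator_of_mem (this.2 h)]; congr 1; ring
    · simp only [hG, indicator_of_notMem h, indicator_of_notMem (fun h' => h (this.1 h'))]
  have hGi : Integrable G := by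
    have h1 : Integrable (fun x => G (x - c)) := by
      rw [eG]; exact hi.integrable_indicator measurableSet_ball
    have h2 := h1.comp_add_right c
    simpa using h2
  have hGI : ∫ x in ball c r, g x = ∫ x, G x := by
    rw [← integral_sub_right_eq_self G c, eG, integral_indicator measurableSet_ball]
  have hcont : Continuous (fun p : ℝ × ℝ => Complex.polarCoord.symm p) := by
    have : (fun p : ℝ × ℝ => Complex.polarCoord.symm p) = fun p : ℝ × ℝ => (p.1 : ℂ) * (Real.cos p.2 + Real.sin p.2 * Complex.I) := by
      ext p; exact Complex.polarCoord_symm_apply p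
    rw [this]; fun_prop
  have hprod : IntegrableOn (fun p : ℝ × ℝ => p.1 • G (Complex.polarCoord.symm p)) polarCoord.target
      := by
    refine ⟨?_, ?_⟩
    · exact ((stronglyMeasurable_id.comp_measurable measurable_fst).smul
        (hGm.comp_measurable hcont.measurable)).aestronglyMeasurable
    · rw [HasFiniteIntegral]
      have h := Complex.lintegral_comp_polarCoord_symm (fun x => ‖G x‖ₑ)
      refine lt_of_le_of_lt ?_ (h.trans_lt hGi.2)
      refine setLIntegral_mono' polarCoord.open_target.measurableSet fun p hp => ?_
      rw [enorm_smul, smul_eq_mul]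
      gcongr
      rw [Real.enorm_eq_ofReal_abs, abs_of_pos hp.1]
  have hpt : polarCoord.target = Ioi (0:ℝ) ×ˢ Ioo (-Real.pi) Real.pi := rfl
  have hvol : (volume : Measure (ℝ × ℝ)) = volume.prod volume := rfl
  have hprod' := hprod
  rw [hpt, hvol, IntegrableOn, ← Measure.prod_restrict] at hprod'
  have hin : ∀ ρ : ℝ, 0 < ρ → ∫ θ in Ioo (-Real.pi) Real.pi, ρ • G (Complex.polarCoord.symm (ρ, θ)) =
      (Ioo (0:ℝ) r).indicator (fun ρ : ℝ => (2 * Real.pi * ρ) • Real.circleAverage g c ρ) ρ := by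
    intro ρ hρ
    have hm : ∀ θ : ℝ, Complex.polarCoord.symm (ρ, θ) ∈ ball (0:ℂ) r ↔ ρ < r := by
      intro θ
      rw [mem_ball, dist_zero_right, Complex.norm_polarCoord_symm, abs_of_pos hρ]
    by_cases h : ρ < r
    · rw [indicator_of_mem (show ρ ∈ Ioo 0 r from ⟨hρ, h⟩)]
      have : ∀ θ : ℝ, G (Complex.polarCoord.symm (ρ, θ)) = g (circleMap c ρ θ) := by
        intro θ
        simp only [hG]
        rw [indicator_of_mem ((hm θ).2 h), Complex.polarCoord_symm_apply, circleMap, Complex.exp_mul_I]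
        simp
      simp_rw [this]
      rw [integral_smul, Real.circleAverage_eq_integral_add (-Real.pi),
        intervalIntegral.integral_comp_add_right (fun θ ↦ g (circleMap c ρ θ)),
        smul_smul, ← integral_Ioc_eq_integral_Ioo, intervalIntegral.integral_of_le (by linarith [Real.pi_pos])]
      have e : (2 * Real.pi * ρ) * (2 * Real.pi)⁻¹ = ρ := by field_simp
      rw [e]; congr 3; ring_nf
    · rw [indicator_of_notMem (fun h' => h h'.2)]
      have : ∀ θ : ℝ, G (Complex.polarCoord.symm (ρ, θ)) = 0 := by
        intro θ
        simp only [hG]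
        rw [indicator_of_notMem (fun h' => h ((hm θ).1 h'))]
      simp_rw [this]; simp
  constructor
  · have h1 := hprod'.integral_prod_left
    have h2 : IntegrableOn ((Ioo (0:ℝ) r).indicator (fun ρ : ℝ => (2 * Real.pi * ρ) • Real.circleAverage g c ρ)) (Ioi 0) :=
      IntegrableOn.congr_fun h1 (fun ρ hρ => hin ρ hρ) measurableSet_Ioi
    rw [IntegrableOn, integrable_indicator_iff measurableSet_Ioo, IntegrableOn, Measure.restrict_restrict measurableSet_Ioo] at h2
    rwa [inter_eq_left.2 Ioo_subset_Ioi_self] at h2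
  · rw [hGI, ← Complex.integral_comp_polarCoord_symm, hpt, hvol, setIntegral_prod _ (by rw [← hvol, ← hpt]; exact hprod)]
    rw [setIntegral_congr_fun measurableSet_Ioi (fun ρ hρ => hin ρ hρ), setIntegral_indicator measurableSet_Ioo,
      inter_eq_right.2 Ioo_subset_Ioi_self]

lemma int_2pir {r : ℝ} (hr : 0 ≤ r) : IntegrableOn (fun ρ : ℝ => 2 * Real.pi * ρ) (Ioo 0 r) ∧
    ∫ ρ in Ioo (0:ℝ) r, (2 * Real.pi * ρ) = Real.pi * r ^ 2 := by
  constructor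
  · exact (Continuous.integrableOn_Icc (by fun_prop)).mono_set Ioo_subset_Icc_self
  · rw [← integral_Ioc_eq_integral_Ioo, ← intervalIntegral.integral_of_le hr, intervalIntegral.integral_const_mul,
      integral_id]; ring

lemma disc_mean {E : Type*} [NormedAddCommGroup E] [NormedSpace ℝ E] [CompleteSpace E] {g : ℂ → E}
    (hg : StronglyMeasurable g) {c : ℂ} {r : ℝ} (hr : 0 ≤ r) (hi : IntegrableOn g (ball c r)) {m : E}
    (h : ∀ ρ ∈ Ioo 0 r, Real.circleAverage g c ρ = m) :
    ∫ x in ball c r, g x = (Real.pi * r ^ 2) • m := by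
  rw [(polar_disc hg hi).2, setIntegral_congr_fun (g := fun ρ : ℝ => (2 * Real.pi * ρ) • m) measurableSet_Ioo
    (fun ρ hρ => by simp only [h ρ hρ]), integral_smul_const, (int_2pir hr).2]

lemma disc_mean_le {g : ℂ → ℝ}
    (hg : Measurable g) {c : ℂ} {r : ℝ} (hr : 0 ≤ r) (hi : IntegrableOn g (ball c r)) {m : ℝ}
    (h : ∀ ρ ∈ Ioo 0 r, Real.circleAverage g c ρ ≤ m) :
    ∫ x in ball c r, g x ≤ (Real.pi * r ^ 2) * m := by
  obtain ⟨h1, h2⟩ := polar_disc hg.stronglyMeasurable hi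
  rw [h2, ← (int_2pir hr).2, ← integral_mul_const]
  refine setIntegral_mono_on h1 ((int_2pir hr).1.mul_const m) measurableSet_Ioo fun ρ hρ => ?_
  rw [smul_eq_mul]
  have : 0 ≤ 2 * Real.pi * ρ := by have := Real.pi_pos; have := hρ.1; positivity
  exact mul_le_mul_of_nonneg_left (h ρ hρ) this

lemma lg_meas : Measurable lg := by unfold lg; fun_prop

/-- log disc mean -/
lemma log_disc {c : ℂ} {r : ℝ} (hr : 0 < r) (hc : r ≤ ‖c‖) :
    ∫ x in ball c r, lg x = (Real.pi * r ^ 2) • lg c := by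
  refine disc_mean lg_meas.stronglyMeasurable hr.le
    ((locInt_lg.integrableOn_isCompact (isCompact_closedBall c r)).mono_set ball_subset_closedBall) ?_
  intro ρ hρ
  have h1 : Real.circleAverage (fun x => Real.log ‖x‖) c ρ = Real.log ‖c‖ := by
    apply InnerProductSpace.HarmonicOnNhd.circleAverage_eq
    intro x hx
    refine AnalyticAt.harmonicAt_log_norm (f := fun x => x) (by fun_prop) ?_
    rintro rfl
    rw [mem_closedBall, abs_of_pos hρ.1, dist_comm, dist_zero_right] at hx
    linarith [hρ.2]
  have h2 : lg = fun x => Complex.ofRealCLM ((2 / Real.pi) • Real.log ‖x‖) := by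
    ext x; simp [lg]
  have hci : CircleIntegrable (fun x => (2 / Real.pi) • Real.log ‖x‖) c ρ := by
    refine ContinuousOn.circleIntegrable hρ.1.le ?_
    have key : ContinuousOn (fun x : ℂ => Real.log ‖x‖) (sphere c ρ) := ?_
    · exact key.const_smul (2 / Real.pi)
    refine ContinuousOn.log continuous_norm.continuousOn ?_
    intro x hx h
    rw [norm_eq_zero] at h
    subst h
    rw [mem_sphere, dist_comm, dist_zero_right] at hx
    linarith [hρ.2]
  rw [h2]
  have := Complex.ofRealCLM.circleAverage_comp_comm hci
  refine this.trans ?_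
  congr 1
  have h3 := Real.circleAverage_fun_smul (f := fun x : ℂ => Real.log ‖x‖) (a := 2 / Real.pi) (c := c) (R := ρ)
  rw [h3, h1]

/-- L^2 evaluation estimate -/
lemma hol_disc {F : ℂ → ℂ} {c : ℂ} {r : ℝ} (hr : 0 < r) (hF : DifferentiableOn ℂ F (ball c r))
    (hi : IntegrableOn F (ball c r)) : ∫ x in ball c r, F x = (Real.pi * r ^ 2) • F c := by
  set G := (ball c r).indicator F
  have hGm : StronglyMeasurable G := by
    have : Measurable G := by
      refine measurable_of_restrict_of_restrict_compl measurableSet_ball (f := G) (s := ball c r) ?_ ?_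
      · have : (ball c r).domRestrict G = (ball c r).domRestrict F := by
          ext x; simp [G, Set.domRestrict]
        rw [this]
        exact (continuousOn_iff_continuous_domRestrict.1 hF.continuousOn).measurable
      · have : ((ball c r)ᶜ).domRestrict G = fun _ => 0 := by
          ext x; simp [G, Set.domRestrict]; intro h; exact absurd h (not_lt.1 (fun h' => x.2 (mem_ball.2 h'))).not_gt
        rw [this]; exact measurable_const
    exact this.stronglyMeasurable
  have h1 : ∫ x in ball c r, F x = ∫ x in ball c r, G x :=
    setIntegral_congr_fun measurableSet_ball fun x hx => by simp [G, hx]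
  have hi' : IntegrableOn G (ball c r) :=
    hi.congr_fun (fun x hx => by simp [G, hx]) measurableSet_ball
  rw [h1]
  refine disc_mean hGm hr.le hi' ?_
  intro ρ hρ
  have e : EqOn G F (sphere c |ρ|) := by
    intro x hx
    have : x ∈ ball c r := by
      rw [mem_sphere, abs_of_pos hρ.1] at hx; rw [mem_ball, hx]; exact hρ.2
    simp [G, this]
  rw [Real.circleAverage_congr_sphere e]
  apply DiffContOnCl.circleAverage
  refine DifferentiableOn.diffContOnCl (hF.mono ?_)
  rw [abs_of_pos hρ.1, closure_ball _ hρ.1.ne']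
  exact closedBall_subset_ball hρ.2


/-- holomorphic square integrable -/
def Hol2 (D : Set ℂ) (f : ℂ → ℂ) : Prop := DifferentiableOn ℂ f D ∧ MemLp f 2 (volume.restrict D)

/-- ambient -/
abbrev HH (D : Set ℂ) := Lp ℂ 2 (volume.restrict D)

lemma IsTest.add {D : Set ℂ} {η ξ : ℂ → ℂ} (hη : IsTest D η) (hξ : IsTest D ξ) :
    IsTest D (fun x => η x + ξ x) :=
  ⟨hη.smooth.add hξ.smooth, hη.cpt.add hξ.cpt, (tsupport_add η ξ).trans (union_subset hη.supp hξ.supp)⟩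

lemma IsTest.zero (D : Set ℂ) : IsTest D (fun _ => 0) := by
  have h : tsupport (fun _ : ℂ => (0:ℂ)) = ∅ := by
    rw [tsupport_eq_empty_iff]; rfl
  refine ⟨contDiff_const, ?_, ?_⟩
  · rw [HasCompactSupport, h]; exact isCompact_empty
  · rw [h]; exact empty_subset _

lemma dee_add {f g : ℂ → ℂ} {a : ℂ} (hf : DifferentiableAt ℝ f a) (hg : DifferentiableAt ℝ g a) :
    dee (fun x => f x + g x) a = dee f a + dee g a := by
  have : fderiv ℝ (fun x => f x + g x) a = fderiv ℝ f a + fderiv ℝ g a := fderiv_add hf hg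
  simp only [dee, this]; simp; ring

lemma IsTest.memLp {D : Set ℂ} {η : ℂ → ℂ} (hη : IsTest D η) (μ : Measure ℂ) [IsFiniteMeasureOnCompacts μ] :
    MemLp η 2 μ := hη.smooth.continuous.memLp_of_hasCompactSupport hη.cpt

/-- the space of dee φ -/
def SS (D : Set ℂ) : Submodule ℂ (HH D) where
  carrier := {x | ∃ φ, IsTest D φ ∧ x =ᵐ[volume.restrict D] dee φ}
  zero_mem' := ⟨fun _ => 0, IsTest.zero D, by
    filter_upwards [Lp.coeFn_zero ℂ 2 (volume.restrict D)] with a ha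
    rw [ha]; simp [dee]⟩
  add_mem' := by
    rintro x y ⟨φ, hφ, h1⟩ ⟨ψ, hψ, h2⟩
    refine ⟨_, hφ.add hψ, ?_⟩
    filter_upwards [h1, h2, Lp.coeFn_add x y] with a a1 a2 a3
    rw [a3, Pi.add_apply, a1, a2, dee_add (hφ.diff a) (hψ.diff a)]
  smul_mem' := by
    rintro c x ⟨φ, hφ, h1⟩
    refine ⟨_, hφ.mul_left (χ := fun _ => c) contDiff_const, ?_⟩
    filter_upwards [h1, Lp.coeFn_smul c x] with a a1 a3
    rw [a3, Pi.smul_apply, a1, dee_mul (by fun_prop) (hφ.diff a)]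
    simp [dee]

/-- Bergman space -/
def AA (D : Set ℂ) : Submodule ℂ (HH D) := (SS D)ᗮ

instance (D : Set ℂ) : CompleteSpace (AA D) := by unfold AA; infer_instance

lemma inner_HH {D : Set ℂ} (f g : HH D) : inner ℂ f g = ∫ a in D, cj (f a) * g a := by
  rw [L2.inner_def]
  congr 1; ext a
  rw [RCLike.inner_apply]; simp [cj, mul_comm]

lemma norm_sq_HH {D : Set ℂ} (f : HH D) : ‖f‖ ^ 2 = ∫ a in D, ‖f a‖ ^ 2 := by
  have h := inner_self_eq_norm_sq_to_K (𝕜 := ℂ) f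
  rw [inner_HH] at h
  have h2 : ∀ a, cj (f a) * f a = ((‖f a‖ ^ 2 : ℝ) : ℂ) := by
    intro a; rw [mul_comm, cj, Complex.mul_conj, Complex.normSq_eq_norm_sq]
  simp_rw [h2] at h
  rw [integral_complex_ofReal] at h
  exact Complex.ofReal_injective (by push_cast; simpa using h.symm)

lemma norm_sq_toLp {D : Set ℂ} {f : ℂ → ℂ} (hf : MemLp f 2 (volume.restrict D)) :
    ‖hf.toLp f‖ ^ 2 = ∫ a in D, ‖f a‖ ^ 2 := by
  rw [norm_sq_HH]
  refine integral_congr_ae ?_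
  filter_upwards [hf.coeFn_toLp] with a ha
  rw [ha]

lemma inner_toLp {D : Set ℂ} {f g : ℂ → ℂ} (hf : MemLp f 2 (volume.restrict D))
    (hg : MemLp g 2 (volume.restrict D)) :
    inner ℂ (hf.toLp f) (hg.toLp g) = ∫ a in D, cj (f a) * g a := by
  rw [inner_HH]
  refine integral_congr_ae ?_
  filter_upwards [hf.coeFn_toLp, hg.coeFn_toLp] with a ha hb
  rw [ha, hb]

lemma fin_of_bdd {D : Set ℂ} (hb : Bornology.IsBounded D) : IsFiniteMeasure (volume.restrict D) :=
  ⟨by simpa using hb.measure_lt_top⟩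

lemma bdd_R {D : Set ℂ} (hb : Bornology.IsBounded D) : ∃ R : ℝ, 0 < R ∧ ∀ x ∈ D, ‖x‖ < R := by
  obtain ⟨R, hR⟩ := hb.subset_ball 0
  exact ⟨max R 1, by positivity, fun x hx => by
    have := hR hx; simp at this; exact lt_max_of_lt_left this⟩

/-- extension by zero -/
lemma WH_indicator {D : Set ℂ} {f : ℂ → ℂ} (hD : MeasurableSet D) :
    WH D (D.indicator f) ↔ ∀ η, IsTest D η → ∫ a in D, f a * dbar η a = 0 := by
  unfold WH
  refine forall_congr' fun η => imp_congr_right fun hη => ?_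
  rw [← integral_indicator hD]
  have : (fun a => D.indicator f a * dbar η a) = D.indicator (fun a => f a * dbar η a) := by
    ext a; by_cases h : a ∈ D <;> simp [h]
  rw [this]

lemma mem_AA_iff_WH {D : Set ℂ} (hD : IsOpen D) (f : HH D) : f ∈ AA D ↔ WH D (D.indicator f) := by
  rw [WH_indicator hD.measurableSet, AA, Submodule.mem_orthogonal]
  constructor
  · intro h η hη
    have hm : MemLp (dee (fun x => cj (η x))) 2 (volume.restrict D) := hη.cj.dee.memLp _
    have := h (hm.toLp _) ⟨_, hη.cj, hm.coeFn_toLp⟩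
    rw [inner_HH] at this
    rw [← this]
    refine integral_congr_ae ?_
    filter_upwards [hm.coeFn_toLp] with a ha
    rw [ha, dee_cj (hη.diff a), cj, cj, Complex.conj_conj, mul_comm]
  · rintro h x ⟨φ, hφ, hx⟩
    rw [inner_HH, ← h _ hφ.cj]
    refine integral_congr_ae ?_
    filter_upwards [hx] with a ha
    rw [ha, dbar_cj (hφ.diff a), mul_comm]

lemma mem_AA_iff {D : Set ℂ} (hD : IsOpen D) (hb : Bornology.IsBounded D) (f : HH D) :
    f ∈ AA D ↔ ∃ F, DifferentiableOn ℂ F D ∧ f =ᵐ[volume.restrict D] F := by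
  have := fin_of_bdd hb
  obtain ⟨R, _, hR⟩ := bdd_R hb
  rw [mem_AA_iff_WH hD]
  constructor
  · intro h
    have hi : Integrable (D.indicator f) := by
      rw [integrable_indicator_iff hD.measurableSet]
      exact (Lp.memLp f).integrable (by norm_num)
    obtain ⟨F, h1, h2⟩ := weyl hD hi (R := R) (fun x hx => indicator_of_notMem
      (fun h => absurd (hR x h) (not_lt.2 hx)) _) h
    refine ⟨F, h1, ?_⟩
    filter_upwards [h2, ae_restrict_mem hD.measurableSet] with a ha hm
    rw [← ha, indicator_of_mem hm]
  · rintro ⟨F, h1, h2⟩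
    refine hol_WH hD h1 ?_
    rw [Filter.EventuallyEq, ae_restrict_iff' hD.measurableSet] at h2
    filter_upwards [h2] with a ha hm
    rw [indicator_of_mem hm, ha hm]

lemma hol_unique {D : Set ℂ} (hD : IsOpen D) {F G : ℂ → ℂ} (hF : DifferentiableOn ℂ F D)
    (hG : DifferentiableOn ℂ G D) (h : F =ᵐ[volume.restrict D] G) : EqOn F G D :=
  Measure.eqOn_open_of_ae_eq h hD hF.continuousOn hG.continuousOn

/-- evaluation bound -/
lemma ev_bound {D : Set ℂ} {F : ℂ → ℂ} (hF : Hol2 D F) {z : ℂ} {r : ℝ} (hr : 0 < r)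
    (hz : ball z r ⊆ D) : ‖F z‖ ≤ r⁻¹ * Real.sqrt (∫ a in D, ‖F a‖ ^ 2) := by
  have hm : MemLp F 2 (volume.restrict (ball z r)) := hF.2.mono_measure (Measure.restrict_mono hz le_rfl)
  have hfin : IsFiniteMeasure (volume.restrict (ball z r)) := fin_of_bdd isBounded_ball
  have hi : IntegrableOn F (ball z r) := hm.integrable (by norm_num)
  have h1 := hol_disc hr (hF.1.mono hz) hi
  have h2 : ‖∫ x in ball z r, F x‖ ≤ ∫ x in ball z r, ‖F x‖ := norm_integral_le_integral_norm _
  rw [h1, norm_smul, Real.norm_eq_abs, abs_of_nonneg (by positivity)] at h2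
  have hsq : IntegrableOn (fun a => ‖F a‖ ^ 2) D := hF.2.integrable_norm_pow (p := 2) (by norm_num)
  have h3 : ∫ x in ball z r, ‖F x‖ ^ 2 ≤ ∫ a in D, ‖F a‖ ^ 2 :=
    setIntegral_mono_set hsq (ae_of_all _ fun a => by positivity) hz.eventuallyLE
  set I := ∫ a in D, ‖F a‖ ^ 2
  have hI : 0 ≤ I := integral_nonneg fun a => by positivity
  have hvol : (volume (ball z r)).toReal = Real.pi * r ^ 2 := by
    rw [Complex.volume_ball]; simp [ENNReal.toReal_ofReal hr.le, mul_comm]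
  -- AM-GM
  have h4 : ∀ t : ℝ, 0 < t → ∫ x in ball z r, ‖F x‖ ≤ t⁻¹ * I / 2 + t / 2 * (Real.pi * r ^ 2) := by
    intro t ht
    have : ∫ x in ball z r, ‖F x‖ ≤ ∫ x in ball z r, (t⁻¹ / 2 * ‖F x‖ ^ 2 + t / 2) := by
      refine setIntegral_mono_on hi.norm (((hsq.mono_set hz).const_mul _).add (integrable_const _)) measurableSet_ball ?_
      intro x _
      have := sq_nonneg (‖F x‖ - t)
      have e : t⁻¹ / 2 * ‖F x‖ ^ 2 + t / 2 - ‖F x‖ = (‖F x‖ - t) ^ 2 * (t⁻¹ / 2) := by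
        field_simp; ring
      have : 0 ≤ (‖F x‖ - t) ^ 2 * (t⁻¹ / 2) := by positivity
      linarith
    refine this.trans ?_
    rw [integral_add ((hsq.mono_set hz).const_mul _) (integrable_const _), integral_const_mul, setIntegral_const,
      Measure.real, hvol, smul_eq_mul]
    have h5 : t⁻¹ / 2 * ∫ x in ball z r, ‖F x‖ ^ 2 ≤ t⁻¹ / 2 * I := by gcongr
    linarith
  have hpi := Real.pi_pos
  rcases hI.eq_or_lt with h0 | h0
  · rw [← h0, Real.sqrt_zero, mul_zero]
    by_contra hc
    push Not at hc
    have := h4 ‖F z‖ hc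
    rw [← h0] at this
    have : ‖F z‖ * (Real.pi * r^2) > 0 := by positivity
    nlinarith
  · have hs := Real.sqrt_pos.2 h0
    have := h4 (Real.sqrt I / (r)) (by positivity)
    have e1 : Real.sqrt I ^ 2 = I := Real.sq_sqrt hI
    have e2 : (Real.sqrt I / r)⁻¹ * I = r * Real.sqrt I := by
      rw [← e1, Real.sqrt_sq hs.le]; field_simp
    rw [e2] at this
    have h6 : Real.pi * r ^ 2 * ‖F z‖ ≤ Real.pi * r^2 * (r⁻¹ * Real.sqrt I) := by
      refine (h2.trans this).trans ?_
      have e3 : Real.sqrt I / r / 2 * (Real.pi * r^2) = Real.pi * r * Real.sqrt I / 2 := by field_simp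
      have e4 : Real.pi * r ^ 2 * (r⁻¹ * Real.sqrt I) = Real.pi * (r * Real.sqrt I) := by field_simp
      rw [e3, e4]
      have : 0 < r * Real.sqrt I := by positivity
      nlinarith [Real.pi_gt_three]
    exact le_of_mul_le_mul_left h6 (by positivity)

lemma exists_kz {D : Set ℂ} (hD : IsOpen D) (hb : Bornology.IsBounded D) {z : ℂ} (hz : z ∈ D) :
    ∃ k : AA D, ∀ (f : AA D) (F : ℂ → ℂ), DifferentiableOn ℂ F D →
      (f : HH D) =ᵐ[volume.restrict D] F → inner ℂ k f = F z := by
  have hrep : ∀ f : AA D, ∃ F, DifferentiableOn ℂ F D ∧ (f : HH D) =ᵐ[volume.restrict D] F :=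
    fun f => (mem_AA_iff hD hb f).1 f.2
  choose rep h1 h2 using hrep
  have huniq : ∀ (f : AA D) (F : ℂ → ℂ), DifferentiableOn ℂ F D →
      (f : HH D) =ᵐ[volume.restrict D] F → rep f z = F z := fun f F hF hf =>
    hol_unique hD (h1 f) hF ((h2 f).symm.trans hf) hz
  obtain ⟨r, hr, hrD⟩ := Metric.isOpen_iff.1 hD z hz
  let L : AA D →ₗ[ℂ] ℂ :=
    { toFun := fun f => rep f z
      map_add' := fun f g => by
        refine huniq (f + g) (fun x => rep f x + rep g x) ((h1 f).add (h1 g)) ?_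
        filter_upwards [h2 f, h2 g, Lp.coeFn_add (f : HH D) (g : HH D)] with a a1 a2 a3
        rw [Submodule.coe_add, a3, Pi.add_apply, a1, a2]
      map_smul' := fun c f => by
        refine huniq (c • f) (fun x => c * rep f x) ((h1 f).const_mul c) ?_
        filter_upwards [h2 f, Lp.coeFn_smul c (f : HH D)] with a a1 a3
        rw [Submodule.coe_smul, a3, Pi.smul_apply, a1, smul_eq_mul] }
  let L' : AA D →L[ℂ] ℂ := L.mkContinuous r⁻¹ (fun f => by
    have hm : MemLp (rep f) 2 (volume.restrict D) := (memLp_congr_ae (h2 f)).1 (Lp.memLp _)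
    have := ev_bound ⟨h1 f, hm⟩ hr hrD
    have e : ∫ a in D, ‖rep f a‖ ^ 2 = ‖f‖ ^ 2 := by
      rw [Submodule.coe_norm, norm_sq_HH]
      refine integral_congr_ae ?_
      filter_upwards [h2 f] with a ha
      rw [ha]
    rw [e, Real.sqrt_sq (norm_nonneg _)] at this
    exact this)
  refine ⟨(InnerProductSpace.toDual ℂ (AA D)).symm L', fun f F hF hf => ?_⟩
  rw [InnerProductSpace.toDual_symm_apply]
  exact huniq f F hF hf

open Classical in
/-- the kernel function -/
def kz (D : Set ℂ) (z : ℂ) : AA D :=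
  if h : ∃ k : AA D, ∀ (f : AA D) (F : ℂ → ℂ), DifferentiableOn ℂ F D →
      (f : HH D) =ᵐ[volume.restrict D] F → inner ℂ k f = F z then h.choose else 0

lemma kz_spec {D : Set ℂ} (hD : IsOpen D) (hb : Bornology.IsBounded D) {z : ℂ} (hz : z ∈ D)
    (f : AA D) (F : ℂ → ℂ) (hF : DifferentiableOn ℂ F D)
      (hf : (f : HH D) =ᵐ[volume.restrict D] F) : inner ℂ (kz D z) f = F z := by
  have h := exists_kz hD hb hz
  rw [kz, dif_pos h]
  exact h.choose_spec f F hF hf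

/-- embed -/
def Hol2.toAA {D : Set ℂ} {F : ℂ → ℂ} (hF : Hol2 D F) (hD : IsOpen D) (hb : Bornology.IsBounded D) : AA D :=
  ⟨hF.2.toLp F, (mem_AA_iff hD hb _).2 ⟨F, hF.1, hF.2.coeFn_toLp⟩⟩

lemma kz_spec' {D : Set ℂ} (hD : IsOpen D) (hb : Bornology.IsBounded D) {z : ℂ} (hz : z ∈ D)
    {F : ℂ → ℂ} (hF : Hol2 D F) : inner ℂ (kz D z) (hF.toAA hD hb) = F z :=
  kz_spec hD hb hz _ F hF.1 hF.2.coeFn_toLp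

/-- root of the Bergman kernel -/
def kap (D : Set ℂ) (z : ℂ) : ℝ := ‖kz D z‖

lemma kap_le {D : Set ℂ} (hD : IsOpen D) (hb : Bornology.IsBounded D) {z : ℂ} (hz : z ∈ D)
    {F : ℂ → ℂ} (hF : Hol2 D F) : ‖F z‖ ≤ kap D z * Real.sqrt (∫ a in D, ‖F a‖ ^ 2) := by
  rw [← kz_spec' hD hb hz hF, ← norm_sq_toLp hF.2, Real.sqrt_sq (norm_nonneg _)]
  exact norm_inner_le_norm (𝕜 := ℂ) (kz D z) (hF.toAA hD hb)

lemma one_Hol2 {D : Set ℂ} (hb : Bornology.IsBounded D) : Hol2 D (fun _ => 1) := by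
  have := fin_of_bdd hb
  exact ⟨differentiableOn_const _, memLp_const 1⟩

lemma kap_pos {D : Set ℂ} (hD : IsOpen D) (hb : Bornology.IsBounded D) {z : ℂ} (hz : z ∈ D) :
    0 < kap D z := by
  have := kap_le hD hb hz (one_Hol2 hb)
  by_contra h
  have h0 : kap D z = 0 := le_antisymm (not_lt.1 h) (norm_nonneg _)
  rw [h0, zero_mul] at this
  simp at this
  linarith

/-- normalized kernel function -/
lemma exists_ez {D : Set ℂ} (hD : IsOpen D) (hb : Bornology.IsBounded D) {z : ℂ} (hz : z ∈ D) :
    ∃ e : ℂ → ℂ, Hol2 D e ∧ (∀ x ∉ D, e x = 0) ∧ (∫ a in D, ‖e a‖ ^ 2) = 1 ∧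
      e z = kap D z ∧ ∀ F, Hol2 D F → ∫ a in D, cj (e a) * F a = F z / kap D z := by
  obtain ⟨K, hK, hKe⟩ := (mem_AA_iff hD hb (kz D z)).1 (kz D z).2
  have hp := kap_pos hD hb hz
  have hpc : (kap D z : ℂ) ≠ 0 := by exact_mod_cast hp.ne'
  have hKm : MemLp K 2 (volume.restrict D) := (memLp_congr_ae hKe).1 (Lp.memLp _)
  set e : ℂ → ℂ := D.indicator (fun x => (kap D z : ℂ)⁻¹ * K x) with he
  have heD : EqOn e (fun x => (kap D z : ℂ)⁻¹ * K x) D := fun x hx => indicator_of_mem hx _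
  have hae : e =ᵐ[volume.restrict D] (fun x => (kap D z : ℂ)⁻¹ * K x) := by
    filter_upwards [ae_restrict_mem hD.measurableSet] with x hx using heD hx
  have hae2 : ∀ᵐ x ∂(volume.restrict D), e x = (kap D z : ℂ)⁻¹ * (kz D z : HH D) x := by
    filter_upwards [hae, hKe] with x hx h2
    rw [hx, h2]
  refine ⟨e, ⟨(hK.const_mul _).congr heD, (memLp_congr_ae hae).2 (hKm.const_mul _)⟩,
    fun x hx => indicator_of_notMem hx _, ?_, ?_, ?_⟩
  · have h1 := norm_sq_HH (kz D z : HH D)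
    have : ∫ a in D, ‖e a‖ ^ 2 = ∫ a in D, (kap D z ^ 2)⁻¹ * ‖(kz D z : HH D) a‖ ^ 2 := by
      refine integral_congr_ae ?_
      filter_upwards [hae2] with x hx
      rw [hx, norm_mul, mul_pow, norm_inv, Complex.norm_real, Real.norm_eq_abs, abs_of_pos hp, inv_pow]
    rw [this, integral_const_mul, ← h1]
    have : ‖(kz D z : HH D)‖ = kap D z := rfl
    rw [this]; field_simp
  · have h1 := kz_spec hD hb hz (kz D z) K hK hKe
    rw [heD hz]
    simp only
    rw [← h1, inner_self_eq_norm_sq_to_K (𝕜 := ℂ) (kz D z)]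
    have : ‖kz D z‖ = kap D z := rfl
    rw [this]
    simp only [Complex.coe_algebraMap]
    field_simp
  · intro F hF
    rw [← kz_spec' hD hb hz hF]
    have : ∀ᵐ a ∂(volume.restrict D), cj (e a) * F a =
        (kap D z : ℂ)⁻¹ * (cj ((kz D z : HH D) a) * (hF.2.toLp F) a) := by
      filter_upwards [hae2, hF.2.coeFn_toLp] with a a1 a2
      rw [a1, a2]; simp [cj]; ring
    rw [integral_congr_ae this, integral_const_mul, ← inner_HH, div_eq_inv_mul]
    rfl

/-- density -/
lemma dense_dee {D : Set ℂ} (hD : IsOpen D) (hb : Bornology.IsBounded D) {g : ℂ → ℂ}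
    (hg : MemLp g 2 (volume.restrict D)) (ho : ∀ F, Hol2 D F → ∫ a in D, cj (F a) * g a = 0) :
    ∀ ε > 0, ∃ φ, IsTest D φ ∧ ∫ a in D, ‖dee φ a - g a‖ ^ 2 < ε := by
  intro ε hε
  have h1 : hg.toLp g ∈ (SS D).topologicalClosure := by
    rw [← Submodule.orthogonal_orthogonal_eq_closure]
    change _ ∈ (AA D)ᗮ
    rw [Submodule.mem_orthogonal]
    intro f hf
    obtain ⟨F, hF, hfF⟩ := (mem_AA_iff hD hb f).1 hf
    have hFm : MemLp F 2 (volume.restrict D) := (memLp_congr_ae hfF).1 (Lp.memLp _)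
    rw [inner_HH, ← ho F ⟨hF, hFm⟩]
    refine integral_congr_ae ?_
    filter_upwards [hfF, hg.coeFn_toLp] with a a1 a2
    rw [a1, a2]
  have h2 : hg.toLp g ∈ closure (SS D : Set (HH D)) := h1
  obtain ⟨x, ⟨φ, hφ, hx⟩, hd⟩ := Metric.mem_closure_iff.1 h2 (Real.sqrt ε) (Real.sqrt_pos.2 hε)
  refine ⟨φ, hφ, ?_⟩
  have hm := (hφ.dee.memLp (volume.restrict D)).sub hg
  have : ∫ a in D, ‖dee φ a - g a‖ ^ 2 = ‖x - hg.toLp g‖ ^ 2 := by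
    rw [norm_sq_HH]
    refine integral_congr_ae ?_
    filter_upwards [hx, hg.coeFn_toLp, Lp.coeFn_sub x (hg.toLp g)] with a a1 a2 a3
    rw [a3, Pi.sub_apply, a1, a2]
  rw [this, ← dist_eq_norm, dist_comm]
  calc _ < Real.sqrt ε ^ 2 := by gcongr
    _ = ε := Real.sq_sqrt hε.le

/-- projection -/
lemma exists_proj {D : Set ℂ} (hD : IsOpen D) (hb : Bornology.IsBounded D) {g : ℂ → ℂ}
    (hg : MemLp g 2 (volume.restrict D)) : ∃ F, Hol2 D F ∧ ∀ G, Hol2 D G →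
      ∫ a in D, cj (G a) * g a = ∫ a in D, cj (G a) * F a := by
  set p := (AA D).starProjection (hg.toLp g) with hp
  have hpm : p ∈ AA D := Submodule.starProjection_apply_mem _ _
  obtain ⟨F, hF, hfF⟩ := (mem_AA_iff hD hb p).1 hpm
  have hFm : MemLp F 2 (volume.restrict D) := (memLp_congr_ae hfF).1 (Lp.memLp _)
  refine ⟨F, ⟨hF, hFm⟩, fun G hG => ?_⟩
  have h := Submodule.sub_starProjection_mem_orthogonal (K := AA D) (hg.toLp g)
  have h2 := h (hG.2.toLp G) (hG.toAA hD hb).2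
  rw [inner_sub_right, inner_toLp, ← hp, sub_eq_zero] at h2
  rw [h2, inner_HH]
  refine integral_congr_ae ?_
  filter_upwards [hfF, hG.2.coeFn_toLp] with a a1 a2
  rw [a1, a2]


lemma kz_cont {D : Set ℂ} (hD : IsOpen D) (hb : Bornology.IsBounded D) : ContinuousOn (kz D) D := by
  intro z hz
  apply ContinuousAt.continuousWithinAt
  obtain ⟨r, hr, hrD⟩ : ∃ r > 0, ball z (2 * r) ⊆ D := by
    obtain ⟨r, hr, h⟩ := Metric.isOpen_iff.1 hD z hz
    exact ⟨r / 2, by positivity, by rwa [mul_div_cancel₀ _ two_ne_zero]⟩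
  have hball : ∀ y ∈ ball z r, ball y r ⊆ D := fun y hy => by
    refine (ball_subset_ball' ?_).trans hrD
    rw [mem_ball] at hy; linarith
  have key : ∀ y ∈ ball z r, ‖kz D y - kz D z‖ ≤ 2 * r⁻¹ / r * dist y z := by
    intro y hy
    set v := kz D y - kz D z with hv
    obtain ⟨F, hF, hfF⟩ := (mem_AA_iff hD hb v).1 v.2
    have hFm : MemLp F 2 (volume.restrict D) := (memLp_congr_ae hfF).1 (Lp.memLp _)
    have hnorm : Real.sqrt (∫ a in D, ‖F a‖ ^ 2) = ‖v‖ := by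
      rw [← Real.sqrt_sq (norm_nonneg v), Submodule.coe_norm, norm_sq_HH]
      congr 1
      refine integral_congr_ae ?_
      filter_upwards [hfF] with a ha
      rw [ha]
    have hyD : y ∈ D := hball y hy (mem_ball_self hr)
    have e1 : inner ℂ v v = F y - F z := by
      conv_lhs => rw [hv, inner_sub_left, ← hv]
      rw [kz_spec hD hb hyD v F hF hfF, kz_spec hD hb hz v F hF hfF]
    have hbd : ∀ x ∈ ball z r, ‖F x‖ ≤ r⁻¹ * ‖v‖ := fun x hx => by
      rw [← hnorm]; exact ev_bound ⟨hF, hFm⟩ hr (hball x hx)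
    have e2 := Complex.dist_le_div_mul_dist_of_mapsTo_ball (f := F) (c := z) (R₁ := r)
      (R₂ := 2 * r⁻¹ * ‖v‖) (z := y)
      (hF.mono (hball z (mem_ball_self hr))) (fun x hx => by
        rw [mem_closedBall, dist_eq_norm]
        refine (norm_sub_le _ _).trans ?_
        have := hbd x hx; have := hbd z (mem_ball_self hr); linarith) hy
    rw [dist_eq_norm, ← e1, inner_self_eq_norm_sq_to_K (𝕜 := ℂ) v] at e2
    simp only [norm_pow, norm_algebraMap', norm_norm] at e2
    by_cases h0 : ‖v‖ = 0
    · rw [h0]; positivity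
    · have hp : 0 < ‖v‖ := lt_of_le_of_ne (norm_nonneg _) (Ne.symm h0)
      have : ‖v‖ * ‖v‖ ≤ (2 * r⁻¹ / r * dist y z) * ‖v‖ := by
        calc _ = ‖v‖ ^ 2 := by ring
          _ ≤ _ := e2
          _ = _ := by ring
      exact le_of_mul_le_mul_right this hp
  rw [ContinuousAt, tendsto_iff_norm_sub_tendsto_zero]
  refine squeeze_zero' (Eventually.of_forall fun _ => norm_nonneg _)
    (g := fun y => 2 * r⁻¹ / r * dist y z) ?_ ?_
  · filter_upwards [ball_mem_nhds z hr] with y hy using key y hy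
  · have : Tendsto (fun y => 2 * r⁻¹ / r * dist y z) (𝓝 z) (𝓝 (2 * r⁻¹ / r * dist z z)) :=
      Continuous.tendsto (by fun_prop) z
    simpa using this

lemma weak_an {H : Type*} [NormedAddCommGroup H] [InnerProductSpace ℂ H] [CompleteSpace H]
    (m : ℂ → H) {c : ℂ} {R : ℝ} (hR : 0 < R) (hmc : ContinuousOn m (closedBall c R))
    (hdiff : ∀ v, DifferentiableOn ℂ (fun x => (inner ℂ v (m x) : ℂ)) (closedBall c R)) :
    ContDiffAt ℝ 2 (fun ζ => ‖m ζ‖ ^ 2) c := by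
  lift R to ℝ≥0 using hR.le
  have hci : CircleIntegrable m c R :=
    (hmc.mono sphere_subset_closedBall).circleIntegrable R.2
  have hps := hasFPowerSeriesOn_cauchy_integral hci (by exact_mod_cast hR)
  have heq : ∀ ζ ∈ ball c R,
      (2 * Real.pi * Complex.I : ℂ)⁻¹ • (∮ ξ in C(c, R), (ξ - ζ)⁻¹ • m ξ) = m ζ := by
    intro ζ hζ
    refine ext_inner_left ℂ fun v => ?_
    have hcau := (hdiff v).circleIntegral_sub_inv_smul hζ
    have hint : CircleIntegrable (fun ξ => (ξ - ζ)⁻¹ • m ξ) c R := by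
      refine ContinuousOn.circleIntegrable R.2 ?_
      refine ContinuousOn.smul ?_ (hmc.mono sphere_subset_closedBall)
      refine ContinuousOn.inv₀ (by fun_prop) fun x hx h => ?_
      rw [sub_eq_zero] at h
      rw [h, mem_sphere] at hx; rw [mem_ball] at hζ; linarith
    have hL : inner ℂ v (∮ ξ in C(c, R), (ξ - ζ)⁻¹ • m ξ) =
        ∮ ξ in C(c, R), (ξ - ζ)⁻¹ • (inner ℂ v (m ξ) : ℂ) := by
      rw [circleIntegral, circleIntegral]
      have := (innerSL ℂ v).intervalIntegral_comp_comm hint.out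
      rw [innerSL_apply_apply] at this
      rw [← this]
      refine intervalIntegral.integral_congr fun θ _ => ?_
      simp only [innerSL_apply_apply, inner_smul_right]
      simp
    rw [inner_smul_right, hL, hcau]
    rw [smul_eq_mul, ← mul_assoc, inv_mul_cancel₀ (by simp [Real.pi_ne_zero]), one_mul]
  have han : AnalyticAt ℂ m c := by
    refine hps.analyticAt.congr ?_
    filter_upwards [ball_mem_nhds c hR] with ζ hζ using heq ζ hζ
  have h1 : ContDiffAt ℝ 2 m c := han.contDiffAt.restrict_scalars ℝ
  exact h1.norm_sq ℂ

lemma kap_smooth {D : Set ℂ} (hD : IsOpen D) (hb : Bornology.IsBounded D) {z : ℂ} (hz : z ∈ D) :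
    ContDiffAt ℝ 2 (fun z => Real.log (kap D z ^ 2)) z := by
  set m : ℂ → AA D := fun ζ => kz D (cj ζ) with hm
  have hcont_cj : Continuous (fun ζ : ℂ => cj ζ) := Complex.continuous_conj
  have hcc : ∀ x, cj (cj x) = x := fun x => Complex.conj_conj x
  obtain ⟨R, hR, hRD⟩ := Metric.nhds_basis_closedBall.mem_iff.1 (hD.mem_nhds hz)
  have hmem : ∀ ζ ∈ closedBall (cj z) R, cj ζ ∈ D := fun ζ hζ => by
    apply hRD
    rw [mem_closedBall, dist_eq_norm] at hζ ⊢
    rw [← hcc z]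
    calc ‖cj ζ - cj (cj z)‖ = ‖cj (ζ - cj z)‖ := by rw [← map_sub]
      _ = ‖ζ - cj z‖ := Complex.norm_conj _
      _ ≤ R := hζ
  have hmc : ContinuousOn m (closedBall (cj z) R) :=
    (kz_cont hD hb).comp hcont_cj.continuousOn hmem
  have h0 := weak_an m hR hmc (fun v => by
    obtain ⟨F, hF, hfF⟩ := (mem_AA_iff hD hb v).1 v.2
    have e1 : ∀ x ∈ closedBall (cj z) R, inner ℂ v (m x) = cj (F (cj x)) := fun x hx => by
      rw [← kz_spec hD hb (hmem x hx) v F hF hfF, cj]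
      exact (inner_conj_symm (𝕜 := ℂ) v (m x)).symm
    refine DifferentiableOn.congr (f := fun x => cj (F (cj x))) ?_ e1
    intro x hx
    apply DifferentiableAt.differentiableWithinAt
    have := (hF.differentiableAt (hD.mem_nhds (hmem x hx)))
    have h2 := this.conj_conj
    simpa [hcc, Function.comp_def, cj] using h2)
  have h1 : ContDiffAt ℝ 2 (fun z => kap D z ^ 2) z := by
    have h2 : (fun z => kap D z ^ 2) = (fun ζ => ‖m ζ‖ ^ 2) ∘ (fun ζ => cj ζ) := by
      ext1 x; simp [hm, hcc, kap]
    rw [h2]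
    exact h0.comp z ((cj_contDiff contDiff_id).of_le (by norm_cast)).contDiffAt
  exact h1.log (pow_pos (kap_pos hD hb hz) 2).ne'


lemma second_test {p : ℝ → ℝ} {M : ℝ} (hM : 0 < M) (h0 : p 0 = 0)
    (hp : ∀ᶠ t in 𝓝 0, Real.log (1 + t ^ 2 / M) ≤ p t)
    (h1 : ∀ᶠ t in 𝓝 0, DifferentiableAt ℝ p t) (h2 : DifferentiableAt ℝ (deriv p) 0) :
    2 / M ≤ deriv (deriv p) 0 := by
  by_contra hcon
  push Not at hcon
  obtain ⟨c', hc1, hc2⟩ := exists_between hcon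
  set c := c' / 2 with hc
  have hcM : c < 1 / M := by rw [hc]; have : 2 / M = 2 * (1 / M) := by ring
                             linarith
  have hmin : IsLocalMin p 0 := by
    filter_upwards [hp] with t ht
    rw [h0]; refine le_trans (Real.log_nonneg ?_) ht
    have : 0 ≤ t ^ 2 / M := by positivity
    linarith
  set q : ℝ → ℝ := fun t => p t - c * t ^ 2 with hq
  have hd : ∀ᶠ t in 𝓝 0, deriv q t = deriv p t - c' * t := by
    filter_upwards [h1] with t ht
    have : HasDerivAt q (deriv p t - c * (2 * t)) t := by
      have h3 := ht.hasDerivAt.sub (((hasDerivAt_pow 2 t)).const_mul c)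
      have e : deriv p t - c * (2 * t) = deriv p t - c * (↑(2:ℕ) * t ^ (2 - 1)) := by norm_num
      rw [e]; exact h3
    rw [this.deriv, hc]; ring
  have hdd : deriv (deriv q) 0 = deriv (deriv p) 0 - c' := by
    rw [EventuallyEq.deriv_eq hd]
    have h3 := h2.hasDerivAt.sub ((hasDerivAt_id (0:ℝ)).const_mul c')
    have := h3.deriv
    rw [mul_one] at this
    exact this
  have hmax := isLocalMax_of_deriv_deriv_neg (f := q) (x₀ := 0) (by rw [hdd]; linarith)
    (by rw [hd.self_of_nhds, hmin.deriv_eq_zero]; simp) 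
    (by have := h1.self_of_nhds.continuousAt; fun_prop)
  have hsm : ∀ᶠ t : ℝ in 𝓝 0, t ^ 2 / M ^ 2 < 1 / M - c := by
    have : Tendsto (fun t : ℝ => t ^ 2 / M ^ 2) (𝓝 0) (𝓝 (0 ^ 2 / M ^ 2)) :=
      Continuous.tendsto (by fun_prop) _
    refine this.eventually (gt_mem_nhds ?_)
    simp; simpa using hcM
  have hall := (hp.and (hmax.and hsm))
  obtain ⟨t, ht, a1, a2, a3⟩ : ∃ t : ℝ, t ≠ 0 ∧ Real.log (1 + t ^ 2 / M) ≤ p t ∧ q t ≤ q 0 ∧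
      t ^ 2 / M ^ 2 < 1 / M - c := by
    have h3 : ∃ᶠ t : ℝ in 𝓝[≠] 0, True := by
      rw [frequently_const]; trivial
    have h4 := h3.and_eventually ((hall.filter_mono nhdsWithin_le_nhds).and self_mem_nhdsWithin)
    obtain ⟨t, -, b, b2⟩ := h4.exists
    exact ⟨t, b2, b.1, b.2.1, b.2.2⟩
  have hq0 : q 0 = 0 := by simp [hq, h0]
  rw [hq0] at a2
  have hx : 0 < t ^ 2 := by positivity
  have hl : t ^ 2 / M - (t ^ 2 / M) ^ 2 ≤ Real.log (1 + t ^ 2 / M) := by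
    have hy : 0 ≤ t ^ 2 / M := by positivity
    have := Real.one_sub_inv_le_log_of_pos (x := 1 + t ^ 2 / M) (by positivity)
    refine le_trans ?_ this
    set y := t ^ 2 / M
    rw [← sub_nonneg]
    have e : 1 - (1 + y)⁻¹ - (y - y ^ 2) = y ^ 3 / (1 + y) := by field_simp; ring
    rw [e]; positivity
  have : t ^ 2 * (1 / M - c) - t ^ 2 * (t ^ 2 / M ^ 2) ≤ 0 := by
    have e2 : t ^ 2 * (1 / M - c) - t ^ 2 * (t ^ 2 / M ^ 2) = t ^ 2 / M - (t ^ 2 / M) ^ 2 - c * t ^ 2 := by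
      field_simp; ring
    rw [e2]; simp only [hq] at a2; linarith
  nlinarith

/-- directional second derivative -/
lemma line_deriv {H : ℂ → ℝ} {z v : ℂ} (hH : ContDiffAt ℝ 2 H z) :
    (∀ᶠ t : ℝ in 𝓝 0, DifferentiableAt ℝ (fun t : ℝ => H (z + t * v)) t) ∧
    DifferentiableAt ℝ (deriv (fun t : ℝ => H (z + t * v))) 0 ∧
    deriv (deriv (fun t : ℝ => H (z + t * v))) 0 = fderiv ℝ (fun w => fderiv ℝ H w v) z v := by
  have hl : ∀ t : ℝ, HasDerivAt (fun t : ℝ => z + t * v) v t := fun t => by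
    have := ((hasDerivAt_id t).ofReal_comp.mul_const v).const_add z
    simpa using this
  have hc : Tendsto (fun t : ℝ => z + t * v) (𝓝 0) (𝓝 z) := by
    have : Tendsto (fun t : ℝ => z + t * v) (𝓝 0) (𝓝 (z + ((0:ℝ):ℂ) * v)) :=
      Continuous.tendsto (by fun_prop) _
    simpa using this
  have hev : ∀ᶠ w in 𝓝 z, DifferentiableAt ℝ H w := by
    filter_upwards [hH.eventually (by simp)] with w hw using hw.differentiableAt (by norm_num)
  have h1 : ∀ᶠ t : ℝ in 𝓝 0, HasDerivAt (fun t : ℝ => H (z + t * v)) (fderiv ℝ H (z + t * v) v) t := by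
    filter_upwards [hc.eventually hev] with t ht
    exact ht.hasFDerivAt.comp_hasDerivAt t (hl t)
  have hfd : ContDiffAt ℝ 1 (fun w => fderiv ℝ H w v) z :=
    (hH.fderiv_right (m := 1) (by norm_num)).clm_apply contDiffAt_const
  have h2 : HasDerivAt (fun t : ℝ => fderiv ℝ H (z + t * v) v) (fderiv ℝ (fun w => fderiv ℝ H w v) z v) 0 := by
    have h3 : HasFDerivAt (fun w => fderiv ℝ H w v) (fderiv ℝ (fun w => fderiv ℝ H w v) z) (z + ((0:ℝ):ℂ) * v) := by
      have := (hfd.differentiableAt (by norm_num)).hasFDerivAt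
      simpa using this
    exact h3.comp_hasDerivAt (0:ℝ) (hl 0)
  have he : deriv (fun t : ℝ => H (z + t * v)) =ᶠ[𝓝 0] fun t : ℝ => fderiv ℝ H (z + t * v) v := by
    filter_upwards [h1] with t ht using ht.deriv
  refine ⟨h1.mono fun t ht => ht.differentiableAt, ?_, ?_⟩
  · exact (h2.congr_of_eventuallyEq he).differentiableAt
  · exact (h2.congr_of_eventuallyEq he).deriv

/-- Laplacian in the frozen shape -/
def LL (G : ℂ → ℝ) (z : ℂ) : ℝ := fderiv ℝ (fun w => fderiv ℝ G w 1) z 1 +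
     fderiv ℝ (fun w => fderiv ℝ G w Complex.I) z Complex.I

lemma LL_eq {G : ℂ → ℝ} {z : ℂ} (hG : ContDiffAt ℝ 2 G z) : LL G z = Laplacian.laplacian G z := by
  rw [InnerProductSpace.laplacian_eq_iteratedFDeriv_complexPlane]
  have hd : DifferentiableAt ℝ (fderiv ℝ G) z :=
    (hG.fderiv_right (m := 1) (by norm_num)).differentiableAt (by norm_num)
  simp only [iteratedFDeriv_two_apply, LL]
  rw [fderiv_clm_apply hd (by fun_prop), fderiv_clm_apply hd (by fun_prop)]
  simp


lemma metric_lower {D : Set ℂ} (hD : IsOpen D) (hb : Bornology.IsBounded D) {z : ℂ} (hz : z ∈ D)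
    {e : ℂ → ℂ} (he : Hol2 D e) (h1 : (∫ a in D, ‖e a‖ ^ 2) = 1) (hez : e z = kap D z)
    (ho : ∀ F, Hol2 D F → ∫ a in D, cj (e a) * F a = F z / kap D z) :
    0 < (∫ a in D, ‖(a - z) * e a‖ ^ 2) ∧
    4 / (∫ a in D, ‖(a - z) * e a‖ ^ 2) ≤ LL (fun z => Real.log (kap D z ^ 2)) z := by
  obtain ⟨R, hR⟩ := hb.subset_closedBall z
  have hh : Hol2 D (fun a => (a - z) * e a) := by
    refine ⟨by have := he.1; fun_prop, ?_⟩
    refine MemLp.of_le_mul (c := R) he.2 ?_ ?_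
    · exact AEStronglyMeasurable.mul (by fun_prop) he.2.1
    · filter_upwards [ae_restrict_mem hD.measurableSet] with a ha
      rw [norm_mul]
      have := hR ha
      rw [mem_closedBall, dist_eq_norm] at this
      gcongr
  set h : ℂ → ℂ := fun a => (a - z) * e a with hhd
  set M := ∫ a in D, ‖h a‖ ^ 2 with hM
  have he2 : Integrable (fun a => ‖e a‖ ^ 2) (volume.restrict D) := (memLp_two_iff_integrable_sq_norm he.2.1).1 he.2
  have hh2 : Integrable (fun a => ‖h a‖ ^ 2) (volume.restrict D) := (memLp_two_iff_integrable_sq_norm hh.2.1).1 hh.2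
  have hMpos : 0 < M := by
    refine lt_of_le_of_ne (integral_nonneg fun a => by positivity) fun h0 => ?_
    have h2 := (integral_eq_zero_iff_of_nonneg (fun a => by positivity) hh2).1 h0.symm
    have h3 : ∫ a in D, ‖e a‖ ^ 2 = 0 := by
      rw [integral_eq_zero_iff_of_nonneg (fun a => by positivity) he2]
      have h4 : ∀ᵐ a ∂(volume.restrict D), a ≠ z := by
        refine ae_restrict_of_ae ?_
        simp [ae_iff]
      filter_upwards [h2, h4] with a ha ha2
      simp [hhd, sub_eq_zero, ha2] at ha
      simp [ha]
    linarith
  refine ⟨hMpos, ?_⟩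
  have hkp := kap_pos hD hb hz
  have horth : ∫ a in D, cj (e a) * h a = 0 := by rw [ho h hh]; simp [hhd]
  have hcross : Integrable (fun a => cj (e a) * h a) (volume.restrict D) := by
    have : MemLp (fun a => cj (e a)) 2 (volume.restrict D) := he.2.star
    exact this.integrable_mul hh.2
  have low : ∀ y ∈ D, ‖e y‖ ^ 2 * (1 + ‖y - z‖ ^ 2 / M) ≤ kap D y ^ 2 := by
    intro y hy
    set b : ℂ := cj (y - z) / M with hbd
    have hF : Hol2 D (fun a => e a + b * h a) :=
      ⟨he.1.add (hh.1.const_mul b), he.2.add (hh.2.const_mul b)⟩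
    have hn : ∫ a in D, ‖e a + b * h a‖ ^ 2 = 1 + ‖y - z‖ ^ 2 / M := by
      have hpt : ∀ a, ‖e a + b * h a‖ ^ 2 = ‖e a‖ ^ 2 + ‖b‖ ^ 2 * ‖h a‖ ^ 2 + 2 * (b * (cj (e a) * h a)).re := by
        intro a
        rw [← Complex.normSq_eq_norm_sq, Complex.normSq_add, Complex.normSq_eq_norm_sq, Complex.normSq_eq_norm_sq,
          norm_mul, mul_pow]
        congr 2
        simp [cj]; ring
      simp_rw [hpt]
      rw [integral_add, integral_add, integral_const_mul, integral_const_mul, h1, ← hM]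
      · have : ∫ a in D, (b * (cj (e a) * h a)).re = 0 := by
          have h5 := integral_re (𝕜 := ℂ) (hcross.const_mul b)
          rw [integral_const_mul, horth] at h5
          simpa using h5
        rw [this, hbd, norm_div, Complex.norm_conj, Complex.norm_real, Real.norm_eq_abs, abs_of_pos hMpos]
        field_simp; ring
      · exact he2
      · exact hh2.const_mul _
      · exact he2.add (hh2.const_mul _)
      · exact ((hcross.const_mul b).re).const_mul 2
    have h6 := kap_le hD hb hy hF
    rw [hn] at h6
    have h7 : e y + b * h y = e y * (((1 + ‖y - z‖ ^ 2 / M : ℝ)) : ℂ) := by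
      have : cj (y - z) * (y - z) = ((‖y - z‖ ^ 2 : ℝ) : ℂ) := by
        rw [mul_comm, cj, Complex.mul_conj, Complex.normSq_eq_norm_sq]
      push_cast at this
      simp only [hhd, hbd]
      push_cast
      rw [← this]; ring
    have hpos : 0 < 1 + ‖y - z‖ ^ 2 / M := by positivity
    rw [h7, norm_mul, Complex.norm_real, Real.norm_eq_abs, abs_of_pos hpos] at h6
    have h8 : (‖e y‖ * (1 + ‖y - z‖ ^ 2 / M)) ^ 2 ≤ (kap D y * Real.sqrt (1 + ‖y - z‖ ^ 2 / M)) ^ 2 := by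
      gcongr
    rw [mul_pow, mul_pow, Real.sq_sqrt hpos.le] at h8
    have : (‖e y‖ ^ 2 * (1 + ‖y - z‖ ^ 2 / M)) * (1 + ‖y - z‖ ^ 2 / M) ≤ kap D y ^ 2 * (1 + ‖y - z‖ ^ 2 / M) := by
      calc _ = _ := by ring
        _ ≤ _ := h8
    exact le_of_mul_le_mul_right this hpos
  have hez0 : e z ≠ 0 := by rw [hez]; exact_mod_cast hkp.ne'
  have hean : AnalyticAt ℂ e z := he.1.analyticAt (hD.mem_nhds hz)
  have hharm := (hean.harmonicAt_log_norm hez0)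
  set Q : ℂ → ℝ := fun y => Real.log ‖e y‖ with hQ
  set P : ℂ → ℝ := fun z => Real.log (kap D z ^ 2) with hP
  have hPs : ContDiffAt ℝ 2 P z := kap_smooth hD hb hz
  have hQ2 := hharm.const_smul (c := (2:ℝ))
  set H : ℂ → ℝ := P - (2:ℝ) • Q with hH
  have hHs : ContDiffAt ℝ 2 H z := hPs.sub hQ2.1
  have hLL : LL P z = LL H z := by
    rw [LL_eq hPs, LL_eq hHs, hH, ContDiffAt.laplacian_sub hPs hQ2.1, hQ2.2.self_of_nhds]
    simp
  have hH0 : H z = 0 := by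
    simp [hH, hP, hQ, hez, abs_of_pos hkp, Real.log_pow]
  have hev : ∀ᶠ y in 𝓝 z, Real.log (1 + ‖y - z‖ ^ 2 / M) ≤ H y := by
    filter_upwards [hD.mem_nhds hz, hean.continuousAt.eventually_ne hez0] with y hy hey
    have := low y hy
    have hep : 0 < ‖e y‖ := norm_pos_iff.2 hey
    have h9 := Real.log_le_log (by positivity) this
    rw [Real.log_mul (by positivity) (by positivity), Real.log_pow] at h9
    simp only [hH, hP, hQ, Pi.sub_apply, Pi.smul_apply, smul_eq_mul]
    push_cast at h9
    linarith
  have hdir : ∀ v : ℂ, ‖v‖ = 1 → 2 / M ≤ fderiv ℝ (fun w => fderiv ℝ H w v) z v := by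
    intro v hv
    obtain ⟨b1, b2, b3⟩ := line_deriv (v := v) hHs
    rw [← b3]
    refine second_test hMpos (by simp [hH0]) ?_ b1 b2
    have hc : Tendsto (fun t : ℝ => z + t * v) (𝓝 0) (𝓝 z) := by
      have : Tendsto (fun t : ℝ => z + t * v) (𝓝 0) (𝓝 (z + ((0:ℝ):ℂ) * v)) :=
        Continuous.tendsto (by fun_prop) _
      simpa using this
    filter_upwards [hc.eventually hev] with t ht
    simpa [hv] using ht
  rw [hLL, LL]
  have i1 := hdir 1 (by simp)
  have i2 := hdir Complex.I (by simp)
  have : 4 / M = 2 / M + 2 / M := by ring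
  linarith


lemma mem_L2h {D : Set ℂ} (hD : IsOpen D) {f : ℂ → ℂ} : f ∈ L2h D ↔ Hol2 D f := by
  unfold L2h Hol2
  simp only [mem_setOf_eq]
  refine and_congr_right fun h => ?_
  have hm : AEStronglyMeasurable f (volume.restrict D) :=
    h.continuousOn.aestronglyMeasurable hD.measurableSet
  rw [MemLp, and_iff_right hm, eLpNorm_lt_top_iff_lintegral_rpow_enorm_lt_top (by norm_num) (by norm_num)]
  simp [enorm_eq_nnnorm]

lemma lint_sq {D : Set ℂ} {f : ℂ → ℂ} (hf : MemLp f 2 (volume.restrict D)) :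
    ∫⁻ w in D, (‖f w‖₊ : ℝ≥0∞) ^ 2 = ENNReal.ofReal (∫ a in D, ‖f a‖ ^ 2) := by
  rw [ofReal_integral_eq_lintegral_ofReal ((memLp_two_iff_integrable_sq_norm hf.1).1 hf)
    (Eventually.of_forall fun a => by positivity)]
  refine lintegral_congr fun a => ?_
  rw [ENNReal.ofReal_pow (norm_nonneg _), ofReal_norm, enorm_eq_nnnorm]

lemma bergmanKernel_eq {D : Set ℂ} (hD : IsOpen D) (hb : Bornology.IsBounded D) {z : ℂ} (hz : z ∈ D) :
    (bergmanKernel D z).toReal = kap D z ^ 2 := by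
  have : bergmanKernel D z = ENNReal.ofReal (kap D z ^ 2) := by
    apply le_antisymm
    · refine iSup_le fun f => iSup_le fun hf => iSup_le fun _ => ?_
      have hf := (mem_L2h hD).1 hf
      rw [lint_sq hf.2]
      refine ENNReal.div_le_of_le_mul ?_
      have h1 := kap_le hD hb hz hf
      have h2 : ‖f z‖ ^ 2 ≤ kap D z ^ 2 * (∫ a in D, ‖f a‖ ^ 2) := by
        calc ‖f z‖ ^ 2 ≤ (kap D z * Real.sqrt (∫ a in D, ‖f a‖ ^ 2)) ^ 2 := by gcongr
          _ = _ := by rw [mul_pow, Real.sq_sqrt (integral_nonneg fun a => by positivity)]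
      rw [← ENNReal.ofReal_mul (by positivity), ← enorm_eq_nnnorm, ← ofReal_norm, ← ENNReal.ofReal_pow (norm_nonneg _)]
      exact ENNReal.ofReal_le_ofReal h2
    · obtain ⟨e, he, -, h1, hez, -⟩ := exists_ez hD hb hz
      have hkp := kap_pos hD hb hz
      refine le_iSup_of_le e (le_iSup_of_le ((mem_L2h hD).2 he) (le_iSup_of_le ⟨z, hz, ?_⟩ ?_))
      · rw [hez]; exact_mod_cast hkp.ne'
      · rw [lint_sq he.2, h1, ENNReal.ofReal_one, div_one, ← enorm_eq_nnnorm, ← ofReal_norm,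
          ← ENNReal.ofReal_pow (norm_nonneg _), hez, Complex.norm_real, Real.norm_eq_abs, abs_of_pos hkp]
  rw [this, ENNReal.toReal_ofReal (by positivity)]

lemma metric_eq {D : Set ℂ} (hD : IsOpen D) (hb : Bornology.IsBounded D) {z : ℂ} (hz : z ∈ D) :
    bergmanMetricOne D z = Real.sqrt ((1 / 4) * LL (fun z => Real.log (kap D z ^ 2)) z) := by
  unfold bergmanMetricOne LL
  have h : (fun v => Real.log (bergmanKernel D v).toReal) =ᶠ[𝓝 z] fun z => Real.log (kap D z ^ 2) := by
    filter_upwards [hD.mem_nhds hz] with y hy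
    rw [bergmanKernel_eq hD hb hy]
  have h2 : ∀ u : ℂ, (fun w => fderiv ℝ (fun v => Real.log (bergmanKernel D v).toReal) w u) =ᶠ[𝓝 z]
      fun w => fderiv ℝ (fun z => Real.log (kap D z ^ 2)) w u := fun u => by
    filter_upwards [h.fderiv (𝕜 := ℝ)] with w hw
    rw [hw]
  rw [(h2 1).fderiv_eq, (h2 Complex.I).fderiv_eq]

/-- reduction of the theorem -/
lemma metric_tendsto {D : Set ℂ} (hD : IsOpen D) (hb : Bornology.IsBounded D) {w : ℂ}
    (e : ℂ → ℂ → ℂ) (he : ∀ z ∈ D, Hol2 D (e z) ∧ (∫ a in D, ‖e z a‖ ^ 2) = 1 ∧ e z z = kap D z ∧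
      ∀ F, Hol2 D F → ∫ a in D, cj (e z a) * F a = F z / kap D z)
    (ht : Tendsto (fun z => ∫ a in D, ‖(a - z) * e z a‖ ^ 2) (𝓝[D] w) (𝓝 0)) :
    Tendsto (fun z => bergmanMetricOne D z) (𝓝[D] w) atTop := by
  have h1 : Tendsto (fun z => ∫ a in D, ‖(a - z) * e z a‖ ^ 2) (𝓝[D] w) (𝓝[>] 0) := by
    rw [tendsto_nhdsWithin_iff]
    refine ⟨ht, ?_⟩
    filter_upwards [self_mem_nhdsWithin] with z hz
    obtain ⟨a1, a2, a3, a4⟩ := he z hz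
    exact (metric_lower hD hb hz a1 a2 a3 a4).1
  have h2 := Real.tendsto_sqrt_atTop.comp (tendsto_inv_nhdsGT_zero.comp h1)
  refine tendsto_atTop_mono' _ ?_ h2
  filter_upwards [self_mem_nhdsWithin] with z hz
  obtain ⟨a1, a2, a3, a4⟩ := he z hz
  rw [metric_eq hD hb hz]
  have := (metric_lower hD hb hz a1 a2 a3 a4).2
  refine Real.sqrt_le_sqrt ?_
  simp only [Function.comp]
  rw [inv_eq_one_div]
  have e : 1 / (∫ a in D, ‖(a - z) * e z a‖ ^ 2) = 1 / 4 * (4 / (∫ a in D, ‖(a - z) * e z a‖ ^ 2)) := by ring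
  rw [e]; gcongr


lemma glob_int {D : Set ℂ} (hD : IsOpen D) (hb : Bornology.IsBounded D) {f : ℂ → ℂ}
    (hf : MemLp f 2 (volume.restrict D)) (h0 : ∀ x ∉ D, f x = 0) :
    Integrable f ∧ ∃ R : ℝ, 0 < R ∧ ∀ x, R ≤ ‖x‖ → f x = 0 := by
  have := fin_of_bdd hb
  obtain ⟨R, hR, hRD⟩ := bdd_R hb
  refine ⟨?_, R, hR, fun x hx => h0 x fun h => absurd (hRD x h) (not_lt.2 hx)⟩
  have h1 : IntegrableOn f D := hf.integrable (by norm_num)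
  rw [← integrable_indicator_iff hD.measurableSet] at h1
  have e : D.indicator f = f := by
    ext x
    by_cases hx : x ∈ D
    · simp [hx]
    · simp [hx, h0 x hx]
  rwa [e] at h1

lemma set_eq {D : Set ℂ} {g : ℂ → ℂ} (h0 : ∀ x ∉ D, g x = 0) : ∫ a in D, g a = ∫ a, g a :=
  setIntegral_eq_integral_of_forall_compl_eq_zero h0

lemma set_leq {D : Set ℂ} (hD : MeasurableSet D) {g : ℂ → ℝ≥0∞} (h0 : ∀ x ∉ D, g x = 0) : ∫⁻ a in D, g a = ∫⁻ a, g a := by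
  rw [← lintegral_indicator hD]
  congr 1; ext x
  by_cases hx : x ∈ D
  · simp [hx]
  · simp [hx, h0 x hx]

lemma lint_sq' {D : Set ℂ} {f : ℂ → ℂ} (hf : MemLp f 2 (volume.restrict D)) :
    ∫⁻ w in D, ‖f w‖ₑ ^ 2 = ENNReal.ofReal (∫ a in D, ‖f a‖ ^ 2) := by
  simpa [enorm_eq_nnnorm] using lint_sq hf

lemma memLp_of_lint {μ : Measure ℂ} {f : ℂ → ℂ} (hm : AEStronglyMeasurable f μ)
    (h : ∫⁻ w, ‖f w‖ₑ ^ 2 ∂μ < ⊤) : MemLp f 2 μ := by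
  refine ⟨hm, ?_⟩
  rw [eLpNorm_lt_top_iff_lintegral_rpow_enorm_lt_top (by norm_num) (by norm_num)]
  simpa using h

/-- general Weyl in L² on bounded sets -/
lemma weyl2 {D : Set ℂ} (hD : IsOpen D) (hb : Bornology.IsBounded D) {f : ℂ → ℂ}
    (hf : MemLp f 2 (volume.restrict D)) (hw : WH D f) :
    ∃ F, Hol2 D F ∧ f =ᵐ[volume.restrict D] F := by
  have hi : D.indicator f =ᵐ[volume.restrict D] f := by
    filter_upwards [ae_restrict_mem hD.measurableSet] with x hx using indicator_of_mem hx _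
  have hm : MemLp (D.indicator f) 2 (volume.restrict D) := (memLp_congr_ae hi).2 hf
  obtain ⟨h1, R, hR, h2⟩ := glob_int hD hb hm (fun x hx => indicator_of_notMem hx _)
  have hw' : WH D (D.indicator f) := by
    intro η hη
    rw [← hw η hη]
    congr 1; ext x
    by_cases hx : x ∈ D
    · simp [hx]
    · have : dbar η x = 0 := dbar_zero_of_notMem fun h => hx (hη.supp h)
      simp [this]
  obtain ⟨F, hF, hFe⟩ := weyl hD h1 h2 hw'
  have := hi.symm.trans hFe
  exact ⟨F, ⟨hF, (memLp_congr_ae this).1 hf⟩, this⟩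

lemma conv_meas {k g : ℂ → ℂ} (hk : Measurable k) (hg : AEStronglyMeasurable g volume) (μ : Measure ℂ) [SFinite μ] :
    AEStronglyMeasurable (fun a => ∫ ζ, k (a - ζ) * g ζ) μ := by
  have h : AEStronglyMeasurable (fun p : ℂ × ℂ => k (p.1 - p.2) * g p.2) (μ.prod volume) := by
    refine AEStronglyMeasurable.mul ?_ hg.comp_snd
    exact (hk.comp (by fun_prop)).aestronglyMeasurable
  exact h.integral_prod_right'

lemma Cau_meas {g : ℂ → ℂ} (hg : AEStronglyMeasurable g volume) (μ : Measure ℂ) [SFinite μ] :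
    AEStronglyMeasurable (Cau g) μ :=
  (conv_meas (k := fun x => x⁻¹) (by fun_prop) hg μ).const_mul _

lemma enorm_inv_ke (x : ℂ) : ‖x⁻¹‖ₑ = ke x := by
  rw [ke, ← norm_inv, ofReal_norm]

lemma enorm_inv_le_ke (x : ℂ) : ‖x⁻¹‖ₑ ≤ ke x := (enorm_inv_ke x).le

lemma pi_inv_enorm : ‖(Real.pi : ℂ)⁻¹‖ₑ ≤ 1 := by
  rw [← ofReal_norm, norm_inv, Complex.norm_real, Real.norm_eq_abs, abs_of_pos Real.pi_pos]
  rw [← ENNReal.ofReal_one]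
  refine ENNReal.ofReal_le_ofReal ?_
  rw [inv_le_one₀ Real.pi_pos]
  linarith [Real.pi_gt_three]

lemma Cau_le (g : ℂ → ℂ) (a : ℂ) : ‖Cau g a‖ₑ ≤ ∫⁻ ζ, ke (a - ζ) * ‖g ζ‖ₑ := by
  rw [Cau, enorm_mul]
  calc _ ≤ 1 * ‖∫ ζ, (a - ζ)⁻¹ * g ζ‖ₑ := by gcongr; exact pi_inv_enorm
    _ ≤ ∫⁻ ζ, ‖(a - ζ)⁻¹ * g ζ‖ₑ := by rw [one_mul]; exact enorm_integral_le_lintegral_enorm _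
    _ = _ := by simp_rw [enorm_mul, enorm_inv_ke]

lemma Cau_L2 (D E : Set ℂ) (hE : MeasurableSet E) {ρ : ℝ} (hρ : 0 < ρ) {g : ℂ → ℂ} (hg : AEMeasurable g) (h0 : ∀ x ∉ E, g x = 0) :
    ∫⁻ a in D, ‖Cau g a‖ₑ ^ 2 ≤ (ENNReal.ofReal (2 * Real.pi * ρ) + ENNReal.ofReal ρ⁻¹ * volume E) *
      (ENNReal.ofReal (2 * Real.pi * ρ) + ENNReal.ofReal ρ⁻¹ * volume D) * ∫⁻ a in E, ‖g a‖ₑ ^ 2 := by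
  have h1 : ∀ a, ‖Cau g a‖ₑ ≤ ∫⁻ ζ in E, ke (a - ζ) * ‖g ζ‖ₑ := fun a => by
    rw [set_leq hE (fun x hx => by simp [h0 x hx])]
    exact Cau_le g a
  refine le_trans (lintegral_mono fun a => pow_le_pow_left' (h1 a) 2) ?_
  refine schur (volume.restrict D) (volume.restrict E) (κ := fun a b => ke (a - b))
    (ke_meas.comp (by fun_prop)) (hg.enorm.restrict) (fun a => ke_set E a hρ) (fun b => ?_)
  simp_rw [← ke_neg (_ - b), neg_sub]
  exact ke_set D b hρ

lemma Cau_memLp {D : Set ℂ} (hD : IsOpen D) (hb : Bornology.IsBounded D) {f : ℂ → ℂ}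
    (hf : MemLp f 2 (volume.restrict D)) (h0 : ∀ x ∉ D, f x = 0) : MemLp (Cau f) 2 (volume.restrict D) := by
  obtain ⟨hi, -⟩ := glob_int hD hb hf h0
  refine memLp_of_lint (Cau_meas hi.1 _) ?_
  refine (Cau_L2 D D hD.measurableSet one_pos hi.1.aemeasurable h0).trans_lt ?_
  rw [lint_sq' hf]
  have hv : volume D < ⊤ := hb.measure_lt_top
  have : ENNReal.ofReal (2 * Real.pi * 1) + ENNReal.ofReal 1⁻¹ * volume D < ⊤ :=
    ENNReal.add_lt_top.2 ⟨ENNReal.ofReal_lt_top, ENNReal.mul_lt_top (by simp) hv⟩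
  exact ENNReal.mul_lt_top (ENNReal.mul_lt_top this this) (by simp)

/-- The conjugate-multiplied kernel function is orthogonal to A. -/
lemma g_orth {D : Set ℂ} (hD : IsOpen D) (hb : Bornology.IsBounded D) {z : ℂ}
    {e : ℂ → ℂ} (he : Hol2 D e)
    (ho : ∀ F, Hol2 D F → ∫ a in D, cj (e a) * F a = F z / kap D z) :
    MemLp (fun a => cj (a - z) * e a) 2 (volume.restrict D) ∧ 
    ∀ F, Hol2 D F → ∫ a in D, cj (F a) * (cj (a - z) * e a) = 0 := by
  obtain ⟨R, hR⟩ := hb.subset_closedBall z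
  have hbd : ∀ᵐ a ∂(volume.restrict D), ‖a - z‖ ≤ R := by
    filter_upwards [ae_restrict_mem hD.measurableSet] with a ha
    simpa [dist_eq_norm] using hR ha
  have hcont : Continuous (fun a : ℂ => cj (a - z)) := Complex.continuous_conj.comp (by fun_prop)
  constructor
  · refine MemLp.of_le_mul (c := R) he.2 (hcont.aestronglyMeasurable.mul he.2.1) ?_
    filter_upwards [hbd] with a ha
    rw [norm_mul, Complex.norm_conj]; gcongr
  · intro F hF
    have hG : Hol2 D (fun a => (a - z) * F a) := by
      refine ⟨by have := hF.1; fun_prop, ?_⟩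
      refine MemLp.of_le_mul (c := R) hF.2 (AEStronglyMeasurable.mul (by fun_prop) hF.2.1) ?_
      filter_upwards [hbd] with a ha
      rw [norm_mul]; gcongr
    have h1 := ho _ hG
    simp only [sub_self, zero_mul, zero_div] at h1
    have h2 : ∫ a in D, cj (cj (e a) * ((a - z) * F a)) = 0 := by
      rw [show (∫ a in D, cj (cj (e a) * ((a - z) * F a))) = cj (∫ a in D, (cj (e a) * ((a - z) * F a)))
        from integral_conj, h1]; simp
    rw [← h2]
    congr 1; ext a
    simp [cj]; ring

lemma L4a {D : Set ℂ} (hD : IsOpen D) (hb : Bornology.IsBounded D) {z : ℂ}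
    {e : ℂ → ℂ} (he : Hol2 D e) (h0 : ∀ x ∉ D, e x = 0)
    (ho : ∀ F, Hol2 D F → ∫ a in D, cj (e a) * F a = F z / kap D z) :
    ∫ a in D, ‖(a - z) * e a‖ ^ 2 ≤ ∫ a in D, ‖Cau e a‖ ^ 2 := by
  obtain ⟨hh, hor⟩ := g_orth hD hb he ho
  have hC := Cau_memLp hD hb he.2 h0
  obtain ⟨hi, R, hR, hRe⟩ := glob_int hD hb he.2 h0
  have hwe : WH D e := hol_WH hD he.1 (Eventually.of_forall fun x _ => rfl)
  have hχ : ContDiff ℝ ∞ (fun a => cj a - cj z) := contDiff_conj_sub _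
  have hwd := lemH (D'' := D) hi hRe hwe hχ inter_subset_right
  simp_rw [dbar_conj_sub, mul_one] at hwd
  have e1 : ∀ a, cj a - cj z = cj (a - z) := fun a => (map_sub _ _ _).symm
  simp_rw [e1] at hwd
  obtain ⟨F, hF, hFe⟩ := weyl2 hD hb (hh.sub hC) hwd
  have hcross := hor F hF
  set h : ℂ → ℂ := fun a => cj (a - z) * e a with hhd
  have hn : ∫ a in D, ‖(a - z) * e a‖ ^ 2 = ∫ a in D, ‖h a‖ ^ 2 := by
    simp only [hhd, norm_mul, Complex.norm_conj]
  have hh2 : Integrable (fun a => ‖h a‖ ^ 2) (volume.restrict D) := (memLp_two_iff_integrable_sq_norm hh.1).1 hh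
  have hF2 : Integrable (fun a => ‖F a‖ ^ 2) (volume.restrict D) := (memLp_two_iff_integrable_sq_norm hF.2.1).1 hF.2
  have hci : Integrable (fun a => cj (F a) * h a) (volume.restrict D) := by
    have : MemLp (fun a => cj (F a)) 2 (volume.restrict D) := hF.2.star
    exact this.integrable_mul hh
  have hpt : ∀ᵐ a ∂(volume.restrict D), ‖Cau e a‖ ^ 2 = ‖h a‖ ^ 2 + ‖F a‖ ^ 2 - 2 * (cj (F a) * h a).re := by
    filter_upwards [hFe] with a ha
    have : Cau e a = h a - F a := by rw [← ha]; simp [hhd]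
    rw [this, ← Complex.normSq_eq_norm_sq, Complex.normSq_sub, Complex.normSq_eq_norm_sq, Complex.normSq_eq_norm_sq]
    congr 2
    simp [cj]; ring
  have : ∫ a in D, (cj (F a) * h a).re = 0 := by
    have h5 := integral_re (𝕜 := ℂ) hci
    rw [hcross] at h5
    simpa using h5
  rw [hn, integral_congr_ae hpt, integral_sub, integral_add hh2 hF2, integral_const_mul]
  · rw [this]
    have : 0 ≤ ∫ a in D, ‖F a‖ ^ 2 := integral_nonneg fun a => by positivity
    linarith
  · exact hh2.add hF2
  · exact hci.re.const_mul 2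


/-- truncated kernel -/
def kd (δ : ℝ) (x : ℂ) : ℂ := if δ ≤ ‖x‖ then x⁻¹ else 0

lemma kd_meas (δ : ℝ) : Measurable (kd δ) := by
  unfold kd
  refine Measurable.ite (measurableSet_le measurable_const (by fun_prop)) (by fun_prop) measurable_const

lemma kd_norm {δ : ℝ} (hδ : 0 < δ) (x : ℂ) : ‖kd δ x‖ ≤ δ⁻¹ := by
  unfold kd
  split_ifs with h
  · rw [norm_inv]; gcongr
  · simp; positivity

lemma Cau_split {δ : ℝ} (hδ : 0 < δ) {g : ℂ → ℂ} (hg : Integrable g) (a : ℂ) :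
    ‖Cau g a‖ₑ ≤ ‖∫ ζ, kd δ (a - ζ) * g ζ‖ₑ + ∫⁻ ζ, (ball (0:ℂ) δ).indicator ke (a - ζ) * ‖g ζ‖ₑ := by
  by_cases hi : Integrable (fun ζ => (a - ζ)⁻¹ * g ζ)
  · have h1 : Integrable (fun ζ => kd δ (a - ζ) * g ζ) := by
      refine hg.bdd_mul (c := δ⁻¹) ((kd_meas δ).comp (by fun_prop)).aestronglyMeasurable ?_
      exact Eventually.of_forall fun x => kd_norm hδ _
    have h2 : ∫ ζ, (a - ζ)⁻¹ * g ζ = (∫ ζ, kd δ (a - ζ) * g ζ) + ∫ ζ, ((a - ζ)⁻¹ * g ζ - kd δ (a - ζ) * g ζ) := by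
      rw [integral_sub hi h1]; ring
    rw [Cau, enorm_mul, h2]
    calc _ ≤ 1 * (‖∫ ζ, kd δ (a - ζ) * g ζ‖ₑ + ‖∫ ζ, ((a - ζ)⁻¹ * g ζ - kd δ (a - ζ) * g ζ)‖ₑ) := by
          gcongr
          · exact pi_inv_enorm
          · exact enorm_add_le _ _
      _ ≤ _ := by
          rw [one_mul]
          gcongr
          refine (enorm_integral_le_lintegral_enorm _).trans (lintegral_mono fun ζ => ?_)
          rw [← sub_mul, enorm_mul]
          gcongr
          unfold kd
          split_ifs with h
          · simp
          · rw [indicator_of_mem (by simpa using h), sub_zero, enorm_inv_ke]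
  · rw [Cau, integral_undef hi]; simp

open Classical in
lemma hol_meas {D : Set ℂ} (hD : IsOpen D) {f : ℂ → ℂ} (hf : DifferentiableOn ℂ f D)
    (h0 : ∀ x ∉ D, f x = 0) : Measurable f := by
  have h := ContinuousOn.measurable_piecewise (s := D) hf.continuousOn
    (continuousOn_const (c := (0:ℂ))) hD.measurableSet
  convert h using 1
  ext x
  by_cases hx : x ∈ D
  · simp [hx]
  · simp [hx, h0 x hx]

lemma L4b {ι : Type*} {l : Filter ι} [l.IsCountablyGenerated] {D : Set ℂ} (hD : IsOpen D) (hb : Bornology.IsBounded D)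
    (e : ι → ℂ → ℂ) (he : ∀ᶠ i in l, Hol2 D (e i) ∧ (∀ x ∉ D, e i x = 0) ∧ (∫ a in D, ‖e i a‖ ^ 2) = 1)
    (hweak : ∀ G, MemLp G 2 (volume.restrict D) → Tendsto (fun i => ∫ a in D, cj (e i a) * G a) l (𝓝 0)) :
    Tendsto (fun i => ∫ a in D, ‖Cau (e i) a‖ ^ 2) l (𝓝 0) := by
  have hfin := fin_of_bdd hb
  have hv : volume D < ⊤ := hb.measure_lt_top
  have step : ∀ δ > 0, Tendsto (fun i => ∫⁻ a in D, ‖∫ ζ, kd δ (a - ζ) * e i ζ‖ₑ ^ 2) l (𝓝 0) := by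
    intro δ hδ
    have h := tendsto_lintegral_filter_of_dominated_convergence (μ := volume.restrict D) (l := l)
      (F := fun i a => ‖∫ ζ, kd δ (a - ζ) * e i ζ‖ₑ ^ 2) (f := fun _ => 0)
      (fun _ => (ENNReal.ofReal (δ⁻¹ ^ 2) * volume D)) ?_ ?_ ?_ ?_
    · simpa using h
    · filter_upwards [he] with i ⟨h1, h2, h3⟩
      have hm := hol_meas hD h1.1 h2
      have h : StronglyMeasurable (fun p : ℂ × ℂ => kd δ (p.1 - p.2) * e i p.2) :=
        (((kd_meas δ).comp (by fun_prop)).mul (hm.comp measurable_snd)).stronglyMeasurable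
      exact (h.integral_prod_right'.measurable.enorm).pow_const 2
    · filter_upwards [he] with i ⟨h1, h2, h3⟩
      refine Eventually.of_forall fun a => ?_
      have hm : AEMeasurable (e i) (volume.restrict D) := h1.2.1.aemeasurable
      calc ‖∫ ζ, kd δ (a - ζ) * e i ζ‖ₑ ^ 2 ≤ (∫⁻ ζ in D, ENNReal.ofReal δ⁻¹ * ‖e i ζ‖ₑ) ^ 2 := by
            gcongr
            rw [← set_eq (D := D) (fun x hx => by simp [h2 x hx])]
            refine (enorm_integral_le_lintegral_enorm _).trans (lintegral_mono fun ζ => ?_)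
            rw [enorm_mul]
            gcongr
            rw [← ofReal_norm]
            exact ENNReal.ofReal_le_ofReal (kd_norm hδ _)
        _ ≤ _ := lint_cs _ (by fun_prop) hm.enorm
        _ = _ := by
            rw [lint_sq' h1.2, h3]
            rw [ENNReal.ofReal_pow (inv_nonneg.2 hδ.le)]
            simp
    · simp only [lintegral_const, Measure.restrict_apply_univ]
      exact (ENNReal.mul_lt_top (ENNReal.mul_lt_top (by simp) hv) hv).ne
    · refine Eventually.of_forall fun a => ?_
      have h1 := hweak (fun ζ => cj (kd δ (a - ζ))) (by
        refine MemLp.of_bound (C := δ⁻¹) ?_ ?_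
        · exact (Complex.continuous_conj.measurable.comp ((kd_meas δ).comp (by fun_prop))).aestronglyMeasurable
        · refine Eventually.of_forall fun x => ?_
          rw [Complex.norm_conj]; exact kd_norm hδ _)
      have h2 := ENNReal.Tendsto.pow (n := 2) h1.enorm
      simp only [enorm_zero] at h2
      rw [zero_pow two_ne_zero] at h2
      refine h2.congr' ?_
      filter_upwards [he] with i ⟨_, hz, _⟩
      congr 1
      rw [← set_eq (D := D) (fun x hx => by simp [hz x hx])]
      rw [← ofReal_norm, ← ofReal_norm, ← Complex.norm_conj, ← integral_conj]
      congr 2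
      congr 1
      ext a; simp [cj]; ring
  have main : Tendsto (fun i => ∫⁻ a in D, ‖Cau (e i) a‖ₑ ^ 2) l (𝓝 0) := by
    rw [ENNReal.tendsto_nhds_zero]
    intro ε hε
    obtain ⟨δ, hδ1, hδ⟩ : ∃ δ : ℝ, 2 * ENNReal.ofReal (2 * Real.pi * δ) ^ 2 ≤ ε / 2 ∧ 0 < δ := by
      have ht : Tendsto (fun δ : ℝ => 2 * ENNReal.ofReal (2 * Real.pi * δ) ^ 2) (𝓝[>] 0) (𝓝 0) := by
        have h1 : Tendsto (fun δ : ℝ => ENNReal.ofReal (2 * Real.pi * δ)) (𝓝[>] 0) (𝓝 0) := by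
          have : Continuous (fun δ : ℝ => ENNReal.ofReal (2 * Real.pi * δ)) :=
            ENNReal.continuous_ofReal.comp (by fun_prop)
          have h3 := (this.tendsto 0).mono_left (nhdsWithin_le_nhds (s := Ioi 0))
          simpa using h3
        have h2 := ENNReal.Tendsto.const_mul (a := 2) (ENNReal.Tendsto.pow (n := 2) h1) (Or.inr (by simp))
        simpa using h2
      have h3 := (ENNReal.tendsto_nhds_zero.1 ht (ε / 2) (ENNReal.half_pos hε.ne')).and self_mem_nhdsWithin
      exact h3.exists
    have hs := ENNReal.tendsto_nhds_zero.1 (step δ hδ) (ε / 4) (ENNReal.div_pos hε.ne' (by simp))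
    filter_upwards [he, hs] with i ⟨h1, h2, h3⟩ h4
    obtain ⟨hi, -⟩ := glob_int hD hb h1.2 h2
    have hind : Measurable ((ball (0:ℂ) δ).indicator ke) := ke_meas.indicator measurableSet_ball
    have hB : ∫⁻ a in D, (∫⁻ ζ, (ball (0:ℂ) δ).indicator ke (a - ζ) * ‖e i ζ‖ₑ) ^ 2 ≤
        ENNReal.ofReal (2 * Real.pi * δ) ^ 2 := by
      have hx := schur (volume.restrict D) volume (κ := fun a b => (ball (0:ℂ) δ).indicator ke (a - b))
        (g := fun ζ => ‖e i ζ‖ₑ) (M1 := ENNReal.ofReal (2 * Real.pi * δ)) (M2 := ENNReal.ofReal (2 * Real.pi * δ))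
        (hind.comp (by fun_prop)) hi.1.aemeasurable.enorm (fun a => by
          rw [lintegral_sub_left_eq_self ((ball (0:ℂ) δ).indicator ke) a, lintegral_indicator measurableSet_ball]
          exact ke_ball δ) (fun b => by
          refine (setLIntegral_le_lintegral _ _).trans ?_
          rw [lintegral_sub_right_eq_self ((ball (0:ℂ) δ).indicator ke) b, lintegral_indicator measurableSet_ball]
          exact ke_ball δ)
      refine hx.trans ?_
      rw [← set_leq hD.measurableSet (fun x hx => by simp [h2 x hx]), lint_sq' h1.2, h3]
      simp [sq]
    have hA : AEMeasurable (fun a => 2 * ‖∫ ζ, kd δ (a - ζ) * e i ζ‖ₑ ^ 2) (volume.restrict D) :=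
      (((conv_meas (kd_meas δ) hi.1 _).aemeasurable.enorm).pow_const 2).const_mul 2
    calc ∫⁻ a in D, ‖Cau (e i) a‖ₑ ^ 2 ≤ ∫⁻ a in D, (2 * ‖∫ ζ, kd δ (a - ζ) * e i ζ‖ₑ ^ 2 +
          2 * (∫⁻ ζ, (ball (0:ℂ) δ).indicator ke (a - ζ) * ‖e i ζ‖ₑ) ^ 2) := by
          refine lintegral_mono fun a => ?_
          refine (pow_le_pow_left' (Cau_split hδ hi a) 2).trans ?_
          have := ENNReal.rpow_add_le_mul_rpow_add_rpow (‖∫ ζ, kd δ (a - ζ) * e i ζ‖ₑ)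
            (∫⁻ ζ, (ball (0:ℂ) δ).indicator ke (a - ζ) * ‖e i ζ‖ₑ) (p := 2) (by norm_num)
          norm_num at this
          rw [← mul_add]
          exact this
      _ = 2 * (∫⁻ a in D, ‖∫ ζ, kd δ (a - ζ) * e i ζ‖ₑ ^ 2) +
          2 * ∫⁻ a in D, (∫⁻ ζ, (ball (0:ℂ) δ).indicator ke (a - ζ) * ‖e i ζ‖ₑ) ^ 2 := by
          rw [lintegral_add_left' hA, lintegral_const_mul' _ _ (by simp), lintegral_const_mul' _ _ (by simp)]
      _ ≤ 2 * (ε / 4) + 2 * ENNReal.ofReal (2 * Real.pi * δ) ^ 2 := by gcongr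
      _ ≤ ε / 2 + ε / 2 := by
          gcongr
          rw [show (4:ℝ≥0∞) = 2 * 2 by norm_num, ENNReal.div_eq_inv_mul, ENNReal.mul_inv (by simp) (by simp),
            ← mul_assoc, ← mul_assoc, ENNReal.mul_inv_cancel (by simp) (by simp), one_mul, ENNReal.div_eq_inv_mul]
      _ = ε := ENNReal.add_halves ε
  have h2 := (ENNReal.tendsto_toReal ENNReal.zero_ne_top).comp main
  simp only [ENNReal.toReal_zero] at h2
  refine h2.congr' ?_
  filter_upwards [he] with i ⟨h1, hz, _⟩
  simp only [Function.comp]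
  rw [lint_sq' (Cau_memLp hD hb h1.2 hz), ENNReal.toReal_ofReal (integral_nonneg fun a => by positivity)]


lemma vol_ball' (w : ℂ) {r : ℝ} (hr : 0 ≤ r) : volume (ball w r) = ENNReal.ofReal (Real.pi * r ^ 2) := by
  rw [Complex.volume_ball, mul_comm, ENNReal.ofReal_mul Real.pi_pos.le, ENNReal.ofReal_pow hr]
  congr 1
  rw [← NNReal.coe_real_pi, ENNReal.ofReal_coe_nnreal]

lemma Cau_dyad {w : ℂ} {ε : ℝ} (hε : 0 < ε) {g : ℂ → ℂ} (hg : AEMeasurable g)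
    (h0 : ∀ x ∉ ball w (2*ε), g x = 0) (m : ℕ) :
    ∫⁻ a in ball w (4*ε*2^m), ‖Cau g a‖ₑ^2 ≤
      ENNReal.ofReal (108*Real.pi^2*(m+1)*ε^2) * ∫⁻ a in ball w (2*ε), ‖g a‖ₑ^2 := by
  have hp := Real.pi_pos
  set I := ∫⁻ a in ball w (2*ε), ‖g a‖ₑ^2 with hI
  induction m with
  | zero =>
    refine (Cau_L2 (ball w (4*ε*2^0)) (ball w (2*ε)) measurableSet_ball hε hg h0).trans ?_
    rw [vol_ball' _ (by positivity), vol_ball' _ (by positivity)]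
    refine mul_le_mul_left ?_ _
    rw [← ENNReal.ofReal_mul (by positivity), ← ENNReal.ofReal_mul (by positivity),
      ← ENNReal.ofReal_add (by positivity) (by positivity), ← ENNReal.ofReal_add (by positivity) (by positivity),
      ← ENNReal.ofReal_mul (by positivity)]
    refine ENNReal.ofReal_le_ofReal (le_of_eq ?_)
    field_simp
    norm_num
  | succ m ih =>
    set r := 4*ε*2^m with hr
    have hr4 : 4 * ε ≤ r := by
      have : (1:ℝ) ≤ 2^m := one_le_pow₀ (by norm_num)
      nlinarith
    have hr0 : 0 < r := by positivity
    have e1 : 4*ε*2^(m+1) = 2*r := by rw [hr]; ring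
    have hsub : ball w (4*ε*2^(m+1)) ⊆ ball w r ∪ (ball w (2*r) \ ball w r) := by
      rw [e1]; intro x hx
      by_cases h : x ∈ ball w r
      · exact Or.inl h
      · exact Or.inr ⟨hx, h⟩
    have hcs : (∫⁻ a in ball w (2*ε), ‖g a‖ₑ) ^ 2 ≤ ENNReal.ofReal (Real.pi * (2*ε)^2) * I := by
      have := lint_cs (volume.restrict (ball w (2*ε))) (f := fun _ => 1) (g := fun a => ‖g a‖ₑ)
        aemeasurable_const hg.enorm.restrict
      simpa [vol_ball' w (show 0 ≤ 2*ε by positivity)] using this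
    have hfar : ∫⁻ a in ball w (2*r) \ ball w r, ‖Cau g a‖ₑ^2 ≤ ENNReal.ofReal (64*Real.pi^2*ε^2) * I := by
      have hpt : ∀ a ∈ ball w (2*r) \ ball w r, ‖Cau g a‖ₑ^2 ≤
          ENNReal.ofReal ((2/r)^2) * (ENNReal.ofReal (Real.pi * (2*ε)^2) * I) := by
        intro a ha
        have h1 : ‖Cau g a‖ₑ ≤ ENNReal.ofReal (2/r) * ∫⁻ a in ball w (2*ε), ‖g a‖ₑ := by
          refine (Cau_le g a).trans ?_
          rw [← set_leq (D := ball w (2*ε)) measurableSet_ball (fun x hx => by simp [h0 x hx]),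
            ← lintegral_const_mul' _ _ ENNReal.ofReal_ne_top]
          refine setLIntegral_mono' measurableSet_ball fun ζ hζ => ?_
          gcongr
          unfold ke
          refine ENNReal.ofReal_le_ofReal ?_
          have h2 : r ≤ dist a w := by simpa using ha.2
          have h3 : dist ζ w < 2 * ε := hζ
          have h4 := dist_triangle a ζ w
          rw [dist_eq_norm a ζ] at h4
          rw [show 2/r = (r/2)⁻¹ by rw [inv_div]]
          exact inv_anti₀ (by positivity) (by linarith)
        refine (pow_le_pow_left' h1 2).trans ?_
        rw [mul_pow, ← ENNReal.ofReal_pow (by positivity)]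
        gcongr
      refine (setLIntegral_mono' (measurableSet_ball.diff measurableSet_ball) hpt).trans ?_
      rw [setLIntegral_const]
      have hv : volume (ball w (2*r) \ ball w r) ≤ ENNReal.ofReal (Real.pi * (2*r)^2) := by
        rw [← vol_ball' w (by positivity)]; exact measure_mono sdiff_subset
      refine (mul_le_mul_right hv _).trans ?_
      rw [← mul_assoc, mul_right_comm, ← ENNReal.ofReal_mul (by positivity), ← ENNReal.ofReal_mul (by positivity)]
      refine mul_le_mul_left (ENNReal.ofReal_le_ofReal (le_of_eq ?_)) _
      field_simp
      norm_num
    refine (lintegral_mono_set hsub).trans ((lintegral_union_le _ _ _).trans ?_)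
    refine (add_le_add ih hfar).trans ?_
    rw [← add_mul, ← ENNReal.ofReal_add (by positivity) (by positivity)]
    refine mul_le_mul_left (ENNReal.ofReal_le_ofReal ?_) _
    push_cast
    nlinarith [sq_nonneg (Real.pi * ε)]

lemma cutoff (w : ℂ) : ∃ C : ℝ, 0 < C ∧ ∀ ε : ℝ, 0 < ε → ∃ χ : ℂ → ℂ, ContDiff ℝ ∞ χ ∧ (∀ x ∈ ball w ε, χ x = 0) ∧
    (∀ x ∉ ball w (2*ε), χ x = 1) ∧ (∀ x, ‖1 - χ x‖ ≤ 1) ∧ (∀ x, ‖dbar χ x‖ ≤ C / ε) ∧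
    (∀ x ∉ ball w (2*ε) \ ball w ε, dbar χ x = 0) := by
  obtain ⟨β, b1, b2, b3, b4, b5⟩ := exists_bump 0 (r := 1) (R := 3/2) one_pos (by norm_num)
  have ht : IsTest univ β := ⟨b1, b5, subset_univ _⟩
  obtain ⟨C, hC⟩ := ht.dbar.smooth.continuous.bounded_above_of_compact_support ht.dbar.cpt
  refine ⟨max C 1, by positivity, fun ε hε => ?_⟩
  have hd : ∀ x, dbar (fun x => 1 - β (ε⁻¹ • (x - w))) x = -(ε⁻¹ * dbar β (ε⁻¹ • (x - w))) := by
    intro x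
    have h1 : HasFDerivAt (fun x : ℂ => ε⁻¹ • (x - w)) (ε⁻¹ • ContinuousLinearMap.id ℝ ℂ) x :=
      ((hasFDerivAt_id x).sub_const w).const_smul ε⁻¹
    have h2 : HasFDerivAt β (fderiv ℝ β (ε⁻¹ • (x - w))) (ε⁻¹ • (x - w)) :=
      (b1.differentiable (by simp)).differentiableAt.hasFDerivAt
    have h3 := (h2.comp x h1).const_sub 1
    unfold dbar
    have h4 : fderiv ℝ (fun x => 1 - β (ε⁻¹ • (x - w))) x = _ := h3.fderiv
    rw [h4]
    simp
    ring
  have hs : ContDiff ℝ ∞ (fun x => 1 - β (ε⁻¹ • (x - w))) := by fun_prop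
  have hn : ∀ x, ‖ε⁻¹ • (x - w)‖ = dist x w / ε := fun x => by
    rw [norm_smul, dist_eq_norm, Real.norm_of_nonneg (by positivity)]; field_simp
  have hin : ∀ x ∈ ball w ε, (fun x => 1 - β (ε⁻¹ • (x - w))) x = 0 := by
    intro x hx
    have : ε⁻¹ • (x - w) ∈ closedBall (0:ℂ) 1 := by
      rw [mem_closedBall_zero_iff, hn, div_le_one hε]; exact (mem_ball.1 hx).le
    simp only [b3 _ this, sub_self]
  have hout : ∀ x ∉ ball w (2*ε), ε⁻¹ • (x - w) ∉ tsupport β := by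
    intro x hx h
    have h2 := b2 h
    rw [mem_closedBall_zero_iff, hn, div_le_iff₀ hε] at h2
    rw [mem_ball, not_lt] at hx
    linarith
  refine ⟨_, hs, hin, ?_, ?_, ?_, ?_⟩
  · intro x hx
    simp only [image_eq_zero_of_notMem_tsupport (hout x hx), sub_zero]
  · intro x; simpa using b4 _
  · intro x
    rw [hd, norm_neg, norm_mul, div_eq_inv_mul]
    rw [Complex.norm_real, Real.norm_of_nonneg (by positivity)]
    gcongr
    exact (hC _).trans (le_max_left _ _)
  · intro x hx
    by_cases h1 : x ∈ ball w (2*ε)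
    · have h2 : x ∈ ball w ε := by by_contra h; exact hx ⟨h1, h⟩
      have h3 : (fun x => 1 - β (ε⁻¹ • (x - w))) =ᶠ[𝓝 x] fun _ => 0 := by
        filter_upwards [isOpen_ball.mem_nhds h2] with y hy using hin y hy
      unfold dbar
      rw [h3.fderiv_eq]
      simp
    · rw [hd, dbar_zero_of_notMem (hout x h1)]; simp

lemma pigeon {s : ℕ → ℝ} (hs : Summable s) (m : ℕ) {δ : ℝ} (hδ : 0 < δ) (K : ℕ) :
    ∃ k ≥ K, (k + m + 1) * s k < δ := by
  by_contra! h
  have h1 : Summable (fun k : ℕ => δ * (1 / ((k + (K + m + 1) : ℕ) : ℝ))) := by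
    refine Summable.of_nonneg_of_le (fun k => by positivity) (fun k => ?_) ((summable_nat_add_iff K).2 hs)
    have := h (k + K) (by omega)
    push_cast at this ⊢
    rw [mul_one_div, div_le_iff₀ (by positivity)]
    linarith
  rw [summable_mul_left_iff hδ.ne', summable_nat_add_iff (f := fun k : ℕ => 1 / (k:ℝ)) (K + m + 1)] at h1
  exact Real.not_summable_one_div_natCast h1

lemma annuli {w : ℂ} {f : ℂ → ℝ≥0∞} (hf : ∫⁻ a, f a ≠ ⊤) :
    Summable (fun k : ℕ => (∫⁻ a in ball w (2 * (2⁻¹)^k) \ ball w ((2⁻¹:ℝ)^k), f a).toReal) := by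
  refine ENNReal.summable_toReal ?_
  rw [← lintegral_iUnion (fun k => measurableSet_ball.diff measurableSet_ball)]
  · exact ((setLIntegral_le_lintegral _ _).trans_lt hf.lt_top).ne
  · have : ∀ i j : ℕ, i < j → Disjoint (ball w (2 * (2⁻¹)^i) \ ball w ((2⁻¹:ℝ)^i)) (ball w (2 * (2⁻¹)^j) \ ball w ((2⁻¹:ℝ)^j)) := by
      intro i j hij
      rw [Set.disjoint_left]
      rintro x ⟨h1, h2⟩ ⟨h3, h4⟩
      apply h2
      rw [mem_ball] at h3 ⊢
      refine h3.trans_le ?_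
      have : (2⁻¹:ℝ)^j ≤ 2⁻¹^(i+1) := pow_le_pow_of_le_one (by norm_num) (by norm_num) hij
      rw [pow_succ] at this
      linarith
    intro i j hij
    rcases lt_or_gt_of_ne hij with h | h
    · exact this i j h
    · exact (this j i h).symm

lemma bdd_dense {D : Set ℂ} (hD : IsOpen D) (hb : Bornology.IsBounded D) (w : ℂ) {F : ℂ → ℂ}
    (hF : Hol2 D F) {δ : ℝ} (hδ : 0 < δ) :
    ∃ E, IsOpen E ∧ w ∈ E ∧ ∃ G, DifferentiableOn ℂ G E ∧ Hol2 D G ∧ ∫ a in D, ‖F a - G a‖ ^ 2 < δ := by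
  have hp := Real.pi_pos
  set f := D.indicator F with hf
  have hfF : f =ᵐ[volume.restrict D] F := by
    filter_upwards [ae_restrict_mem hD.measurableSet] with x hx using indicator_of_mem hx _
  have hfD : MemLp f 2 (volume.restrict D) := (memLp_congr_ae hfF).2 hF.2
  have h0 : ∀ x ∉ D, f x = 0 := fun x hx => indicator_of_notMem hx _
  obtain ⟨hi, R, hR, hRf⟩ := glob_int hD hb hfD h0
  have hwf : WH D f := hol_WH hD hF.1 (Eventually.of_forall fun x hx => indicator_of_mem hx _)
  have hfin : ∫⁻ a, ‖f a‖ₑ^2 ≠ ⊤ := by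
    rw [← set_leq hD.measurableSet (fun x hx => by simp [h0 x hx]), lint_sq' hfD]; simp
  have hfv : MemLp f 2 volume := memLp_of_lint hi.1 hfin.lt_top
  obtain ⟨C, hC, hcut⟩ := cutoff w
  obtain ⟨m, hm⟩ : ∃ m : ℕ, D ⊆ ball w (4 * 2^m) := by
    obtain ⟨r, hr⟩ := hb.subset_ball w
    obtain ⟨m, hm⟩ := pow_unbounded_of_one_lt r (one_lt_two)
    refine ⟨m, hr.trans (ball_subset_ball ?_)⟩
    have : (0:ℝ) < 2^m := by positivity
    linarith
  have hsum := annuli (w := w) hfin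
  have hsm : Tendsto (fun k : ℕ => ∫⁻ a in ball w (2 * (2⁻¹)^k), ‖f a‖ₑ^2) atTop (𝓝 0) := by
    refine tendsto_setLIntegral_zero hfin ?_
    have : Tendsto (fun k : ℕ => ENNReal.ofReal (Real.pi * (2 * (2⁻¹)^k)^2)) atTop (𝓝 (ENNReal.ofReal (Real.pi * (2 * 0)^2))) := by
      refine ENNReal.tendsto_ofReal (((tendsto_pow_atTop_nhds_zero_of_lt_one (by norm_num) (by norm_num)).const_mul 2 |>.pow 2).const_mul _)
    simp only [mul_zero, ne_eq, OfNat.ofNat_ne_zero, not_false_eq_true, zero_pow, ENNReal.ofReal_zero] at this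
    refine this.congr fun k => ?_
    rw [Function.comp_apply, vol_ball' w (by positivity)]
  obtain ⟨K, hK⟩ := (hsm.eventually (gt_mem_nhds (show (0:ℝ≥0∞) < ENNReal.ofReal (δ/4) by simpa using hδ))).exists_forall_of_atTop
  obtain ⟨k, hkK, hk⟩ := pigeon (hsum.mul_left (108*Real.pi^2*C^2)) m (show 0 < δ/4 by positivity) K
  have hk2 := hK k hkK
  set ε : ℝ := 2⁻¹^k with hεd
  have hε : 0 < ε := by positivity
  obtain ⟨χ, c1, c2, c3, c4, c5, c6⟩ := hcut ε hε
  set g := fun x => f x * dbar χ x with hg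
  set E := D ∪ ball w ε with hE
  have hEo : IsOpen E := hD.union isOpen_ball
  have hEb : Bornology.IsBounded E := hb.union isBounded_ball
  have hdm : Measurable (dbar χ) := (dbar_contDiff c1).continuous.measurable
  have hgm : MemLp g 2 (volume.restrict E) := by
    refine MemLp.of_le_mul (c := C/ε) (hfv.restrict E) (hi.1.mul hdm.aestronglyMeasurable).restrict (Eventually.of_forall fun x => ?_)
    rw [hg, norm_mul, mul_comm]
    gcongr; exact c5 x
  have hχf : MemLp (fun x => χ x * f x) 2 (volume.restrict E) := by
    refine MemLp.of_le_mul (c := 2) (hfv.restrict E) (c1.continuous.aestronglyMeasurable.mul hi.1).restrict (Eventually.of_forall fun x => ?_)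
    rw [norm_mul]
    gcongr
    have := c4 x
    have h2 := norm_sub_norm_le (χ x) (χ x - 1)
    rw [norm_sub_rev (χ x) 1] at h2
    simp at h2
    linarith
  have hgE : ∀ x ∉ E, g x = 0 := fun x hx => by simp [hg, h0 x (fun h => hx (Or.inl h))]
  have hCm := Cau_memLp hEo hEb hgm hgE
  have hts : tsupport χ ∩ E ⊆ D := by
    rintro x ⟨hx, hxE | hxE⟩
    · exact hxE
    · exfalso
      have : tsupport χ ⊆ (ball w ε)ᶜ := closure_minimal (fun y hy hyb => hy (c2 y hyb)) isOpen_ball.isClosed_compl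
      exact this hx hxE
  obtain ⟨G, hG, hGe⟩ := weyl2 hEo hEb (hχf.sub hCm) (lemH hi hRf hwf c1 hts)
  have hDE : D ⊆ E := subset_union_left
  have hGD : Hol2 D G := ⟨hG.1.mono hDE, hG.2.mono_measure (Measure.restrict_mono hDE le_rfl)⟩
  refine ⟨E, hEo, Or.inr (mem_ball_self hε), G, hG.1, hGD, ?_⟩
  have hFG : MemLp (fun a => F a - G a) 2 (volume.restrict D) := hF.2.sub hGD.2
  have hle := lint_sq' hFG
  rw [← ENNReal.ofReal_lt_ofReal_iff hδ, ← hle]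
  have hpt : ∀ᵐ a ∂(volume.restrict D), ‖F a - G a‖ₑ^2 ≤ 2 * (‖(1 - χ a) * f a‖ₑ^2 + ‖Cau g a‖ₑ^2) := by
    filter_upwards [hfF, ae_restrict_of_ae_restrict_of_subset hDE hGe] with a ha hb
    have : F a - G a = (1 - χ a) * f a + Cau g a := by
      rw [← ha, ← hb]; simp only [Pi.sub_apply]; ring
    rw [this]
    have h1 : ‖(1 - χ a) * f a + Cau g a‖ₑ ≤ ‖(1 - χ a) * f a‖ₑ + ‖Cau g a‖ₑ := enorm_add_le _ _
    refine (pow_le_pow_left' h1 2).trans ?_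
    have := ENNReal.rpow_add_le_mul_rpow_add_rpow ‖(1 - χ a) * f a‖ₑ ‖Cau g a‖ₑ (p := 2) (by norm_num)
    norm_num [-enorm_mul] at this
    exact this
  refine (lintegral_mono_ae hpt).trans_lt ?_
  rw [lintegral_const_mul' _ _ (by simp), lintegral_add_left' (by
    refine AEMeasurable.pow_const (AEMeasurable.enorm ?_) 2
    exact ((measurable_const.sub c1.continuous.measurable).aemeasurable.mul hi.1.aemeasurable).restrict)]
  have t1 : ∫⁻ a in D, ‖(1 - χ a) * f a‖ₑ^2 ≤ ∫⁻ a in ball w (2*ε), ‖f a‖ₑ^2 := by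
    refine (setLIntegral_le_lintegral _ _).trans ?_
    rw [← set_leq (D := ball w (2*ε)) measurableSet_ball (fun x hx => by simp [c3 x hx])]
    refine lintegral_mono fun a => pow_le_pow_left' ?_ 2
    rw [enorm_mul]
    refine mul_le_of_le_one_left' ?_
    rw [← ofReal_norm]
    exact ENNReal.ofReal_le_one.2 (c4 a)
  have t2 : ∫⁻ a in D, ‖Cau g a‖ₑ^2 ≤ ENNReal.ofReal (δ/4) := by
    have hme : 4 * 2^m = 4 * ε * 2^(k+m) := by
      rw [hεd, pow_add, inv_pow]; field_simp
    rw [hme] at hm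
    have hg0 : ∀ x ∉ ball w (2*ε) \ ball w ε, g x = 0 := fun x hx => by simp [hg, c6 x hx]
    refine (lintegral_mono_set hm).trans ((Cau_dyad hε (hi.1.aemeasurable.mul hdm.aemeasurable)
      (fun x hx => hg0 x fun h => hx h.1) (k+m)).trans ?_)
    have : ∫⁻ a in ball w (2*ε), ‖g a‖ₑ^2 ≤ ENNReal.ofReal ((C/ε)^2) * ∫⁻ a in ball w (2*ε) \ ball w ε, ‖f a‖ₑ^2 := by
      refine (setLIntegral_le_lintegral _ _).trans ?_
      rw [← set_leq (D := ball w (2*ε) \ ball w ε) (measurableSet_ball.diff measurableSet_ball) (fun x hx => by simp [hg0 x hx]),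
        ← lintegral_const_mul' _ _ (by simp)]
      refine lintegral_mono fun a => ?_
      rw [enorm_mul, mul_pow, mul_comm, ENNReal.ofReal_pow (by positivity)]
      gcongr
      rw [← ofReal_norm]
      exact ENNReal.ofReal_le_ofReal (c5 a)
    refine (mul_le_mul_right this _).trans ?_
    have hs : ∫⁻ a in ball w (2*ε) \ ball w ε, ‖f a‖ₑ^2 ≠ ⊤ :=
      ((setLIntegral_le_lintegral _ _).trans_lt hfin.lt_top).ne
    rw [← ENNReal.ofReal_toReal hs, ← ENNReal.ofReal_mul (by positivity), ← ENNReal.ofReal_mul (by positivity)]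
    refine ENNReal.ofReal_le_ofReal (le_trans (le_of_eq ?_) hk.le)
    push_cast
    field_simp
  calc 2 * ((∫⁻ a in D, ‖(1 - χ a) * f a‖ₑ^2) + ∫⁻ a in D, ‖Cau g a‖ₑ^2)
      < 2 * (ENNReal.ofReal (δ/4) + ENNReal.ofReal (δ/4)) := by
        refine ENNReal.mul_lt_mul_right (by simp) (by simp) ?_
        exact ENNReal.add_lt_add_of_lt_of_le ((t2.trans_lt (by simp)).ne) (t1.trans_lt hk2) t2
    _ = ENNReal.ofReal δ := by
        rw [← ENNReal.ofReal_add (by positivity) (by positivity), show (2:ℝ≥0∞) = ENNReal.ofReal 2 by simp,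
          ← ENNReal.ofReal_mul (by norm_num)]
        congr 1; ring

/-- weak convergence -/
lemma L5 {D : Set ℂ} (hD : IsOpen D) (hb : Bornology.IsBounded D) {w : ℂ} (hk : Tendsto (fun z => kap D z) (𝓝[D] w) atTop)
    (e : ℂ → ℂ → ℂ) (he : ∀ z ∈ D, Hol2 D (e z) ∧ (∫ a in D, ‖e z a‖ ^ 2) = 1 ∧
      ∀ F, Hol2 D F → ∫ a in D, cj (e z a) * F a = F z / kap D z) (G : ℂ → ℂ) (hG : MemLp G 2 (volume.restrict D)) :
    Tendsto (fun z => ∫ a in D, cj (e z a) * G a) (𝓝[D] w) (𝓝 0) := by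
  obtain ⟨F, hF, hFG⟩ := exists_proj hD hb hG
  rw [Metric.tendsto_nhds]
  intro δ hδ
  obtain ⟨E, hE, hwE, H, hH, hHD, hlt⟩ := bdd_dense hD hb w hF (δ := (δ/2)^2) (by positivity)
  have hc : ContinuousAt H w := (hH.differentiableAt (hE.mem_nhds hwE)).continuousAt
  have h1 : Tendsto (fun z => H z / (kap D z : ℂ)) (𝓝[D] w) (𝓝 0) := by
    have h2 : Tendsto (fun z => (((kap D z)⁻¹ : ℝ) : ℂ)) (𝓝[D] w) (𝓝 ((0:ℝ):ℂ)) :=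
      (Complex.continuous_ofReal.tendsto 0).comp hk.inv_tendsto_atTop
    have := (hc.tendsto.mono_left nhdsWithin_le_nhds).mul h2
    simp only [Complex.ofReal_zero, mul_zero] at this
    refine this.congr fun z => by rw [Complex.ofReal_inv, div_eq_mul_inv]
  filter_upwards [Metric.tendsto_nhds.1 h1 (δ/2) (by positivity), self_mem_nhdsWithin] with z hz hzD
  obtain ⟨h2, h3, h4⟩ := he z hzD
  rw [dist_zero_right] at hz ⊢
  rw [hFG _ h2]
  have hd : MemLp (fun a => F a - H a) 2 (volume.restrict D) := hF.2.sub hHD.2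
  have hcs : ‖∫ a in D, cj (e z a) * (F a - H a)‖ ≤ δ/2 := by
    have e1 := inner_toLp h2.2 hd
    rw [← e1]
    refine (norm_inner_le_norm _ _).trans ?_
    have a1 := norm_sq_toLp h2.2
    have a2 := norm_sq_toLp hd
    have a3 : ‖h2.2.toLp (e z)‖ = 1 := by
      have : ‖h2.2.toLp (e z)‖^2 = 1 := by rw [a1, h3]
      nlinarith [norm_nonneg (h2.2.toLp (e z))]
    rw [a3, one_mul]
    refine le_of_lt (lt_of_pow_lt_pow_left₀ 2 (by positivity) ?_)
    rw [a2]; exact hlt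
  have h5 : ∫ a in D, cj (e z a) * F a = (∫ a in D, cj (e z a) * (F a - H a)) + ∫ a in D, cj (e z a) * H a := by
    have hce : MemLp (fun a => cj (e z a)) 2 (volume.restrict D) := h2.2.star
    refine Eq.trans ?_ (integral_add (hce.integrable_mul hd) (hce.integrable_mul hHD.2))
    congr 1; ext a; ring
  rw [h5, h4 _ hHD]
  refine (norm_add_le _ _).trans_lt (by linarith)


lemma enorm_add_sq_le (a b : ℂ) : ‖a + b‖ₑ ^ 2 ≤ 2 * (‖a‖ₑ ^ 2 + ‖b‖ₑ ^ 2) := by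
  refine (pow_le_pow_left' (enorm_add_le a b) 2).trans ?_
  have := ENNReal.rpow_add_le_mul_rpow_add_rpow ‖a‖ₑ ‖b‖ₑ (p := 2) (by norm_num)
  norm_num at this
  exact this

lemma Cau_far {z : ℂ} {r : ℝ} (hr : 0 < r) {g : ℂ → ℂ} (h0 : ∀ x ∈ ball z r, g x = 0) :
    ‖Cau g z‖ₑ ≤ ENNReal.ofReal r⁻¹ * ∫⁻ a, ‖g a‖ₑ := by
  refine (Cau_le g z).trans ?_
  rw [← lintegral_const_mul' _ _ ENNReal.ofReal_ne_top]
  refine lintegral_mono fun ζ => ?_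
  by_cases hζ : ζ ∈ ball z r
  · simp [h0 ζ hζ]
  · gcongr
    unfold ke
    refine ENNReal.ofReal_le_ofReal (inv_anti₀ hr ?_)
    rw [← dist_eq_norm, dist_comm]
    simpa using hζ

lemma lint_l1 {D : Set ℂ} (hD : MeasurableSet D) {g : ℂ → ℂ} (hg : AEMeasurable g) (h0 : ∀ x ∉ D, g x = 0) :
    (∫⁻ a, ‖g a‖ₑ) ^ 2 ≤ volume D * ∫⁻ a in D, ‖g a‖ₑ ^ 2 := by
  rw [← set_leq hD (fun x hx => by simp [h0 x hx])]
  have := lint_cs (volume.restrict D) (f := fun _ => 1) (g := fun a => ‖g a‖ₑ)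
    aemeasurable_const hg.enorm.restrict
  simpa using this

lemma kap_loc {D : Set ℂ} (hD : IsOpen D) (hb : Bornology.IsBounded D) (w : ℂ) {R : ℝ} (hR : 0 < R) :
    ∃ C : ℝ, 0 < C ∧ ∀ z ∈ D ∩ ball w (R/4), kap (D ∩ ball w R) z ≤ C * (kap D z + 1) := by
  set D' := D ∩ ball w R with hD'
  have ho : IsOpen D' := hD.inter isOpen_ball
  have hb' : Bornology.IsBounded D' := hb.subset inter_subset_left
  obtain ⟨χ, c1, c2, c3, c4, c5⟩ := exists_bump w (r := R/2) (R := 3*R/4) (by positivity) (by linarith)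
  have hχt : IsTest univ χ := ⟨c1, c5, subset_univ _⟩
  obtain ⟨M, hM⟩ := hχt.dbar.smooth.continuous.bounded_above_of_compact_support hχt.dbar.cpt
  have hv : volume D ≠ ⊤ := hb.measure_lt_top.ne
  set S : ℝ≥0∞ := (ENNReal.ofReal (2 * Real.pi * 1) + ENNReal.ofReal 1⁻¹ * volume D) *
      (ENNReal.ofReal (2 * Real.pi * 1) + ENNReal.ofReal 1⁻¹ * volume D) * ENNReal.ofReal M ^ 2 with hS
  have hSf : S ≠ ⊤ := by
    have : ENNReal.ofReal (2 * Real.pi * 1) + ENNReal.ofReal 1⁻¹ * volume D ≠ ⊤ :=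
      (ENNReal.add_lt_top.2 ⟨ENNReal.ofReal_lt_top, ENNReal.mul_lt_top (by simp) hv.lt_top⟩).ne
    exact ENNReal.mul_ne_top (ENNReal.mul_ne_top this this) (by simp)
  set A1 : ℝ≥0∞ := 2 * (1 + S)
  have hA1 : A1 ≠ ⊤ := ENNReal.mul_ne_top (by simp) (by simp [hSf])
  set A2 : ℝ≥0∞ := ENNReal.ofReal (R/4)⁻¹ ^ 2 * (volume D * ENNReal.ofReal M ^ 2)
  have hA2 : A2 ≠ ⊤ := ENNReal.mul_ne_top (by simp) (ENNReal.mul_ne_top hv (by simp))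
  refine ⟨max (√A1.toReal) (√A2.toReal) + 1, by positivity, ?_⟩
  rintro z ⟨hzD, hzR⟩
  have hz' : z ∈ D' := ⟨hzD, ball_subset_ball (by linarith) hzR⟩
  obtain ⟨e, h1, h2, h3, h4, -⟩ := exists_ez ho hb' hz'
  obtain ⟨hi, R', hR', hRe⟩ := glob_int ho hb' h1.2 h2
  have hwe : WH D' e := hol_WH ho h1.1 (Eventually.of_forall fun x _ => rfl)
  have hts : tsupport χ ∩ D ⊆ D' := fun x hx => ⟨hx.2, closedBall_subset_ball (by linarith) (c2 hx.1)⟩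
  have h2D : ∀ x ∉ D, e x = 0 := fun x hx => h2 x fun h => hx h.1
  have hl1 : ∫⁻ a, ‖e a‖ₑ ^ 2 = 1 := by
    rw [← set_leq ho.measurableSet (fun x hx => by simp [h2 x hx]), lint_sq' h1.2, h3]; simp
  have hev : MemLp e 2 volume := memLp_of_lint hi.1 (by simp [hl1])
  set g := fun x => e x * dbar χ x with hg
  have hdm : Measurable (dbar χ) := (dbar_contDiff c1).continuous.measurable
  have hgv : MemLp g 2 volume := by
    refine MemLp.of_le_mul (c := M) hev (hi.1.mul hdm.aestronglyMeasurable) (Eventually.of_forall fun x => ?_)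
    rw [hg, norm_mul, mul_comm]
    gcongr; exact hM x
  have hχe : MemLp (fun x => χ x * e x) 2 volume := by
    refine MemLp.of_le_mul (c := 1) hev (c1.continuous.aestronglyMeasurable.mul hi.1) (Eventually.of_forall fun x => ?_)
    rw [norm_mul]
    gcongr; exact c4 x
  have hgD : ∀ x ∉ D, g x = 0 := fun x hx => by simp [hg, h2D x hx]
  have hgl : ∫⁻ a in D, ‖g a‖ₑ ^ 2 ≤ ENNReal.ofReal M ^ 2 := by
    refine (setLIntegral_le_lintegral _ _).trans ?_
    calc ∫⁻ a, ‖g a‖ₑ ^ 2 ≤ ∫⁻ a, ENNReal.ofReal M ^ 2 * ‖e a‖ₑ ^ 2 := lintegral_mono fun a => by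
          rw [hg, enorm_mul, mul_pow, mul_comm]
          gcongr
          rw [← ofReal_norm]
          exact ENNReal.ofReal_le_ofReal (hM a)
      _ = _ := by rw [lintegral_const_mul' _ _ (by simp), hl1, mul_one]
  have hCm := Cau_memLp hD hb (hgv.restrict D) hgD
  obtain ⟨G, hG, hGe⟩ := weyl2 hD hb ((hχe.restrict D).sub hCm) (lemH hi hRe hwe c1 hts)
  have hg0 : ∀ x ∈ ball w (R/2), g x = 0 := by
    intro x hx
    have h3 : χ =ᶠ[𝓝 x] fun _ => 1 := by
      filter_upwards [isOpen_ball.mem_nhds hx] with y hy using c3 y (ball_subset_closedBall hy)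
    have : dbar χ x = 0 := by unfold dbar; rw [h3.fderiv_eq]; simp
    simp [hg, this]
  have hval : G z = e z - Cau g z := by
    have hU : IsOpen (D ∩ ball w (R/2)) := hD.inter isOpen_ball
    have hUD' : D ∩ ball w (R/2) ⊆ D' := inter_subset_inter_right _ (ball_subset_ball (by linarith))
    have hh := hol_unique hU (hG.1.mono inter_subset_left) (G := fun x => e x - Cau g x)
      ((h1.1.mono hUD').sub ((Cau_hol (hgv.restrict D |> fun h => (glob_int hD hb h hgD).1) hg0).mono inter_subset_right)) (by
        filter_upwards [ae_restrict_of_ae_restrict_of_subset inter_subset_left hGe, ae_restrict_mem hU.measurableSet] with a ha hm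
        rw [← ha]; simp [c3 a (ball_subset_closedBall hm.2), hg])
    exact hh ⟨hzD, ball_subset_ball (by linarith) hzR⟩
  have hGn : ∫ a in D, ‖G a‖^2 ≤ A1.toReal := by
    rw [← ENNReal.ofReal_le_iff_le_toReal hA1, ← lint_sq' hG.2]
    calc ∫⁻ a in D, ‖G a‖ₑ^2 ≤ ∫⁻ a in D, 2 * (‖χ a * e a‖ₑ^2 + ‖Cau g a‖ₑ^2) := by
          refine lintegral_mono_ae ?_
          filter_upwards [hGe] with a ha
          rw [← ha, sub_eq_add_neg, ← enorm_neg (Cau g a)]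
          exact enorm_add_sq_le _ _
      _ = 2 * ((∫⁻ a in D, ‖χ a * e a‖ₑ^2) + ∫⁻ a in D, ‖Cau g a‖ₑ^2) := by
          rw [lintegral_const_mul' _ _ (by simp), lintegral_add_left' ((hχe.restrict D).1.aemeasurable.enorm.pow_const 2)]
      _ ≤ 2 * (1 + S) := by
          refine mul_le_mul_right (add_le_add ?_ ?_) _
          · refine (setLIntegral_le_lintegral _ _).trans ?_
            rw [← hl1]
            refine lintegral_mono fun a => pow_le_pow_left' ?_ 2
            rw [enorm_mul]
            refine mul_le_of_le_one_left' ?_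
            rw [← ofReal_norm]
            exact ENNReal.ofReal_le_one.2 (c4 a)
          · refine (Cau_L2 D D hD.measurableSet one_pos hgv.1.aemeasurable hgD).trans ?_
            exact mul_le_mul_right hgl _
  have hCz : ‖Cau g z‖ ≤ √A2.toReal := by
    refine Real.le_sqrt_of_sq_le ?_
    rw [← ENNReal.ofReal_le_iff_le_toReal hA2, ENNReal.ofReal_pow (norm_nonneg _), ofReal_norm]
    have := Cau_far (z := z) (r := R/4) (by positivity) (g := g) (fun x hx => hg0 x (by
      have h5 : dist x z < R/4 := hx
      have h6 : dist z w < R/4 := hzR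
      have := dist_triangle x z w
      rw [mem_ball]; linarith))
    refine (pow_le_pow_left' this 2).trans ?_
    rw [mul_pow]
    refine mul_le_mul_right ((lint_l1 hD.measurableSet hgv.1.aemeasurable hgD).trans ?_) _
    gcongr
  have hk := kap_pos hD hb hzD
  have h5 := kap_le hD hb hzD hG
  have h6 : kap D' z ≤ ‖G z‖ + ‖Cau g z‖ := by
    have : (kap D' z : ℂ) = G z + Cau g z := by rw [← h4, hval]; ring
    calc kap D' z = ‖(kap D' z : ℂ)‖ := by rw [Complex.norm_real, Real.norm_of_nonneg (kap_pos ho hb' hz').le]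
      _ ≤ _ := by rw [this]; exact norm_add_le _ _
  have h7 : ‖G z‖ ≤ kap D z * √A1.toReal := h5.trans (by gcongr)
  have h8 := le_max_left (√A1.toReal) (√A2.toReal)
  have h9 := le_max_right (√A1.toReal) (√A2.toReal)
  nlinarith [Real.sqrt_nonneg A1.toReal]


lemma memLp_shift {f : ℂ → ℝ} (hf : MemLp f 2 volume) (h : ℂ) : MemLp (fun x => f (x + h)) 2 volume :=
  hf.comp_measurePreserving (measurePreserving_add_right volume h)

lemma int_shift (f : ℂ → ℝ) (h : ℂ) : ∫ x, f (x + h) = ∫ x, f x := integral_add_right_eq_self f h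

lemma real_eLp {f : ℂ → ℝ} (hf : MemLp f 2 volume) : eLpNorm f 2 volume = ENNReal.ofReal (√(∫ x, f x ^ 2)) := by
  have h := hf.eLpNorm_eq_integral_rpow_norm (by norm_num) (by norm_num)
  rw [h]
  congr 1
  simp [Real.sqrt_eq_rpow]

/-- Poincaré in finite difference form -/
lemma poin {η : ℂ → ℝ} {R : ℝ} (hR : 0 < R) (hη : MemLp η 2 volume) (h0 : ∀ x, R ≤ ‖x‖ → η x = 0) {h : ℂ}
    (hh : ‖h‖ ≤ 1) : 2 * ‖h‖^2 * ∫ x, η x ^ 2 ≤ (2*R+1)^2 * ∫ x, (η (x+h) - η x)^2 := by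
  by_cases hz : h = 0
  · subst hz; simp
  have hp : 0 < ‖h‖ := norm_pos_iff.2 hz
  set N := ⌈2*R/‖h‖⌉₊ with hN
  have hN1 : 2 * R ≤ N * ‖h‖ := by
    rw [← div_le_iff₀ hp]; exact Nat.le_ceil _
  have hN2 : N * ‖h‖ ≤ 2 * R + 1 := by
    have := Nat.ceil_lt_add_one (show 0 ≤ 2*R/‖h‖ by positivity)
    have h2 : (N:ℝ) * ‖h‖ ≤ (2*R/‖h‖ + 1) * ‖h‖ := by gcongr
    rw [add_mul, div_mul_cancel₀ _ hp.ne'] at h2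
    linarith
  have hd : ∀ k : ℕ, MemLp (fun x => η (x + k • h) - η x) 2 volume := fun k => (memLp_shift hη _).sub hη
  have hd1 : MemLp (fun x => η (x + h) - η x) 2 volume := (memLp_shift hη _).sub hη
  have h1 : ∀ k : ℕ, eLpNorm (fun x => η (x + k • h) - η x) 2 volume ≤ k * eLpNorm (fun x => η (x + h) - η x) 2 volume := by
    intro k
    induction k with
    | zero => simp
    | succ k ih =>
      have e : (fun x => η (x + (k+1) • h) - η x) = (fun x => η ((x + k • h) + h) - η (x + k • h)) + (fun x => η (x + k • h) - η x) := by
        ext x; simp only [Pi.add_apply, add_smul, one_smul, add_assoc]; ring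
      rw [e]
      have m1 : MemLp (fun x => η ((x + k • h) + h) - η (x + k • h)) 2 volume := memLp_shift hd1 _
      refine (eLpNorm_add_le m1.1 (hd k).1 (by norm_num)).trans ?_
      have e2 : eLpNorm (fun x => η ((x + k • h) + h) - η (x + k • h)) 2 volume = eLpNorm (fun x => η (x + h) - η x) 2 volume :=
        eLpNorm_comp_measurePreserving (g := fun x => η (x + h) - η x) hd1.1 (measurePreserving_add_right volume (k • h))
      rw [e2]; push_cast; rw [add_mul, one_mul, add_comm]
      gcongr
  have h2 := h1 N
  rw [real_eLp (hd N), real_eLp hd1, ← ENNReal.ofReal_natCast, ← ENNReal.ofReal_mul (by positivity),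
    ENNReal.ofReal_le_ofReal_iff (by positivity)] at h2
  have h3 : ∫ x, (η (x + N • h) - η x)^2 = 2 * ∫ x, η x ^ 2 := by
    have e : ∀ x, (η (x + N • h) - η x)^2 = η (x + N • h)^2 + η x ^ 2 := by
      intro x
      have : η (x + N • h) * η x = 0 := by
        by_cases hx : R ≤ ‖x‖
        · rw [h0 x hx, mul_zero]
        · rw [h0 (x + N • h), zero_mul]
          have t := norm_sub_le (x + N • h) x
          rw [add_sub_cancel_left, nsmul_eq_mul, norm_mul, Complex.norm_natCast] at t
          rw [nsmul_eq_mul]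
          linarith
      linear_combination (-2) * this
    simp_rw [e]
    rw [integral_add (memLp_shift hη _).integrable_sq hη.integrable_sq, int_shift (fun x => η x ^ 2)]
    ring
  set a := ∫ x, η x ^ 2
  set b := ∫ x, (η (x+h) - η x)^2
  have ha : 0 ≤ a := integral_nonneg fun x => sq_nonneg _
  have hb : 0 ≤ b := integral_nonneg fun x => sq_nonneg _
  rw [h3] at h2
  have h4 : 2 * a ≤ N^2 * b := by
    have := pow_le_pow_left₀ (Real.sqrt_nonneg _) h2 2
    rwa [Real.sq_sqrt (by positivity), mul_pow, Real.sq_sqrt hb] at this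
  calc 2 * ‖h‖^2 * a = ‖h‖^2 * (2 * a) := by ring
    _ ≤ ‖h‖^2 * (N^2 * b) := by gcongr
    _ = (N * ‖h‖)^2 * b := by ring
    _ ≤ (2*R+1)^2 * b := by gcongr

lemma CP1 {V δ : ℂ → ℝ} {R r G : ℝ} (hR : 0 < R) (hr : 0 < r) (hr1 : r ≤ 1) (hVm : Measurable V) (hδm : Measurable δ)
    (hV : MemLp V 2 volume) (hδ : MemLp δ 2 volume) (hV0 : ∀ x, R ≤ ‖x‖ → V x = 0) (hδ0 : ∀ x, 0 ≤ δ x)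
    (hJ : ∀ᵐ x, δ x < V x → V x ≤ (Real.pi * r^2)⁻¹ * ∫ h in ball (0:ℂ) r, V (x + h))
    (hG : ∀ h, ∫ x, (δ (x + h) - δ x)^2 ≤ ‖h‖^2 * G) :
    ∫ x, (max (V x - δ x) 0)^2 ≤ (2*R+1)^2 * G := by
  set η := fun x => max (V x - δ x) 0 with hη
  have hηm : Measurable η := (hVm.sub hδm).max measurable_const
  have hη0 : ∀ x, 0 ≤ η x := fun x => le_max_right _ _
  have hηL : MemLp η 2 volume := by
    refine (hV.sub hδ).of_le hηm.aestronglyMeasurable (Eventually.of_forall fun x => ?_)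
    rw [Real.norm_of_nonneg (hη0 x)]
    exact max_le (le_abs_self _) (abs_nonneg _)
  have hηR : ∀ x, R ≤ ‖x‖ → η x = 0 := fun x hx => by
    simp only [hη, hV0 x hx]; exact max_eq_right (by linarith [hδ0 x])
  have hfin : IsFiniteMeasure (volume.restrict (ball (0:ℂ) r)) := fin_of_bdd isBounded_ball
  set B := ball (0:ℂ) r
  set ν := volume.restrict B with hν
  have hsqi : ∀ f : ℂ → ℝ, Measurable f → MemLp f 2 volume → Integrable (fun p : ℂ × ℂ => f (p.1 + p.2)^2) (volume.prod ν) := by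
    intro f hfm hf
    have hm : AEStronglyMeasurable (fun p : ℂ × ℂ => f (p.1 + p.2)^2) (volume.prod ν) :=
      ((hfm.comp (measurable_fst.add measurable_snd)).pow_const 2).aestronglyMeasurable
    rw [integrable_prod_iff' hm]
    refine ⟨Eventually.of_forall fun h => (memLp_shift hf h).integrable_sq, ?_⟩
    have : ∀ h, ∫ x, ‖f (x + h)^2‖ = ∫ x, ‖f x^2‖ := fun h => int_shift (fun x => ‖f x ^ 2‖) h
    simp_rw [this]
    exact integrable_const _
  have hsqj : ∀ f : ℂ → ℝ, Measurable f → MemLp f 2 volume → Integrable (fun p : ℂ × ℂ => f p.1^2) (volume.prod ν) := by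
    intro f hfm hf
    exact hf.integrable_sq.comp_fst ν
  have hprod : Integrable (fun p : ℂ × ℂ => (V (p.1 + p.2) - V p.1) * η p.1) (volume.prod ν) := by
    refine Integrable.mono' (((hsqi V hVm hV).add (hsqj V hVm hV)).add (hsqj η hηm hηL)) ?_ (Eventually.of_forall fun p => ?_)
    · exact ((hVm.comp (measurable_fst.add measurable_snd)).sub (hVm.comp measurable_fst)).mul (hηm.comp measurable_fst) |>.aestronglyMeasurable
    · rw [Real.norm_eq_abs, abs_le]
      simp only [Pi.add_apply]
      constructor <;> nlinarith [sq_nonneg (V (p.1 + p.2) - η p.1), sq_nonneg (V (p.1 + p.2) + η p.1), sq_nonneg (V p.1 - η p.1), sq_nonneg (V p.1 + η p.1)]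
  set A := fun h => ∫ x, (V (x + h) - V x) * η x with hA
  have hAi : IntegrableOn A B := hprod.integral_prod_right
  have hpos : 0 ≤ ∫ h in B, A h := by
    rw [hA, ← integral_integral_swap (f := fun x h => (V (x + h) - V x) * η x) hprod]
    refine integral_nonneg_of_ae ?_
    filter_upwards [hJ, hprod.prod_right_ae] with x hx hxi
    rw [integral_mul_const]
    by_cases hlt : δ x < V x
    · refine mul_nonneg ?_ (hη0 x)
      have hVi : IntegrableOn (fun h => V (x + h)) B := by
        have := (hV.comp_measurePreserving (measurePreserving_add_left volume x)).restrict B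
        exact this.integrable (by norm_num)
      rw [integral_sub hVi (integrable_const _), setIntegral_const, smul_eq_mul]
      have hv : volume.real B = Real.pi * r^2 := by
        rw [Measure.real, vol_ball' _ hr.le, ENNReal.toReal_ofReal (by positivity)]
      rw [hv]
      have := hx hlt
      rw [inv_mul_eq_div, le_div_iff₀ (by positivity)] at this
      linarith
    · have : η x = 0 := max_eq_right (by linarith)
      simp [this]
  have hneg : ∫ h in B, A (-h) = ∫ h in B, A h := by
    rw [← integral_indicator measurableSet_ball, ← integral_indicator measurableSet_ball, ← integral_neg_eq_self (B.indicator A)]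
    congr 1; ext h
    simp only [Set.indicator, B, mem_ball_zero_iff, norm_neg]
  have hnegi : IntegrableOn (fun h => A (-h)) B := by
    rw [← integrable_indicator_iff measurableSet_ball] at hAi ⊢
    have := hAi.comp_neg
    refine this.congr (Eventually.of_forall fun h => ?_)
    simp only [Set.indicator, B, mem_ball_zero_iff, norm_neg]
  set c := ∫ x, η x ^ 2 with hc
  have hpt : ∀ h ∈ B, A h + A (-h) ≤ ‖h‖^2 * (G / 2 - c / (2*R+1)^2) := by
    intro h hh
    have m1 : MemLp (fun x => V (x + h) - V x) 2 volume := (memLp_shift hV h).sub hV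
    have m2 : MemLp (fun x => η (x + h) - η x) 2 volume := (memLp_shift hηL h).sub hηL
    have m3 : MemLp (fun x => δ (x + h) - δ x) 2 volume := (memLp_shift hδ h).sub hδ
    have e1 : A (-h) = ∫ x, (V x - V (x + h)) * η (x + h) := by
      refine (int_shift (fun x => (V (x + -h) - V x) * η x) h).symm.trans ?_
      simp [add_assoc]
    have e2 : A h + A (-h) = - ∫ x, (V (x + h) - V x) * (η (x + h) - η x) := by
      rw [e1, hA, ← integral_add, ← integral_neg]
      · congr 1; ext x; ring
      · exact m1.integrable_mul hηL
      · have : MemLp (fun x => V x - V (x + h)) 2 volume := hV.sub (memLp_shift hV h)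
        exact this.integrable_mul (memLp_shift hηL h)
    have e3 : ∫ x, ((η (x + h) - η x)^2 / 2 - (δ (x + h) - δ x)^2 / 2) ≤ ∫ x, (V (x + h) - V x) * (η (x + h) - η x) := by
      refine integral_mono ((m2.integrable_sq.div_const 2).sub (m3.integrable_sq.div_const 2)) (m1.integrable_mul m2) fun x => ?_
      have key : (η (x + h) - η x)^2 ≤ ((V (x + h) - δ (x + h)) - (V x - δ x)) * (η (x + h) - η x) := by
        simp only [hη]
        rcases le_total (V (x+h) - δ (x+h)) 0 with h1 | h1 <;> rcases le_total (V x - δ x) 0 with h2 | h2 <;>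
        simp only [max_eq_left, max_eq_right, h1, h2] <;> nlinarith
      simp only []
      nlinarith [sq_nonneg ((η (x + h) - η x) + (δ (x + h) - δ x))]
    rw [integral_sub (m2.integrable_sq.div_const 2) (m3.integrable_sq.div_const 2), integral_div, integral_div] at e3
    have e4 := hG h
    have e5 := poin hR hηL hηR (h := h) ((mem_ball_zero_iff.1 hh).le.trans hr1)
    rw [e2]
    have e6 : ‖h‖^2 * (c / (2*R+1)^2) ≤ (∫ x, (η (x+h) - η x)^2) / 2 := by
      rw [mul_div_assoc', div_le_iff₀ (by positivity)]
      linarith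
    linarith
  have hni : IntegrableOn (fun h : ℂ => ‖h‖^2) B := by
    refine Integrable.mono' (integrable_const (r^2)) (by fun_prop) ?_
    filter_upwards [ae_restrict_mem measurableSet_ball] with h hh
    rw [Real.norm_of_nonneg (by positivity)]
    have := (mem_ball_zero_iff.1 hh).le
    gcongr
  have hI : 0 < ∫ h in B, ‖h‖^2 := by
    rw [setIntegral_pos_iff_support_of_nonneg_ae (Eventually.of_forall fun h => by positivity) hni]
    have : ball (0:ℂ) r \ {0} ⊆ Function.support (fun h : ℂ => ‖h‖^2) ∩ B := fun x hx => ⟨by simpa using hx.2, hx.1⟩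
    refine lt_of_lt_of_le ?_ (measure_mono this)
    rw [measure_sdiff_null (by simp)]
    exact measure_ball_pos _ _ hr
  have hfinal : 0 ≤ (∫ h in B, ‖h‖^2) * (G / 2 - c / (2*R+1)^2) := by
    rw [← integral_mul_const]
    refine le_trans ?_ (setIntegral_mono_on (hAi.add hnegi) (hni.mul_const _) measurableSet_ball hpt)
    have : ∫ h in B, (A + fun h => A (-h)) h = (∫ h in B, A h) + ∫ h in B, A (-h) := integral_add hAi hnegi
    rw [this, hneg]; linarith
  have h7 := nonneg_of_mul_nonneg_right hfinal hI
  have h8 : c / (2*R+1)^2 ≤ G / 2 := by linarith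
  rw [div_le_iff₀ (by positivity)] at h8
  have h9 : 0 ≤ c := integral_nonneg fun x => sq_nonneg _
  nlinarith


lemma fderiv_decomp (φ : ℂ → ℂ) (y h : ℂ) : fderiv ℝ φ y h = dee φ y * h + dbar φ y * cj h := by
  have : h = h.re • (1:ℂ) + h.im • Complex.I := by
    apply Complex.ext <;> simp
  conv_lhs => rw [this, map_add, map_smul, map_smul]
  have h2 : cj h = h.re - h.im * Complex.I := by
    apply Complex.ext <;> simp [cj]
  have h3 : h = h.re + h.im * Complex.I := (Complex.re_add_im h).symm
  rw [h2]
  conv_rhs => rw [h3]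
  unfold dee dbar
  simp only [Complex.real_smul, Complex.add_re, Complex.ofReal_re, Complex.mul_re, Complex.I_re, mul_zero, Complex.ofReal_im, Complex.I_im, mul_one,
    Complex.add_im, Complex.mul_im, sub_self, add_zero, zero_add]
  linear_combination (fderiv ℝ φ y Complex.I * h.im) * Complex.I_sq

lemma dbar_dee_norm {φ : ℂ → ℂ} (hφ : IsTest univ φ) : ∫⁻ x, ‖dbar φ x‖ₑ^2 = ∫⁻ x, ‖dee φ x‖ₑ^2 := by
  have m1 : MemLp (dbar φ) 2 (volume.restrict univ) := hφ.dbar.memLp _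
  have m2 : MemLp (dee φ) 2 (volume.restrict univ) := hφ.dee.memLp _
  have e1 := lint_sq' m1
  have e2 := lint_sq' m2
  rw [setLIntegral_univ] at e1 e2
  rw [e1, e2]
  congr 1
  simp only [Measure.restrict_univ]
  have key : ∫ x, dbar φ x * cj (dbar φ x) = ∫ x, dee φ x * cj (dee φ x) := by
    have a1 : ∀ x, cj (dbar φ x) = dee (fun x => cj (φ x)) x := fun x => (dee_cj (hφ.diff _)).symm
    have a2 : ∀ x, cj (dee φ x) = dbar (fun x => cj (φ x)) x := fun x => (dbar_cj (hφ.diff _)).symm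
    simp_rw [a1, a2]
    rw [parts_dee isOpen_univ (hφ.dbar.smooth.of_le (by norm_cast)).contDiffOn hφ.cj,
      parts_dbar isOpen_univ (hφ.dee.smooth.of_le (by norm_cast)).contDiffOn hφ.cj]
    congr 2; ext x
    rw [dee_dbar_comm (hφ.smooth.of_le (by norm_cast))]
  have e : ∀ z : ℂ, z * cj z = ((‖z‖^2 : ℝ) : ℂ) := fun z => by
    rw [Complex.mul_conj, Complex.normSq_eq_norm_sq]
  simp_rw [e] at key
  rw [integral_complex_ofReal, integral_complex_ofReal] at key
  exact_mod_cast key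

lemma diff_test {φ : ℂ → ℂ} (hφ : IsTest univ φ) (h : ℂ) :
    ∫⁻ x, ‖φ (x + h) - φ x‖ₑ^2 ≤ 4 * ‖h‖ₑ^2 * ∫⁻ x, ‖dee φ x‖ₑ^2 := by
  have c1 : Continuous (dee φ) := hφ.dee.smooth.continuous
  have c2 : Continuous (dbar φ) := hφ.dbar.smooth.continuous
  set I : Measure ℝ := volume.restrict (Ioc 0 1)
  have hpt : ∀ x, ‖φ (x + h) - φ x‖ₑ^2 ≤ ∫⁻ t, 2 * ‖h‖ₑ^2 * (‖dee φ (x + t • h)‖ₑ^2 + ‖dbar φ (x + t • h)‖ₑ^2) ∂I := by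
    intro x
    have hd : ∀ t : ℝ, HasDerivAt (fun t : ℝ => φ (x + t • h)) (fderiv ℝ φ (x + t • h) h) t := by
      intro t
      have h1 : HasDerivAt (fun t : ℝ => x + t • h) h t := by
        simpa using ((hasDerivAt_id t).smul_const h).const_add x
      exact ((hφ.diff _).hasFDerivAt).comp_hasDerivAt t h1
    have hcont : Continuous (fun t : ℝ => fderiv ℝ φ (x + t • h) h) := by
      simp_rw [fderiv_decomp]; fun_prop
    have hint := intervalIntegral.integral_eq_sub_of_hasDerivAt (a := 0) (b := 1) (fun t _ => hd t) (hcont.intervalIntegrable _ _)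
    simp only [one_smul, zero_smul, add_zero] at hint
    rw [← hint, intervalIntegral.integral_of_le zero_le_one]
    have s1 : ‖∫ t in Ioc (0:ℝ) 1, fderiv ℝ φ (x + t • h) h‖ₑ ≤ ∫⁻ t, 1 * ‖fderiv ℝ φ (x + t • h) h‖ₑ ∂I := by
      simpa using enorm_integral_le_lintegral_enorm _
    refine (pow_le_pow_left' s1 2).trans ((lint_cs I aemeasurable_const hcont.measurable.enorm.aemeasurable).trans ?_)
    simp only [one_pow, lintegral_const, I, Measure.restrict_apply_univ, Real.volume_Ioc, sub_zero, ENNReal.ofReal_one, one_mul]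
    refine lintegral_mono fun t => ?_
    rw [fderiv_decomp]
    refine (enorm_add_sq_le _ _).trans (le_of_eq ?_)
    rw [enorm_mul, enorm_mul, mul_pow, mul_pow]
    have : ‖cj h‖ₑ = ‖h‖ₑ := by rw [← ofReal_norm, ← ofReal_norm, RCLike.norm_conj]
    rw [this]; ring
  refine (lintegral_mono hpt).trans ?_
  rw [lintegral_lintegral_swap (by
    apply Measurable.aemeasurable
    have m : Continuous (fun p : ℂ × ℝ => p.1 + p.2 • h) := by fun_prop
    exact measurable_const.mul (((c1.comp m).measurable.enorm.pow_const 2).add ((c2.comp m).measurable.enorm.pow_const 2)))]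
  have e : ∀ t : ℝ, ∫⁻ x, 2 * ‖h‖ₑ^2 * (‖dee φ (x + t • h)‖ₑ^2 + ‖dbar φ (x + t • h)‖ₑ^2) = 4 * ‖h‖ₑ^2 * ∫⁻ x, ‖dee φ x‖ₑ^2 := by
    intro t
    rw [lintegral_add_right_eq_self (fun x => 2 * ‖h‖ₑ^2 * (‖dee φ x‖ₑ^2 + ‖dbar φ x‖ₑ^2)) (t • h),
      lintegral_const_mul' _ _ (ENNReal.mul_ne_top (by simp) (by simp)),
      lintegral_add_left (c1.measurable.enorm.pow_const 2), dbar_dee_norm hφ]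
    ring
  simp_rw [e]
  simp [I]

lemma eLp_sq {f : ℂ → ℂ} : eLpNorm f 2 volume ^ 2 = ∫⁻ x, ‖f x‖ₑ^2 := by
  have := eLpNorm_nnreal_pow_eq_lintegral (f := f) (μ := volume) (p := 2) (by norm_num)
  have h2 : ((2:ℝ≥0):ℝ) = 2 := by norm_num
  have h3 : ((2:ℝ≥0):ℝ≥0∞) = 2 := by norm_num
  rw [h2, h3] at this
  simpa using this

lemma diff_test' {φ : ℂ → ℂ} (hφ : IsTest univ φ) (h : ℂ) :
    eLpNorm (fun x => φ (x + h) - φ x) 2 volume ≤ 2 * ‖h‖ₑ * eLpNorm (dee φ) 2 volume := by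
  refine (ENNReal.pow_le_pow_left_iff (n := 2) (by norm_num)).1 ?_
  rw [eLp_sq, mul_pow, mul_pow, eLp_sq]
  refine (diff_test hφ h).trans (le_of_eq ?_)
  norm_num

lemma test_sub {D : Set ℂ} {η ξ : ℂ → ℂ} (hη : IsTest D η) (hξ : IsTest D ξ) :
    IsTest D (fun x => η x - ξ x) ∧ ∀ x, dee (fun x => η x - ξ x) x = dee η x - dee ξ x := by
  have e : (fun x => η x - ξ x) = fun x => η x + (-1) * ξ x := by ext x; ring
  have hn : IsTest D (fun x => (-1) * ξ x) := hξ.mul_left contDiff_const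
  refine ⟨by rw [e]; exact hη.add hn, fun x => ?_⟩
  unfold dee
  rw [fderiv_fun_sub (hη.diff _) (hξ.diff _)]
  simp; ring

lemma diff_lim {D : Set ℂ} {φ g : ℂ → ℂ} {φs : ℕ → ℂ → ℂ} (ht : ∀ n, IsTest D (φs n)) (hφ : MemLp φ 2 volume)
    (hg : MemLp g 2 volume) (h1 : Tendsto (fun n => eLpNorm (fun x => φ x - φs n x) 2 volume) atTop (𝓝 0))
    (h2 : Tendsto (fun n => eLpNorm (fun x => g x - dee (φs n) x) 2 volume) atTop (𝓝 0)) (n : ℕ) (h : ℂ) :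
    eLpNorm (fun x => (φ (x + h) - φs n (x + h)) - (φ x - φs n x)) 2 volume ≤
      2 * ‖h‖ₑ * eLpNorm (fun x => g x - dee (φs n) x) 2 volume := by
  have mt : ∀ m, MemLp (φs m) 2 volume := fun m => (ht m).memLp volume
  have md : ∀ m, MemLp (dee (φs m)) 2 volume := fun m => (ht m).dee.memLp volume
  have sh : ∀ f : ℂ → ℂ, MemLp f 2 volume → MemLp (fun x => f (x + h)) 2 volume := fun f hf =>
    hf.comp_measurePreserving (measurePreserving_add_right volume h)
  have she : ∀ f : ℂ → ℂ, MemLp f 2 volume → eLpNorm (fun x => f (x + h)) 2 volume = eLpNorm f 2 volume := fun f hf =>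
    eLpNorm_comp_measurePreserving hf.1 (measurePreserving_add_right volume h)
  have key : ∀ m, eLpNorm (fun x => (φ (x + h) - φs n (x + h)) - (φ x - φs n x)) 2 volume ≤
      (eLpNorm (fun x => φ x - φs m x) 2 volume + eLpNorm (fun x => φ x - φs m x) 2 volume) +
      2 * ‖h‖ₑ * (eLpNorm (fun x => g x - dee (φs m) x) 2 volume + eLpNorm (fun x => g x - dee (φs n) x) 2 volume) := by
    intro m
    have hm : MemLp (fun x => φ x - φs m x) 2 volume := hφ.sub (mt m)
    have hT := test_sub (ht m) (ht n)
    have hT' := diff_test' (hT.1.mono (subset_univ _)) h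
    have e : (fun x => (φ (x + h) - φs n (x + h)) - (φ x - φs n x)) =
        ((fun x => φ (x + h) - φs m (x + h)) - (fun x => φ x - φs m x)) +
        (fun x => (φs m (x + h) - φs n (x + h)) - (φs m x - φs n x)) := by
      ext x; simp only [Pi.add_apply, Pi.sub_apply]; ring
    have hmn : MemLp (fun x => φs m x - φs n x) 2 volume := (mt m).sub (mt n)
    rw [e]
    refine (eLpNorm_add_le (((sh _ hm).sub hm).1) ((sh _ hmn).sub hmn).1 (by norm_num)).trans (add_le_add ?_ ?_)
    · refine (eLpNorm_sub_le (sh _ hm).1 hm.1 (by norm_num)).trans ?_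
      rw [she _ hm]
    · refine hT'.trans (mul_le_mul_right ?_ _)
      have e2 : dee (fun x => φs m x - φs n x) = (fun x => g x - dee (φs n) x) - (fun x => g x - dee (φs m) x) := by
        ext x; rw [hT.2]; simp
      rw [e2, add_comm]
      exact eLpNorm_sub_le (hg.sub (md n)).1 (hg.sub (md m)).1 (by norm_num)
  have hlim : Tendsto (fun m => (eLpNorm (fun x => φ x - φs m x) 2 volume + eLpNorm (fun x => φ x - φs m x) 2 volume) +
      2 * ‖h‖ₑ * (eLpNorm (fun x => g x - dee (φs m) x) 2 volume + eLpNorm (fun x => g x - dee (φs n) x) 2 volume)) atTop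
      (𝓝 ((0 + 0) + 2 * ‖h‖ₑ * (0 + eLpNorm (fun x => g x - dee (φs n) x) 2 volume))) := by
    refine (h1.add h1).add (ENNReal.Tendsto.const_mul (h2.add tendsto_const_nhds) (Or.inr ?_))
    exact ENNReal.mul_ne_top (by simp) (by simp)
  have := ge_of_tendsto' hlim key
  simpa using this

/-- comparison principle -/
lemma CP {D : Set ℂ} (hb : Bornology.IsBounded D) {φ g : ℂ → ℂ} {φs : ℕ → ℂ → ℂ} (ht : ∀ n, IsTest D (φs n))
    (hφm : Measurable φ) (hφ : MemLp φ 2 volume)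
    (hg : MemLp g 2 volume) (h1 : Tendsto (fun n => eLpNorm (fun x => φ x - φs n x) 2 volume) atTop (𝓝 0))
    (h2 : Tendsto (fun n => eLpNorm (fun x => g x - dee (φs n) x) 2 volume) atTop (𝓝 0))
    {V : ℂ → ℝ} (hVm : Measurable V) (hV0 : ∀ x, 0 ≤ V x) (hVD : ∀ x ∉ D, V x = 0)
    (hVφ : ∀ x, V x ≤ max (-(φ x).re) 0)
    (hJ : ∀ K, IsCompact K → K ⊆ D → ∃ r : ℝ, 0 < r ∧ r ≤ 1 ∧ ∀ᵐ x, x ∈ K → V x ≤ (Real.pi * r^2)⁻¹ * ∫ h in ball (0:ℂ) r, V (x + h)) :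
    V =ᵐ[volume] 0 := by
  obtain ⟨R, hR, hRD⟩ := bdd_R hb
  have hVR : ∀ x, R ≤ ‖x‖ → V x = 0 := fun x hx => hVD x fun h => absurd (hRD x h) (not_lt.2 hx)
  have hVL : MemLp V 2 volume := by
    refine hφ.of_le hVm.aestronglyMeasurable (Eventually.of_forall fun x => ?_)
    rw [Real.norm_of_nonneg (hV0 x)]
    refine (hVφ x).trans (max_le ?_ (norm_nonneg _))
    exact (neg_le_abs _).trans (Complex.abs_re_le_norm _)
  have mt : ∀ m, MemLp (φs m) 2 volume := fun m => (ht m).memLp volume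
  have md : ∀ m, MemLp (dee (φs m)) 2 volume := fun m => (ht m).dee.memLp volume
  set δ := fun n x => |(φ x - φs n x).re| with hδ
  have hδm : ∀ n, Measurable (δ n) := fun n =>
    (Complex.measurable_re.comp (hφm.sub (ht n).smooth.continuous.measurable)).abs
  have hδle : ∀ n x, ‖δ n x‖ ≤ ‖φ x - φs n x‖ := fun n x => by
    rw [Real.norm_of_nonneg (abs_nonneg _)]; exact Complex.abs_re_le_norm _
  have hδL : ∀ n, MemLp (δ n) 2 volume := fun n =>
    (hφ.sub (mt n)).of_le (hδm n).aestronglyMeasurable (Eventually.of_forall (hδle n))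
  have hmax : ∀ n, ∫ x, (max (V x - δ n x) 0)^2 ≤ (2*R+1)^2 * (2 * (eLpNorm (fun x => g x - dee (φs n) x) 2 volume).toReal)^2 := by
    intro n
    obtain ⟨r, hr, hr1, hJr⟩ := hJ _ (ht n).cpt (ht n).supp
    refine CP1 hR hr hr1 hVm (hδm n) hVL (hδL n) hVR (fun x => abs_nonneg _) ?_ ?_
    · filter_upwards [hJr] with x hx hlt
      refine hx ?_
      by_contra hns
      have : φs n x = 0 := image_eq_zero_of_notMem_tsupport hns
      have h3 := hVφ x
      simp only [hδ, this, sub_zero] at hlt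
      have : max (-(φ x).re) 0 ≤ |(φ x).re| := max_le (neg_le_abs _) (abs_nonneg _)
      linarith
    · intro h
      have hm : MemLp (fun x => δ n (x + h) - δ n x) 2 volume := (memLp_shift (hδL n) h).sub (hδL n)
      have hle : eLpNorm (fun x => δ n (x + h) - δ n x) 2 volume ≤ 2 * ‖h‖ₑ * eLpNorm (fun x => g x - dee (φs n) x) 2 volume := by
        refine (eLpNorm_mono fun x => ?_).trans (diff_lim ht hφ hg h1 h2 n h)
        rw [Real.norm_eq_abs]
        refine (abs_abs_sub_abs_le _ _).trans ?_
        rw [← Complex.sub_re]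
        exact Complex.abs_re_le_norm _
      have hfin : eLpNorm (fun x => g x - dee (φs n) x) 2 volume ≠ ⊤ := (hg.sub (md n)).2.ne
      rw [real_eLp hm, ← ENNReal.ofReal_toReal hfin, ← ofReal_norm, show (2:ℝ≥0∞) = ENNReal.ofReal 2 by simp,
        ← ENNReal.ofReal_mul (by norm_num), ← ENNReal.ofReal_mul (by positivity),
        ENNReal.ofReal_le_ofReal_iff (by positivity)] at hle
      have := pow_le_pow_left₀ (Real.sqrt_nonneg _) hle 2
      rw [Real.sq_sqrt (integral_nonneg fun x => sq_nonneg _)] at this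
      refine this.trans (le_of_eq (by simp only [ENNReal.ofReal_ofNat]; ring))
  have hVb : ∀ n, eLpNorm V 2 volume ≤ ENNReal.ofReal ((2*R+1) * (2 * (eLpNorm (fun x => g x - dee (φs n) x) 2 volume).toReal)) +
      eLpNorm (fun x => φ x - φs n x) 2 volume := by
    intro n
    have hm : MemLp (fun x => max (V x - δ n x) 0) 2 volume := by
      refine (hVL.sub (hδL n)).of_le ((hVm.sub (hδm n)).max measurable_const).aestronglyMeasurable (Eventually.of_forall fun x => ?_)
      rw [Real.norm_of_nonneg (le_max_right _ _)]
      exact max_le (le_abs_self _) (abs_nonneg _)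
    calc eLpNorm V 2 volume ≤ eLpNorm ((fun x => max (V x - δ n x) 0) + δ n) 2 volume := by
          refine eLpNorm_mono fun x => ?_
          rw [Real.norm_of_nonneg (hV0 x), Pi.add_apply, Real.norm_of_nonneg (add_nonneg (le_max_right _ _) (abs_nonneg _))]
          linarith [le_max_left (V x - δ n x) 0]
      _ ≤ eLpNorm (fun x => max (V x - δ n x) 0) 2 volume + eLpNorm (δ n) 2 volume := eLpNorm_add_le hm.1 (hδL n).1 (by norm_num)
      _ ≤ _ := by
          refine add_le_add ?_ (eLpNorm_mono (hδle n))
          rw [real_eLp hm]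
          refine ENNReal.ofReal_le_ofReal (Real.sqrt_le_iff.2 ⟨by positivity, ?_⟩)
          rw [mul_pow]; exact hmax n
  have hlim : Tendsto (fun n => ENNReal.ofReal ((2*R+1) * (2 * (eLpNorm (fun x => g x - dee (φs n) x) 2 volume).toReal)) +
      eLpNorm (fun x => φ x - φs n x) 2 volume) atTop (𝓝 (ENNReal.ofReal ((2*R+1) * (2 * (0:ℝ≥0∞).toReal)) + 0)) := by
    refine Tendsto.add (ENNReal.tendsto_ofReal (Tendsto.const_mul _ (Tendsto.const_mul _ ?_))) h1
    exact (ENNReal.tendsto_toReal (by simp)).comp h2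
  have := ge_of_tendsto' hlim hVb
  simp only [ENNReal.toReal_zero, mul_zero, ENNReal.ofReal_zero, add_zero, nonpos_iff_eq_zero] at this
  exact (eLpNorm_eq_zero_iff hVL.1 (by norm_num)).1 this


def kr (r : ℝ) : ℂ → ℂ := (ball (0:ℂ) r).indicator (fun _ => (((Real.pi * r^2)⁻¹ : ℝ) : ℂ))

lemma kr_int (r : ℝ) : Integrable (kr r) :=
  (integrable_indicator_iff measurableSet_ball).2 (integrableOn_const measure_ball_lt_top.ne enorm_ne_top)

lemma kr_meas (r : ℝ) : Measurable (kr r) := measurable_const.indicator measurableSet_ball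

lemma kr_zero (r : ℝ) (x : ℂ) (h : r ≤ ‖x‖) : kr r x = 0 := indicator_of_notMem (by simpa using h) _

lemma kr_symm (r : ℝ) (x y : ℂ) : kr r (x - y) = kr r (y - x) := by
  simp only [kr, Set.indicator, mem_ball_zero_iff, norm_sub_rev x y]

lemma kr_avg (r : ℝ) (f : ℂ → ℂ) (x : ℂ) : ∫ y, kr r (x - y) * f y = (((Real.pi * r^2)⁻¹ : ℝ) : ℂ) * ∫ y in ball x r, f y := by
  rw [← integral_const_mul, ← integral_indicator measurableSet_ball]
  congr 1; ext y
  simp only [kr, Set.indicator, mem_ball, dist_eq_norm, sub_zero, norm_sub_rev x y]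
  split_ifs <;> simp

lemma kr_test (r : ℝ) {η : ℂ → ℂ} (hη : IsTest univ η) : IsTest univ (cv (kr r) η) := by
  refine ⟨cv_smooth (kr_int r).locallyIntegrable hη, ?_, subset_univ _⟩
  refine HasCompactSupport.intro (K := cthickening r (tsupport η)) (hη.cpt.isCompact.cthickening) fun x hx => ?_
  rw [cv_eq']
  have : ∀ t, kr r (x - t) * η t = 0 := by
    intro t
    by_cases ht : t ∈ tsupport η
    · rw [kr_zero, zero_mul]
      by_contra h
      exact hx (thickening_subset_cthickening _ _ (mem_thickening_iff.2 ⟨t, ht, by rw [dist_eq_norm]; linarith⟩))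
    · rw [image_eq_zero_of_notMem_tsupport ht, mul_zero]
  simp [this]

lemma cv_comm (r : ℝ) {η : ℂ → ℂ} (hη : IsTest univ η) (x : ℂ) :
    cv lg (cv (kr r) η) x = ∫ y, kr r y * cv lg η (x - y) := by
  obtain ⟨R', hR'⟩ := hη.cpt.isCompact.isBounded.subset_ball 0
  obtain ⟨M, hM⟩ := hη.smooth.continuous.bounded_above_of_compact_support hη.cpt
  set ρ := R' + ‖x‖ + r
  have hl : Integrable ((ball (0:ℂ) ρ).indicator lg) := (integrable_indicator_iff measurableSet_ball).2
    ((locInt_lg.integrableOn_isCompact (isCompact_closedBall 0 ρ)).mono_set ball_subset_closedBall)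
  have hi : Integrable (fun p : ℂ × ℂ => lg p.1 * (kr r p.2 * η (x - p.1 - p.2))) (volume.prod volume) := by
    refine ((hl.mul_prod (kr_int r)).norm.mul_const M).mono' ?_ (ae_of_all _ fun p => ?_)
    · have : Continuous (fun p : ℂ × ℂ => η (x - p.1 - p.2)) := hη.smooth.continuous.comp (by fun_prop)
      exact ((lg_meas.comp measurable_fst).mul (((kr_meas r).comp measurable_snd).mul this.measurable)).aestronglyMeasurable
    · by_cases h1 : r ≤ ‖p.2‖
      · simp [kr_zero r _ h1]
      by_cases h2 : x - p.1 - p.2 ∈ tsupport η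
      · have h3 := mem_ball_zero_iff.1 (hR' h2)
        have h4 : p.1 ∈ ball (0:ℂ) ρ := by
          rw [mem_ball_zero_iff]
          have : p.1 = x - p.2 - (x - p.1 - p.2) := by ring
          rw [this]
          linarith [norm_sub_le (x - p.2) (x - p.1 - p.2), norm_sub_le x p.2]
        rw [indicator_of_mem h4, norm_mul, norm_mul, norm_mul, ← mul_assoc]
        exact mul_le_mul_of_nonneg_left (hM _) (by positivity)
      · rw [image_eq_zero_of_notMem_tsupport h2]
        have : 0 ≤ M := (norm_nonneg _).trans (hM 0)
        simp only [mul_zero, norm_zero]; positivity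
  have h := integral_integral_swap (f := fun t y => lg t * (kr r y * η (x - t - y))) hi
  have e1 : ∀ t, ∫ y, lg t * (kr r y * η (x - t - y)) = lg t * cv (kr r) η (x - t) := fun t => integral_const_mul _ _
  have e2 : ∀ y, ∫ t, lg t * (kr r y * η (x - t - y)) = kr r y * cv lg η (x - y) := fun y => by
    rw [cv, ← integral_const_mul]
    congr 1; ext t; rw [sub_right_comm]; ring
  simp_rw [e1, e2] at h
  exact h

lemma cv_lg_zero {r : ℝ} (hr : 0 < r) {η : ℂ → ℂ} (hη : IsTest univ η) (x : ℂ) (h0 : ∀ t ∈ ball x r, η t = 0) :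
    ∫ y, kr r y * cv lg η (x - y) = cv lg η x := by
  have hs := fub_swap locInt_lg lg_meas (hη.reflect x).smooth.continuous (hη.reflect x).cpt (kr_int r) (kr_zero r)
  have e1 : ∀ y, ∫ p, lg (p - y) * η (x - p) = cv lg η (x - y) := fun y => by
    rw [cv, ← integral_sub_right_eq_self (fun t => lg t * η (x - y - t)) y]
    congr 1; ext p; congr 2; ring
  have e2 : ∀ p, (∫ y, lg (p - y) * kr r y) * η (x - p) = lg p * η (x - p) := fun p => by
    by_cases hp : r ≤ ‖p‖
    · congr 1
      rw [← integral_sub_left_eq_self _ volume p]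
      simp_rw [sub_sub_cancel]
      have := kr_avg r lg p
      rw [log_disc hr hp] at this
      simp_rw [mul_comm (lg _)]
      rw [this, Complex.real_smul, ← mul_assoc, ← Complex.ofReal_mul, inv_mul_cancel₀ (by positivity)]; simp
    · rw [h0 (x - p) (by simpa [dist_eq_norm] using hp)]; simp
  simp_rw [e1, e2] at hs
  simp_rw [mul_comm (kr r _)]
  exact hs.symm

/-- the potential of `η - J η` is a test function -/
lemma pot_test {r : ℝ} (hr : 0 < r) {Ω D : Set ℂ} (hΩ : ∀ x ∈ Ω, closedBall x r ⊆ D) {η : ℂ → ℂ} (hη : IsTest Ω η) :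
    ∃ u, IsTest D u ∧ (∀ x, dee (dbar u) x = η x - cv (kr r) η x) ∧ u = cv lg (fun y => η y - cv (kr r) η y) := by
  have hη' := hη.mono (subset_univ _)
  have hJ := kr_test r hη'
  have hT := (test_sub hη' hJ).1
  have hz : ∀ x ∉ cthickening r (tsupport η), cv lg (fun y => η y - cv (kr r) η y) x = 0 := by
    intro x hx
    have := cv_lin locInt_lg hη' hJ 1 (-1) x
    have e : (fun y => 1 * η y + (-1) * cv (kr r) η y) = fun y => η y - cv (kr r) η y := by ext y; ring
    rw [e] at this
    rw [this, cv_comm r hη', cv_lg_zero hr hη']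
    · ring
    · intro t ht
      by_contra h
      exact hx (thickening_subset_cthickening _ _ (mem_thickening_iff.2 ⟨t, subset_tsupport _ h, by rw [dist_comm]; exact ht⟩))
  have hc : IsCompact (cthickening r (tsupport η)) := hη.cpt.isCompact.cthickening
  refine ⟨_, ⟨cv_smooth locInt_lg hT, HasCompactSupport.intro hc hz, ?_⟩, fun x => cv_lg_dee_dbar hT x, rfl⟩
  refine (closure_minimal (fun x hx => ?_) hc.isClosed).trans (?_ : cthickening r (tsupport η) ⊆ D)
  · by_contra h; exact hx (hz x h)
  · rw [hη.cpt.isCompact.cthickening_eq_biUnion_closedBall hr.le]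
    exact iUnion₂_subset fun x hx => hΩ x (hη.supp hx)

lemma mean_ae {Ω : Set ℂ} (hΩ : IsOpen Ω) (r : ℝ) {H : ℂ → ℂ} (hH : Integrable H) {R : ℝ} (hR : ∀ x, R ≤ ‖x‖ → H x = 0)
    (h : ∀ η, IsTest Ω η → ∫ x, H x * (η x - cv (kr r) η x) = 0) :
    ∀ᵐ x, x ∈ Ω → H x = (((Real.pi * r^2)⁻¹ : ℝ) : ℂ) * ∫ y in ball x r, H y := by
  have hloc : LocallyIntegrable (fun x => ∫ y, kr r (x - y) * H y) := fub_locInt (kr_int r).locallyIntegrable (kr_meas r) hH hR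
  have hL : LocallyIntegrable (fun x => H x - ∫ y, kr r (x - y) * H y) := hH.locallyIntegrable.sub hloc
  have := hΩ.ae_eq_zero_of_integral_contDiff_smul_eq_zero (hL.locallyIntegrableOn Ω) (μ := volume) ?_
  · filter_upwards [this] with x hx hxΩ
    rw [← kr_avg]; exact sub_eq_zero.1 (hx hxΩ)
  · intro g hg hgc hgs
    set η : ℂ → ℂ := fun x => (g x : ℂ)
    have hts : tsupport η = tsupport g := by
      unfold tsupport; congr 1; ext x; simp [η]
    have hη : IsTest Ω η := ⟨Complex.ofRealCLM.contDiff.comp hg, by rw [HasCompactSupport, hts]; exact hgc, by rw [hts]; exact hgs⟩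
    have hη' := hη.mono (subset_univ _)
    have hs := fub_swap (kr_int r).locallyIntegrable (kr_meas r) hη.smooth.continuous hη.cpt hH hR
    have hi := fub_int (kr_int r).locallyIntegrable (kr_meas r) hη.smooth.continuous hη.cpt hH hR
    have e1 : ∀ y, ∫ x, kr r (x - y) * η x = cv (kr r) η y := fun y => by
      rw [cv_eq']; simp_rw [kr_symm r y]
    simp_rw [e1] at hs
    have h0 := h η hη
    have i1 := int_mul_cont hH hη.smooth.continuous hR
    have i2 := int_mul_cont hH (kr_test r hη').smooth.continuous hR
    simp_rw [mul_sub] at h0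
    rw [integral_sub i1 i2] at h0
    have e3 : ∀ x, g x • (H x - ∫ y, kr r (x - y) * H y) = H x * η x - (∫ y, kr r (x - y) * H y) * η x := fun x => by
      rw [Complex.real_smul]; simp only [η]; ring
    simp_rw [e3]
    rw [integral_sub i1 hi, hs]
    simp_rw [mul_comm (cv (kr r) η _)]
    exact h0


lemma tend_sq {f : ℕ → ℝ≥0∞} (h : Tendsto (fun n => f n ^ 2) atTop (𝓝 0)) : Tendsto f atTop (𝓝 0) := by
  have := ((ENNReal.continuous_rpow_const (y := (1/2:ℝ))).tendsto 0).comp h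
  rw [ENNReal.zero_rpow_of_pos (by norm_num)] at this
  refine this.congr fun n => ?_
  simp only [Function.comp]
  rw [← ENNReal.rpow_natCast, ← ENNReal.rpow_mul]; norm_num

lemma lim_int {f v : ℂ → ℂ} {fs : ℕ → ℂ → ℂ} (hf : MemLp f 2 volume) (hfs : ∀ n, MemLp (fs n) 2 volume) (hv : MemLp v 2 volume)
    (h : Tendsto (fun n => eLpNorm (fun x => f x - fs n x) 2 volume) atTop (𝓝 0)) :
    Tendsto (fun n => ∫ x, fs n x * v x) atTop (𝓝 (∫ x, f x * v x)) := by
  rw [tendsto_iff_edist_tendsto_0]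
  refine tend_sq ?_
  have hb : ∀ n, edist (∫ x, fs n x * v x) (∫ x, f x * v x) ^ 2 ≤ eLpNorm (fun x => f x - fs n x) 2 volume ^ 2 * eLpNorm v 2 volume ^ 2 := by
    intro n
    have hm : MemLp (fun x => f x - fs n x) 2 volume := hf.sub (hfs n)
    have e : (∫ x, f x * v x) - (∫ x, fs n x * v x) = ∫ x, (f x - fs n x) * v x := by
      refine (integral_sub (hf.integrable_mul hv) ((hfs n).integrable_mul hv)).symm.trans ?_
      congr 1; ext x; simp only [Pi.mul_apply]; ring
    rw [edist_comm, edist_eq_enorm_sub, e, eLp_sq, eLp_sq]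
    have := enorm_integral_le_lintegral_enorm (fun x => (f x - fs n x) * v x) (μ := volume)
    simp_rw [enorm_mul] at this
    exact (pow_le_pow_left' this 2).trans (lint_cs volume hm.1.enorm hv.1.enorm)
  refine tendsto_of_tendsto_of_tendsto_of_le_of_le tendsto_const_nhds ?_ (fun n => zero_le) hb
  have := ENNReal.Tendsto.mul_const (b := eLpNorm v 2 volume ^ 2) (ENNReal.Tendsto.pow (n := 2) h) (Or.inr (ENNReal.pow_ne_top hv.2.ne))
  simpa using this

lemma near_le {g : ℂ → ℂ} {a : ℂ} {r M : ℝ} (hr : 0 < r) (hM : ∀ ζ ∈ ball a r, ‖g ζ‖ ≤ M) :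
    ∫⁻ ζ, ke (a - ζ) * ‖g ζ‖ₑ ≤ ENNReal.ofReal M * ENNReal.ofReal (2 * Real.pi * r) + ENNReal.ofReal r⁻¹ * ∫⁻ ζ, ‖g ζ‖ₑ := by
  have hm : Measurable (fun ζ => (ball a r).indicator (fun ζ => ENNReal.ofReal M * ke (a - ζ)) ζ) :=
    (measurable_const.mul (ke_meas.comp (by fun_prop))).indicator measurableSet_ball
  have h1 : ∀ ζ, ke (a - ζ) * ‖g ζ‖ₑ ≤ (ball a r).indicator (fun ζ => ENNReal.ofReal M * ke (a - ζ)) ζ + ENNReal.ofReal r⁻¹ * ‖g ζ‖ₑ := by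
    intro ζ
    by_cases h : ζ ∈ ball a r
    · rw [indicator_of_mem h, mul_comm (ENNReal.ofReal M)]
      refine le_add_right (mul_le_mul_right ?_ _)
      rw [← ofReal_norm]; exact ENNReal.ofReal_le_ofReal (hM ζ h)
    · refine le_add_left (mul_le_mul_left (ENNReal.ofReal_le_ofReal ?_) _)
      rw [mem_ball, dist_comm, dist_eq_norm, not_lt] at h
      gcongr
  refine (lintegral_mono h1).trans ?_
  rw [lintegral_add_left hm, lintegral_indicator measurableSet_ball, lintegral_const_mul' _ _ ENNReal.ofReal_ne_top,
    lintegral_const_mul' _ _ ENNReal.ofReal_ne_top]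
  gcongr
  exact ke_ball' a r

lemma near_int {g : ℂ → ℂ} (hg : Integrable g) {a : ℂ} {r M : ℝ} (hr : 0 < r) (hM : ∀ ζ ∈ ball a r, ‖g ζ‖ ≤ M) :
    Integrable (fun ζ => (a - ζ)⁻¹ * g ζ) := by
  refine ⟨AEStronglyMeasurable.mul (by fun_prop) hg.1, ?_⟩
  rw [HasFiniteIntegral]
  simp_rw [enorm_mul, enorm_inv_ke]
  refine (near_le hr hM).trans_lt ?_
  have : ∫⁻ ζ, ‖g ζ‖ₑ ≠ ⊤ := hg.2.ne
  finiteness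

/-- data attached to a point -/
structure Dat (D : Set ℂ) (z : ℂ) (e : ℂ → ℂ) : Prop where
  hol : Hol2 D e
  zero : ∀ x ∉ D, e x = 0
  nrm : (∫ a in D, ‖e a‖ ^ 2) = 1
  rep : ∀ F, Hol2 D F → ∫ a in D, cj (e a) * F a = F z / kap D z

def psi (z : ℂ) (e : ℂ → ℂ) : ℂ → ℂ := Cau (fun a => (a - z) * cj (e a))

def phi (D : Set ℂ) (z : ℂ) (e : ℂ → ℂ) : ℂ → ℂ := D.indicator (fun a => cj (psi z e a))

lemma conv_meas' {k g : ℂ → ℂ} (hk : Measurable k) (hg : Measurable g) : Measurable (fun a => ∫ ζ, k (a - ζ) * g ζ) := by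
  have h : StronglyMeasurable (fun p : ℂ × ℂ => k (p.1 - p.2) * g p.2) :=
    ((hk.comp (measurable_fst.sub measurable_snd)).mul (hg.comp measurable_snd)).stronglyMeasurable
  exact h.integral_prod_right'.measurable

section
variable {D : Set ℂ} {z : ℂ} {e : ℂ → ℂ} 

lemma Dat.lint (h : Dat D z e) (hD : IsOpen D) : ∫⁻ a, ‖e a‖ₑ^2 = 1 := by
  have := lint_sq' h.hol.2
  rw [h.nrm, set_leq hD.measurableSet (fun x hx => by simp [h.zero x hx])] at this
  simpa using this

lemma Dat.meas (h : Dat D z e) (hD : IsOpen D) : Measurable e := hol_meas hD h.hol.1 h.zero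

lemma Dat.cmeas (h : Dat D z e) (hD : IsOpen D) : Measurable (fun a => cj (e a)) := Complex.continuous_conj.measurable.comp (h.meas hD)

lemma Dat.phi_meas (h : Dat D z e) (hD : IsOpen D) : Measurable (phi D z e) := by
  refine (Complex.continuous_conj.measurable.comp ?_).indicator hD.measurableSet
  have hk : Measurable (fun x : ℂ => x⁻¹) := measurable_inv
  have hg : Measurable (fun a => (a - z) * cj (e a)) := (by fun_prop : Measurable (fun a : ℂ => a - z)).mul (h.cmeas hD)
  exact (conv_meas' hk hg).const_mul _

lemma glob_mem (hD : IsOpen D) {f : ℂ → ℂ} (hf : MemLp f 2 (volume.restrict D)) (h0 : ∀ x ∉ D, f x = 0) : MemLp f 2 volume := by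
  have : D.indicator f = f := indicator_eq_self.2 fun x hx => by by_contra hn; exact hx (h0 x hn)
  rw [← this]; exact (memLp_indicator_iff_restrict hD.measurableSet).2 hf

lemma Dat.approx (h : Dat D z e) (hD : IsOpen D) (hb : Bornology.IsBounded D) :
    MemLp (fun a => cj (a - z) * e a) 2 volume ∧ MemLp (phi D z e) 2 volume ∧
    ∃ φs : ℕ → ℂ → ℂ, (∀ n, IsTest D (φs n)) ∧
      Tendsto (fun n => eLpNorm (fun x => phi D z e x - φs n x) 2 volume) atTop (𝓝 0) ∧
      Tendsto (fun n => eLpNorm (fun x => cj (x - z) * e x - dee (φs n) x) 2 volume) atTop (𝓝 0) := by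
  obtain ⟨hg, ho⟩ := g_orth hD hb h.hol h.rep
  set g : ℂ → ℂ := fun a => cj (a - z) * e a with hgd
  have hg0 : ∀ x ∉ D, g x = 0 := fun x hx => by simp [hgd, h.zero x hx]
  have hG := glob_mem hD hg hg0
  have hcg : MemLp (fun a => (a - z) * cj (e a)) 2 (volume.restrict D) := by
    have : MemLp (fun a => cj (g a)) 2 (volume.restrict D) := hg.star
    refine this.ae_eq (ae_of_all _ fun a => ?_)
    simp [hgd, cj]
  have hcg0 : ∀ x ∉ D, (x - z) * cj (e x) = 0 := fun x hx => by simp [h.zero x hx]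
  have hC := Cau_memLp hD hb hcg hcg0
  have hφ : MemLp (phi D z e) 2 volume := (memLp_indicator_iff_restrict hD.measurableSet).2 hC.star
  refine ⟨hG, hφ, ?_⟩
  choose φs ht hφs using fun n : ℕ => dense_dee hD hb hg ho (1 / ((n:ℝ) + 1)) (by positivity)
  have hsq : ∀ n, eLpNorm (fun x => g x - dee (φs n) x) 2 volume ^ 2 ≤ ENNReal.ofReal (1 / ((n:ℝ) + 1)) := by
    intro n
    have hd : MemLp (dee (φs n)) 2 volume := (ht n).dee.memLp volume
    have hm : MemLp (fun x => dee (φs n) x - g x) 2 (volume.restrict D) := (hd.restrict D).sub hg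
    have hl := lint_sq' hm
    rw [set_leq hD.measurableSet (fun x hx => by
      simp [hg0 x hx, dee_zero_of_notMem (fun hn => hx ((ht n).supp hn))])] at hl
    rw [eLp_sq]
    simp_rw [← neg_sub (dee (φs n) _) (g _), enorm_neg]
    rw [hl]
    exact ENNReal.ofReal_le_ofReal (hφs n).le
  have hz : Tendsto (fun n : ℕ => ENNReal.ofReal (1 / ((n:ℝ) + 1))) atTop (𝓝 0) := by
    have := ENNReal.tendsto_ofReal tendsto_one_div_add_atTop_nhds_zero_nat
    simpa using this
  have hs2 : Tendsto (fun n => eLpNorm (fun x => g x - dee (φs n) x) 2 volume ^ 2) atTop (𝓝 0) :=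
    tendsto_of_tendsto_of_tendsto_of_le_of_le tendsto_const_nhds hz (fun n => zero_le) hsq
  refine ⟨φs, ht, tend_sq ?_, tend_sq hs2⟩
  have hDf : volume D ≠ ⊤ := hb.measure_lt_top.ne
  set C := (ENNReal.ofReal (2 * Real.pi * 1) + ENNReal.ofReal (1:ℝ)⁻¹ * volume D)
  have hCf : C ≠ ⊤ := by simp only [C]; finiteness
  refine tendsto_of_tendsto_of_tendsto_of_le_of_le tendsto_const_nhds (h := fun n => C * C * eLpNorm (fun x => g x - dee (φs n) x) 2 volume ^ 2) ?_ (fun n => zero_le) fun n => ?_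
  · have := ENNReal.Tendsto.const_mul (a := C * C) hs2 (Or.inr (ENNReal.mul_ne_top hCf hCf))
    simpa using this
  · have hT := (ht n).mono (subset_univ _)
    have hdm : MemLp (dee (φs n)) 2 volume := (ht n).dee.memLp volume
    have hd0 : ∀ x ∉ D, dee (φs n) x = 0 := fun x hx => dee_zero_of_notMem (fun hn => hx ((ht n).supp hn))
    have i1 := (glob_int hD hb hcg hcg0).1
    have hcd : MemLp (fun a => cj (dee (φs n) a)) 2 (volume.restrict D) := (hdm.restrict D).star
    have i2 := (glob_int hD hb hcd (fun x hx => by simp [hd0 x hx])).1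
    have L := Cau_L2 D D hD.measurableSet one_pos (i1.sub i2).1.aemeasurable (fun x hx => by simp [hd0 x hx, h.zero x hx])
    simp only [eLp_sq]
    have e1 : ∀ x, ‖((fun a => (a - z) * cj (e a)) - fun a => cj (dee (φs n) a)) x‖ₑ^2 = ‖g x - dee (φs n) x‖ₑ^2 := fun x => by
      have : ((fun a => (a - z) * cj (e a)) - fun a => cj (dee (φs n) a)) x = cj (g x - dee (φs n) x) := by
        simp [hgd, cj]
      rw [this, ← ofReal_norm, ← ofReal_norm, RCLike.norm_conj]
    simp_rw [e1] at L
    rw [set_leq hD.measurableSet (g := fun a => ‖g a - dee (φs n) a‖ₑ^2) (fun x hx => by simp [hg0 x hx, hd0 x hx])] at L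
    refine le_trans ?_ L
    rw [← set_leq hD.measurableSet (fun x hx => by
      rw [phi, indicator_of_notMem hx, image_eq_zero_of_notMem_tsupport (fun hn => hx ((ht n).supp hn))]; simp)]
    refine lintegral_mono_ae ?_
    filter_upwards [ae_restrict_mem hD.measurableSet] with x hx
    have hca : ContinuousAt (fun a => (a - z) * cj (e a)) x :=
      ContinuousAt.mul (by fun_prop) (Complex.continuous_conj.continuousAt.comp ((h.hol.1.differentiableAt (hD.mem_nhds hx)).continuousAt))
    obtain ⟨r, hr, hrb⟩ := Metric.eventually_nhds_iff_ball.1 (hca.norm.eventually_lt_const (lt_add_one _))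
    obtain ⟨M, hM⟩ := hT.dee.smooth.continuous.bounded_above_of_compact_support hT.dee.cpt
    have j1 := near_int i1 hr (fun ζ hζ => (hrb ζ hζ).le)
    have j2 := near_int i2 one_pos (a := x) (M := M) (fun ζ hζ => by rw [RCLike.norm_conj]; exact hM ζ)
    have e2 : ∀ a, cj (dee (φs n) a) = dbar (fun x => cj (φs n x)) a := fun a => (dbar_cj (hT.diff _)).symm
    have e3 : cj (φs n x) = Cau (fun a => cj (dee (φs n) a)) x := by
      simp_rw [e2]; exact (Cau_dbar hT.cj x).symm
    have e4 : phi D z e x - φs n x = cj (Cau ((fun a => (a - z) * cj (e a)) - fun a => cj (dee (φs n) a)) x) := by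
      have : Cau ((fun a => (a - z) * cj (e a)) - fun a => cj (dee (φs n) a)) x = psi z e x - cj (φs n x) := by
        rw [e3, psi, Cau, Cau, Cau, ← mul_sub, ← integral_sub j1 j2]
        congr 2; ext ζ; simp only [Pi.sub_apply]; ring
      rw [this, phi, indicator_of_mem hx]; simp [cj]
    rw [e4, ← ofReal_norm, ← ofReal_norm, RCLike.norm_conj]

end


def TT (D E : Set ℂ) (e : ℂ → ℂ) : ℂ → ℂ := D.indicator (fun x => ∫ y, lg (x - y) * E.indicator e y)

section
variable {D : Set ℂ} {z : ℂ} {e : ℂ → ℂ} 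

lemma Dat.weak (h : Dat D z e) (hD : IsOpen D) (hb : Bornology.IsBounded D) {u : ℂ → ℂ} (hu : IsTest D u) :
    ∫ x, phi D z e x * Brg.dee (Brg.dbar u) x = ∫ x, e x * u x := by
  obtain ⟨hG, hφ, φs, ht, h1, h2⟩ := h.approx hD hb
  have l1 := lim_int hφ (fun n => (ht n).memLp volume) (hu.dbar.dee.memLp volume) h1
  have l2 := lim_int hG (fun n => (ht n).dee.memLp volume) (hu.dbar.memLp volume) h2
  have e1 : ∀ n, ∫ x, φs n x * Brg.dee (Brg.dbar u) x = - ∫ x, Brg.dee (φs n) x * Brg.dbar u x := fun n =>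
    parts_dee hD ((ht n).smooth.of_le (by norm_cast)).contDiffOn hu.dbar
  simp_rw [e1] at l1
  have e2 := tendsto_nhds_unique l1 l2.neg
  have hc : ContDiff ℝ ∞ (fun a => cj a - cj z) := contDiff_conj_sub _
  have hcd : ContDiffOn ℝ 1 (fun a => (cj a - cj z) * e a) D :=
    (hc.of_le (by norm_cast)).contDiffOn.mul ((h.hol.1.contDiffOn (n := 1) hD).restrict_scalars ℝ)
  have e3 := parts_dbar hD hcd hu
  have e4 : ∀ a, cj a - cj z = cj (a - z) := fun a => (map_sub _ _ _).symm
  rw [e2]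
  simp_rw [← e4]
  rw [e3, neg_neg]
  congr 1; ext x
  by_cases hx : x ∈ D
  · have hd := h.hol.1.differentiableAt (hD.mem_nhds hx)
    rw [dbar_mul ((hc.differentiable (by simp)) x) (hd.restrictScalars ℝ), dbar_hol hd, dbar_conj_sub]; ring
  · rw [image_eq_zero_of_notMem_tsupport (fun hn => hx (hu.supp hn))]; simp

lemma Dat.l1 (h : Dat D z e) (hD : IsOpen D) (hb : Bornology.IsBounded D) : ∫⁻ a, ‖e a‖ₑ ≤ ENNReal.ofReal (√(volume.real D)) := by
  refine (ENNReal.pow_le_pow_left_iff (n := 2) (by norm_num)).1 ?_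
  have := lint_l1 hD.measurableSet (h.meas hD).aemeasurable h.zero
  rw [set_leq hD.measurableSet (fun x hx => by simp [h.zero x hx]), h.lint hD, mul_one] at this
  refine this.trans (le_of_eq ?_)
  rw [← ENNReal.ofReal_pow (by positivity), Real.sq_sqrt measureReal_nonneg, Measure.real, ENNReal.ofReal_toReal hb.measure_lt_top.ne]

lemma Dat.near (h : Dat D z e) {a : ℂ} {r : ℝ} (hr : 0 < r) (hB : ball a r ⊆ D) :
    ∀ ζ ∈ ball a (r/2), ‖cj (e ζ)‖ ≤ 2/r := by
  intro ζ hζ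
  have := ev_bound h.hol (z := ζ) (r := r/2) (by positivity) ((ball_subset_ball' (by rw [mem_ball] at hζ; linarith)).trans hB)
  rw [h.nrm, Real.sqrt_one, mul_one, inv_div] at this
  rwa [RCLike.norm_conj]

lemma Dat.cint (h : Dat D z e) (hD : IsOpen D) (hb : Bornology.IsBounded D) : Integrable (fun a => cj (e a)) := by
  have : MemLp (fun a => cj (e a)) 2 (volume.restrict D) := h.hol.2.star
  exact (glob_int hD hb this (fun x hx => by simp [h.zero x hx])).1

lemma Dat.bound (h : Dat D z e) (hD : IsOpen D) (hb : Bornology.IsBounded D) {a : ℂ} {r : ℝ} (hr : 0 < r) (hB : ball a r ⊆ D) :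
    ‖Cau (fun a => cj (e a)) a‖ ≤ 2 * Real.pi + 2 / r * √(volume.real D) := by
  have h1 := (Cau_le (fun a => cj (e a)) a).trans (near_le (half_pos hr) (h.near hr hB))
  have hn : ∀ x, ‖cj (e x)‖ₑ = ‖e x‖ₑ := fun x => by rw [← ofReal_norm, ← ofReal_norm, RCLike.norm_conj]
  simp_rw [hn] at h1
  have h2 := h1.trans (add_le_add_right (mul_le_mul_right (h.l1 hD hb) _) _)
  rw [← ENNReal.ofReal_mul (by positivity), ← ENNReal.ofReal_mul (by positivity), ← ENNReal.ofReal_add (by positivity) (by positivity),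
    ← ofReal_norm, ENNReal.ofReal_le_ofReal_iff (by positivity)] at h2
  refine h2.trans (le_of_eq ?_)
  field_simp

lemma Dat.psi_eq (h : Dat D z e) (hD : IsOpen D) (hb : Bornology.IsBounded D) {a : ℂ} (ha : a ∈ D) :
    psi z e a = (a - z) * Cau (fun a => cj (e a)) a - ((Real.pi * kap D z)⁻¹ : ℝ) := by
  obtain ⟨r, hr, hB⟩ := Metric.isOpen_iff.1 hD a ha
  have j := near_int (h.cint hD hb) (half_pos hr) (h.near hr hB)
  have h1 := h.rep _ (one_Hol2 hb)
  simp only [mul_one] at h1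
  rw [set_eq (fun x hx => by simp [h.zero x hx])] at h1
  have hne : ∀ᵐ ζ : ℂ, ζ ≠ a := by simp [ae_iff]
  have h2 : ∫ ζ, (a - ζ)⁻¹ * ((ζ - z) * cj (e ζ)) = ∫ ζ, ((a - z) * ((a - ζ)⁻¹ * cj (e ζ)) - cj (e ζ)) := by
    refine integral_congr_ae ?_
    filter_upwards [hne] with ζ hζ
    have : a - ζ ≠ 0 := sub_ne_zero.2 (Ne.symm hζ)
    field_simp; ring
  rw [psi, Cau, h2, integral_sub (j.const_mul _) (h.cint hD hb), integral_const_mul, h1, Cau]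
  push_cast
  rw [mul_inv, one_div]; ring

lemma Dat.phi_int (h : Dat D z e) (hD : IsOpen D) (hb : Bornology.IsBounded D) : Integrable (phi D z e) :=
  (glob_int hD hb (((h.approx hD hb).2.1).restrict D) (fun x hx => indicator_of_notMem hx _)).1

lemma Dat.E_int (h : Dat D z e) (hD : IsOpen D) (hb : Bornology.IsBounded D) {E : Set ℂ} (hE : MeasurableSet E) :
    Integrable (E.indicator e) ∧ ∃ R : ℝ, ∀ x, R ≤ ‖x‖ → E.indicator e x = 0 := by
  obtain ⟨h1, R, h2, h3⟩ := glob_int hD hb h.hol.2 h.zero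
  exact ⟨h1.indicator hE, R, fun x hx => by simp [indicator, h3 x hx]⟩

lemma Dat.TT_int (h : Dat D z e) (hD : IsOpen D) (hb : Bornology.IsBounded D) {E : Set ℂ} (hE : MeasurableSet E) : Integrable (TT D E e) := by
  obtain ⟨h1, R, h2⟩ := h.E_int hD hb hE
  obtain ⟨R', hR'⟩ := hb.subset_closedBall 0
  exact (integrable_indicator_iff hD.measurableSet).2
    (((fub_locInt locInt_lg lg_meas h1 h2).integrableOn_isCompact (isCompact_closedBall 0 R')).mono_set hR')

lemma Dat.TT_meas (h : Dat D z e) (hD : IsOpen D) {E : Set ℂ} (hE : MeasurableSet E) : Measurable (TT D E e) :=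
  (conv_meas' lg_meas ((h.meas hD).indicator hE)).indicator hD.measurableSet

lemma Dat.mean (h : Dat D z e) (hD : IsOpen D) (hb : Bornology.IsBounded D) {E Ω : Set ℂ} (hE : MeasurableSet E) (hED : E ⊆ D)
    (hΩ : IsOpen Ω) {r : ℝ} (hr : 0 < r) (hΩE : ∀ x ∈ Ω, closedBall x r ⊆ E) :
    ∀ᵐ x, x ∈ Ω → phi D z e x - TT D E e x =
      (((Real.pi * r^2)⁻¹ : ℝ) : ℂ) * ∫ y in ball x r, (phi D z e y - TT D E e y) := by
  obtain ⟨R, hR, hRD⟩ := bdd_R hb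
  have hR0 : ∀ x, R ≤ ‖x‖ → x ∉ D := fun x hx hn => absurd (hRD x hn) (not_lt.2 hx)
  refine mean_ae hΩ r (R := R) ((h.phi_int hD hb).sub (h.TT_int hD hb hE)) (fun x hx => ?_) fun η hη => ?_
  · simp [phi, TT, indicator_of_notMem (hR0 x hx)]
  obtain ⟨u, hu, hdd, hcv⟩ := pot_test hr hΩE hη
  have hη' := hη.mono (subset_univ _)
  have huD := hu.mono hED
  have hv := (test_sub hη' (kr_test r hη')).1
  set v := fun y => η y - cv (kr r) η y with hvd
  have hv0 : ∀ x ∉ D, v x = 0 := fun x hx => by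
    exact (hdd x).symm.trans (image_eq_zero_of_notMem_tsupport fun hn => hx (huD.dbar.dee.supp hn))
  have i1 := int_mul_cont (h.phi_int hD hb) hv.smooth.continuous (R := R) (fun x hx => indicator_of_notMem (hR0 x hx) _)
  have i2 := int_mul_cont (h.TT_int hD hb hE) hv.smooth.continuous (R := R) (fun x hx => indicator_of_notMem (hR0 x hx) _)
  change ∫ x, (phi D z e x - TT D E e x) * v x = 0
  simp_rw [sub_mul]
  rw [integral_sub i1 i2, sub_eq_zero]
  have w := h.weak hD hb huD
  simp_rw [hdd] at w
  refine w.trans ?_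
  obtain ⟨f1, R1, f2⟩ := h.E_int hD hb hE
  have hs := fub_swap locInt_lg lg_meas hv.smooth.continuous hv.cpt f1 f2
  have e1 : ∀ x, TT D E e x * v x = (∫ y, lg (x - y) * E.indicator e y) * v x := fun x => by
    by_cases hx : x ∈ D
    · rw [TT, indicator_of_mem hx]
    · rw [hv0 x hx, mul_zero, mul_zero]
  simp_rw [e1]
  rw [hs]
  congr 1; ext y
  have e2 : ∫ x, lg (x - y) * v x = u y := by
    rw [hcv, cv_eq']
    congr 1; ext x; congr 1; simp only [lg, norm_sub_rev x y]
  rw [e2, mul_comm]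
  by_cases hy : y ∈ E
  · rw [indicator_of_mem hy]
  · rw [image_eq_zero_of_notMem_tsupport (fun hn => hy (hu.supp hn))]; simp

end


def lay (D : Set ℂ) (κ : ℝ) : Set ℂ := D ∩ {x | infDist x Dᶜ < κ}

lemma lay_open {D : Set ℂ} (hD : IsOpen D) (κ : ℝ) : IsOpen (lay D κ) :=
  hD.inter (isOpen_lt (continuous_infDist_pt _) continuous_const)

lemma compl_ne {D : Set ℂ} (hb : Bornology.IsBounded D) : Dᶜ.Nonempty := by
  obtain ⟨R, hR, h⟩ := bdd_R hb
  exact ⟨(R : ℂ), fun hn => by have := h _ hn; rw [Complex.norm_real, Real.norm_of_nonneg hR.le] at this; exact lt_irrefl _ this⟩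

lemma dist_pos {D : Set ℂ} (hD : IsOpen D) (hb : Bornology.IsBounded D) {x : ℂ} (hx : x ∈ D) : 0 < infDist x Dᶜ :=
  (hD.isClosed_compl.notMem_iff_infDist_pos (compl_ne hb)).1 (by simpa using hx)

lemma mem_of_dist {D : Set ℂ} {x : ℂ} (h : 0 < infDist x Dᶜ) : x ∈ D := by
  by_contra hn
  rw [infDist_zero_of_mem (show x ∈ Dᶜ from hn)] at h; exact lt_irrefl _ h

lemma layer {D : Set ℂ} (hD : IsOpen D) (hb : Bornology.IsBounded D) {m : ℝ} (hm : 0 < m) :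
    ∃ κ > 0, volume (lay D κ) ≤ ENNReal.ofReal m := by
  have ha : Antitone fun n : ℕ => lay D (1 / ((n:ℝ) + 1)) := by
    intro i j hij x hx
    have hc : (i:ℝ) ≤ j := by exact_mod_cast hij
    have h2 : infDist x Dᶜ < 1 / ((j:ℝ) + 1) := hx.2
    exact ⟨hx.1, lt_of_lt_of_le h2 (one_div_le_one_div_of_le (by positivity) (by linarith))⟩
  have h := tendsto_measure_iInter_atTop (μ := volume) (s := fun n : ℕ => lay D (1 / ((n:ℝ) + 1)))
    (fun n => (lay_open hD _).measurableSet.nullMeasurableSet) ha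
    ⟨0, (measure_mono inter_subset_left).trans_lt hb.measure_lt_top |>.ne⟩
  have h0 : (⋂ n : ℕ, lay D (1 / ((n:ℝ) + 1))) = ∅ := by
    ext x
    simp only [mem_iInter, mem_empty_iff_false, iff_false]
    intro hx
    obtain ⟨n, hn⟩ := exists_nat_one_div_lt (dist_pos hD hb (hx 0).1)
    exact absurd (hx n).2 (not_lt.2 hn.le)
  rw [h0, measure_empty] at h
  obtain ⟨n, hn⟩ := (h.eventually (gt_mem_nhds (ENNReal.ofReal_pos.2 hm))).exists
  exact ⟨_, by positivity, hn.le⟩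

lemma lg_sq (x : ℂ) : ‖lg x‖ₑ ^ 2 ≤ 4 * (ENNReal.ofReal ‖x‖ + ke x) := by
  refine le_trans ?_ (log_sq_ke x)
  rw [← ofReal_norm, ← ENNReal.ofReal_pow (norm_nonneg _)]
  refine ENNReal.ofReal_le_ofReal ?_
  rw [lg, Complex.norm_real, Real.norm_eq_abs, sq_abs, mul_pow]
  have h1 : (2 / Real.pi)^2 ≤ 1 := by
    rw [div_pow, div_le_one (by positivity)]; nlinarith [Real.pi_gt_three]
  nlinarith [sq_nonneg (Real.log ‖x‖)]

lemma lg_lay {D : Set ℂ} (hD : IsOpen D) (hb : Bornology.IsBounded D) {m : ℝ} (hm : 0 < m) :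
    ∃ κ > 0, ∀ x ∈ D, ∫⁻ y in lay D κ, ‖lg (x - y)‖ₑ ^ 2 ≤ ENNReal.ofReal m := by
  obtain ⟨R, hR, hRD⟩ := bdd_R hb
  have hpi := Real.pi_pos
  set ρ := m / (16 * Real.pi) with hρ
  have hρ0 : 0 < ρ := by positivity
  obtain ⟨κ, hκ, hv⟩ := layer hD hb (m := m / (8 * (2 * R + ρ⁻¹))) (by positivity)
  refine ⟨κ, hκ, fun x hx => ?_⟩
  have h1 : ∫⁻ y in lay D κ, ‖lg (x - y)‖ₑ ^ 2 ≤ ∫⁻ y in lay D κ, 4 * (ENNReal.ofReal (2 * R) + ke (x - y)) := by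
    refine setLIntegral_mono (by have := ke_meas; fun_prop) fun y hy => (lg_sq _).trans ?_
    gcongr
    linarith [norm_sub_le x y, hRD x hx, hRD y hy.1]
  refine h1.trans ?_
  rw [lintegral_const_mul' _ _ (by norm_num), lintegral_add_left measurable_const, setLIntegral_const]
  calc _ ≤ 4 * (ENNReal.ofReal (2 * R) * ENNReal.ofReal (m / (8 * (2 * R + ρ⁻¹))) + (ENNReal.ofReal (2 * Real.pi * ρ) + ENNReal.ofReal ρ⁻¹ * ENNReal.ofReal (m / (8 * (2 * R + ρ⁻¹))))) := by
        gcongr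
        exact (ke_set _ _ hρ0).trans (by gcongr)
    _ = ENNReal.ofReal (4 * (2 * R * (m / (8 * (2 * R + ρ⁻¹))) + (2 * Real.pi * ρ + ρ⁻¹ * (m / (8 * (2 * R + ρ⁻¹)))))) := by
        rw [ENNReal.ofReal_mul (p := 4) (by norm_num), ENNReal.ofReal_add (by positivity) (by positivity), ENNReal.ofReal_add (by positivity) (by positivity),
          ENNReal.ofReal_mul (p := 2 * R) (by positivity), ENNReal.ofReal_mul (p := ρ⁻¹) (by positivity)]
        norm_num
    _ ≤ _ := by
        refine ENNReal.ofReal_le_ofReal (le_of_eq ?_)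
        have : 4 * (2 * R * (m / (8 * (2 * R + ρ⁻¹))) + (2 * Real.pi * ρ + ρ⁻¹ * (m / (8 * (2 * R + ρ⁻¹)))))
          = 8 * Real.pi * ρ + (2 * R + ρ⁻¹) * (m / (2 * (2 * R + ρ⁻¹))) := by field_simp; ring
        have hq : 0 < 2 * R + ρ⁻¹ := by positivity
        rw [this, hρ, ← hρ]
        have e1 : (2 * R + ρ⁻¹) * (m / (2 * (2 * R + ρ⁻¹))) = m / 2 := by field_simp
        have e2 : 8 * Real.pi * ρ = m / 2 := by rw [hρ]; field_simp; norm_num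
        rw [e1, e2]; ring

lemma T_small {D : Set ℂ} (hD : IsOpen D) (hb : Bornology.IsBounded D) {ε : ℝ} (hε : 0 < ε) :
    ∃ κ > 0, ∀ z e, Dat D z e → ∀ x, ‖TT D (lay D κ) e x‖ ≤ ε := by
  obtain ⟨κ, hκ, h⟩ := lg_lay hD hb (m := ε^2) (by positivity)
  refine ⟨κ, hκ, fun z e he x => ?_⟩
  by_cases hx : x ∈ D
  · rw [TT, indicator_of_mem hx]
    rw [← ENNReal.ofReal_le_ofReal_iff hε.le, ofReal_norm]
    refine (ENNReal.pow_le_pow_left_iff (n := 2) (by norm_num)).1 ?_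
    have hm := (lay_open hD κ).measurableSet
    have h1 : ‖∫ y, lg (x - y) * (lay D κ).indicator e y‖ₑ ≤ ∫⁻ y in lay D κ, ‖lg (x - y)‖ₑ * ‖e y‖ₑ := by
      refine (enorm_integral_le_lintegral_enorm _).trans (le_of_eq ?_)
      rw [← lintegral_indicator hm]
      congr 1; ext y
      by_cases hy : y ∈ lay D κ
      · simp [hy, enorm_mul]
      · simp [hy]
    refine (pow_le_pow_left' h1 2).trans ?_
    refine (lint_cs _ (by have := lg_meas; fun_prop) (he.meas hD).enorm.aemeasurable).trans ?_
    rw [← ENNReal.ofReal_pow hε.le]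
    refine (mul_le_mul' (h x hx) ((setLIntegral_le_lintegral _ _).trans (he.lint hD).le)).trans ?_
    rw [mul_one]
  · rw [TT, indicator_of_notMem hx, norm_zero]; exact hε.le


lemma ball_sub_of_dist {D : Set ℂ} {a : ℂ} {r : ℝ} (h : r ≤ infDist a Dᶜ) : ball a r ⊆ D := fun y hy => by
  refine mem_of_dist ?_
  have := infDist_le_infDist_add_dist (s := Dᶜ) (x := a) (y := y)
  rw [mem_ball, dist_comm] at hy; linarith

lemma shift_int (V : ℂ → ℝ) (x : ℂ) (r : ℝ) : ∫ h in ball (0:ℂ) r, V (x + h) = ∫ y in ball x r, V y := by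
  have := (measurePreserving_add_left volume x).setIntegral_preimage_emb (measurableEmbedding_addLeft x) V (ball x r)
  rw [← this]
  congr 2; ext y; simp

lemma cz_le {D : Set ℂ} (hD : IsOpen D) (hb : Bornology.IsBounded D) {z : ℂ} (hz : z ∈ D) :
    0 < (Real.pi * kap D z)⁻¹ ∧ (Real.pi * kap D z)⁻¹ ≤ √(volume.real D) := by
  have hk := kap_pos hD hb hz
  have hp := Real.pi_pos
  refine ⟨by positivity, ?_⟩
  have h := kap_le hD hb hz (one_Hol2 hb)
  simp only [norm_one, one_pow, integral_const, smul_eq_mul, mul_one, measureReal_restrict_apply_univ] at h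
  rw [inv_le_iff_one_le_mul₀ (by positivity)]
  have : (1:ℝ) ≤ Real.pi := by linarith [Real.pi_gt_three]
  nlinarith

lemma Dat.psi_le {D : Set ℂ} {z : ℂ} {e : ℂ → ℂ} (h : Dat D z e) (hD : IsOpen D) (hb : Bornology.IsBounded D) {R : ℝ} (hR : ∀ x ∈ D, ‖x‖ < R)
    (hz : z ∈ D) {a : ℂ} {r : ℝ} (hr : 0 < r) (hB : ball a r ⊆ D) :
    ‖psi z e a‖ ≤ 2 * R * (2 * Real.pi + 2 / r * √(volume.real D)) + √(volume.real D) := by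
  have ha : a ∈ D := hB (mem_ball_self hr)
  rw [h.psi_eq hD hb ha]
  obtain ⟨c1, c2⟩ := cz_le hD hb hz
  refine (norm_sub_le _ _).trans ?_
  rw [norm_mul, Complex.norm_real, Real.norm_of_nonneg c1.le]
  have h1 : ‖a - z‖ ≤ 2 * R := by linarith [norm_sub_le a z, hR a ha, hR z hz]
  have h2 := h.bound hD hb hr hB
  have h3 : 0 ≤ 2 * R := (norm_nonneg _).trans h1
  gcongr

lemma vzero {D : Set ℂ} (hD : IsOpen D) (hb : Bornology.IsBounded D) {s : ℂ → ℝ} (hsm : Measurable s)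
    (hs0 : ∀ x, 0 ≤ s x) (hs1 : ∀ x, s x ≤ 1)
    (hsup : ∀ x r, 0 < r → closedBall x r ⊆ D → ∫ y in ball x r, s y ≤ (Real.pi * r^2) * s x)
    {z : ℂ} {e : ℂ → ℂ} (h : Dat D z e) {κ ε C : ℝ} (hκ : 0 < κ) (hC : 0 ≤ C)
    (hT : ∀ x, ‖TT D (lay D κ) e x‖ ≤ ε) (hK : ∀ x, κ/2 ≤ infDist x Dᶜ → ‖psi z e x‖ ≤ C * s x) :
    ∀ᵐ x, x ∈ lay D κ → -(psi z e x).re ≤ 2 * ε + C * s x := by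
  obtain ⟨hG, hφ, φs, ht, h1, h2⟩ := h.approx hD hb
  have hE := (lay_open hD κ).measurableSet
  have hp := Real.pi_pos
  have hTre : ∀ x, |(TT D (lay D κ) e x).re| ≤ ε := fun x => (Complex.abs_re_le_norm _).trans (hT x)
  set q := fun x => -(phi D z e x - TT D (lay D κ) e x).re - ε - C * s x with hq
  have hqm : Measurable q := by
    have a1 := h.phi_meas hD
    have a2 := h.TT_meas hD hE
    exact (((Complex.measurable_re.comp (a1.sub a2)).neg).sub_const _).sub (hsm.const_mul C)
  set V := (lay D κ).indicator (fun x => max (q x) 0) with hVd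
  have hVm : Measurable V := (hqm.max measurable_const).indicator hE
  have hV0 : ∀ x, 0 ≤ V x := fun x => indicator_nonneg (fun x _ => le_max_right _ _) x
  have hqV : ∀ x ∈ lay D κ, q x ≤ V x := fun x hx => by rw [hVd, indicator_of_mem hx]; exact le_max_left _ _
  have hqφ : ∀ x, q x ≤ -(phi D z e x).re := fun x => by
    have := (abs_le.1 (hTre x)).2
    have := mul_nonneg hC (hs0 x)
    simp only [hq, Complex.sub_re]; linarith
  have hVφ : ∀ x, V x ≤ max (-(phi D z e x).re) 0 := fun x => by
    by_cases hx : x ∈ lay D κ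
    · rw [hVd, indicator_of_mem hx]; exact max_le_max (hqφ x) le_rfl
    · rw [hVd, indicator_of_notMem hx]; exact le_max_right _ _
  have hφre : ∀ x ∈ D, (phi D z e x).re = (psi z e x).re := fun x hx => by
    rw [phi, indicator_of_mem hx]; exact Complex.conj_re _
  have hVK : ∀ x, κ/2 ≤ infDist x Dᶜ → V x = 0 := fun x hx => by
    by_cases hxl : x ∈ lay D κ
    · rw [hVd, indicator_of_mem hxl]
      refine max_eq_right ?_
      have a1 := (abs_le.1 (hTre x)).2
      have a2 := (abs_le.1 ((Complex.abs_re_le_norm _).trans (hK x hx))).1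
      simp only [hq, Complex.sub_re, hφre x hxl.1]; linarith
    · rw [hVd, indicator_of_notMem hxl]
  have iφ := h.phi_int hD hb
  have iT := h.TT_int hD hb hE
  have iV : Integrable V := by
    refine iφ.norm.mono' hVm.aestronglyMeasurable (Eventually.of_forall fun x => ?_)
    rw [Real.norm_of_nonneg (hV0 x)]
    exact (hVφ x).trans (max_le ((neg_le_abs _).trans (Complex.abs_re_le_norm _)) (norm_nonneg _))
  have hz := CP hb ht (h.phi_meas hD) hφ hG h1 h2 hVm hV0 (fun x hx => indicator_of_notMem (fun hn => hx hn.1) _) hVφ (by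
    intro Q hQ hQD
    obtain ⟨δ, hδ, hδQ⟩ := hQ.exists_forall_le' (continuous_infDist_pt Dᶜ).continuousOn (fun x hx => dist_pos hD hb (hQD hx))
    set r := min (min (δ/2) (κ/4)) 1 with hr
    have hr0 : 0 < r := by positivity
    have hrδ : r ≤ δ/2 := (min_le_left _ _).trans (min_le_left _ _)
    have hrκ : r ≤ κ/4 := (min_le_left _ _).trans (min_le_right _ _)
    refine ⟨r, hr0, min_le_right _ _, ?_⟩
    have hcb : ∀ x ∈ {x | r < infDist x Dᶜ} ∩ {x | infDist x Dᶜ < κ/2}, closedBall x r ⊆ lay D κ := by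
      rintro x ⟨hx1, hx2⟩ y hy
      simp only [mem_ofPred_eq] at hx1 hx2
      have a1 := infDist_le_infDist_add_dist (s := Dᶜ) (x := x) (y := y)
      have a2 := infDist_le_infDist_add_dist (s := Dᶜ) (x := y) (y := x)
      rw [mem_closedBall] at hy
      rw [dist_comm] at a1
      exact ⟨mem_of_dist (by linarith), show infDist y Dᶜ < κ by linarith⟩
    have hm := h.mean hD hb hE inter_subset_left ((isOpen_lt continuous_const (continuous_infDist_pt _)).inter
      (isOpen_lt (continuous_infDist_pt _) continuous_const)) hr0 hcb
    filter_upwards [hm] with x hx hxQ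
    rw [shift_int]
    by_cases hxκ : infDist x Dᶜ < κ/2
    · have hxΩ : x ∈ {x | r < infDist x Dᶜ} ∩ {x | infDist x Dᶜ < κ/2} := ⟨by
        have := hδQ x hxQ; simp only [mem_ofPred_eq]; linarith, hxκ⟩
      have hxl := hcb x hxΩ
      have e1 := congrArg Complex.re (hx hxΩ)
      rw [Complex.re_ofReal_mul] at e1
      have hfin : IsFiniteMeasure (volume.restrict (ball x r)) := fin_of_bdd isBounded_ball
      have is : IntegrableOn s (ball x r) := by
        refine Integrable.mono' (integrable_const 1) hsm.aestronglyMeasurable (Eventually.of_forall fun y => ?_)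
        rw [Real.norm_of_nonneg (hs0 y)]; exact hs1 y
      have id : IntegrableOn (fun y => phi D z e y - TT D (lay D κ) e y) (ball x r) := (iφ.sub iT).integrableOn
      have e2 : (∫ y in ball x r, (phi D z e y - TT D (lay D κ) e y)).re = ∫ y in ball x r, (phi D z e y - TT D (lay D κ) e y).re :=
        (integral_re id).symm
      rw [e2] at e1
      have e3 : ∫ y in ball x r, q y = -(∫ y in ball x r, (phi D z e y - TT D (lay D κ) e y).re) - ε * (Real.pi * r^2) - C * ∫ y in ball x r, s y := by
        have i1 : IntegrableOn (fun y => -(phi D z e y - TT D (lay D κ) e y).re) (ball x r) := id.re.neg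
        have i2 : IntegrableOn (fun y => -(phi D z e y - TT D (lay D κ) e y).re - ε) (ball x r) := i1.sub (integrable_const ε)
        have hv : volume.real (ball x r) = Real.pi * r^2 := by
          rw [Measure.real, vol_ball' x hr0.le, ENNReal.toReal_ofReal (by positivity)]
        have s1 : ∫ y in ball x r, q y = (∫ y in ball x r, (-(phi D z e y - TT D (lay D κ) e y).re - ε)) - ∫ y in ball x r, C * s y :=
          integral_sub i2 (is.const_mul C)
        have s2 : (∫ y in ball x r, (-(phi D z e y - TT D (lay D κ) e y).re - ε)) = (∫ y in ball x r, (-(phi D z e y - TT D (lay D κ) e y).re)) - ∫ y in ball x r, ε :=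
          integral_sub i1 (integrable_const ε)
        rw [s1, s2, integral_neg, integral_const_mul, integral_const, measureReal_restrict_apply_univ, hv, smul_eq_mul]; ring
      have iq : IntegrableOn q (ball x r) := ((id.re.neg).sub (integrable_const ε)).sub (is.const_mul C)
      have e4 : ∫ y in ball x r, q y ≤ ∫ y in ball x r, V y :=
        setIntegral_mono_on iq iV.integrableOn measurableSet_ball fun y hy => hqV y (hxl (ball_subset_closedBall hy))
      have e5 := hsup x r hr0 (hxl.trans inter_subset_left)
      have hA : 0 < Real.pi * r^2 := by positivity
      have e6 : q x ≤ (Real.pi * r^2)⁻¹ * ∫ y in ball x r, V y := by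
        rw [le_inv_mul_iff₀ hA]
        refine le_trans ?_ e4
        rw [e3]
        simp only [hq]
        rw [e1]
        have : Real.pi * r^2 * ((Real.pi * r^2)⁻¹ * ∫ y in ball x r, (phi D z e y - TT D (lay D κ) e y).re) = ∫ y in ball x r, (phi D z e y - TT D (lay D κ) e y).re :=
          mul_inv_cancel_left₀ hA.ne' _
        nlinarith [mul_le_mul_of_nonneg_left e5 hC]
      rw [hVd, indicator_of_mem (hxl (mem_closedBall_self hr0.le))]
      exact max_le e6 (mul_nonneg (by positivity) (integral_nonneg hV0))
    · rw [hVK x (not_lt.1 hxκ)]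
      exact mul_nonneg (by positivity) (integral_nonneg hV0))
  filter_upwards [hz] with x hx hxl
  have a1 := (hqV x hxl).trans hx.le
  have a2 := (abs_le.1 (hTre x)).1
  simp only [hq, Complex.sub_re, hφre x hxl.1, Pi.zero_apply] at a1
  linarith

lemma barrier {D : Set ℂ} (hD : IsOpen D) (hb : Bornology.IsBounded D) {s : ℂ → ℝ} (hsm : Measurable s)
    (hs0 : ∀ x, 0 ≤ s x) (hs1 : ∀ x, s x ≤ 1)
    (hsup : ∀ x r, 0 < r → closedBall x r ⊆ D → ∫ y in ball x r, s y ≤ (Real.pi * r^2) * s x)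
    (hsK : ∀ K, IsCompact K → K ⊆ D → ∃ m > 0, ∀ x ∈ K, m ≤ s x) {ε : ℝ} (hε : 0 < ε) :
    ∃ κ > 0, ∃ C ≥ 0, ∀ z ∈ D, ∀ e, Dat D z e → infDist z Dᶜ < κ → ∀ M, (∀ᶠ x in 𝓝 z, s x ≤ M) →
      (Real.pi * kap D z)⁻¹ ≤ 3 * ε + C * M := by
  obtain ⟨κ, hκ, hT⟩ := T_small hD hb hε
  obtain ⟨R, hR, hRD⟩ := bdd_R hb
  have hp := Real.pi_pos
  have hK1 : {x | κ/2 ≤ infDist x Dᶜ} ⊆ D := fun x hx => mem_of_dist (lt_of_lt_of_le (half_pos hκ) hx)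
  have hKc : IsCompact {x | κ/2 ≤ infDist x Dᶜ} :=
    Metric.isCompact_of_isClosed_isBounded (isClosed_le continuous_const (continuous_infDist_pt _)) (hb.subset hK1)
  obtain ⟨m, hm, hms⟩ := hsK _ hKc hK1
  set A := 2 * R * (2 * Real.pi + 2 / (κ/2) * √(volume.real D)) + √(volume.real D) with hA
  have hA0 : 0 ≤ A := by positivity
  refine ⟨κ, hκ, A / m, by positivity, fun z hz e he hzκ M hM => ?_⟩
  have hv := vzero hD hb hsm hs0 hs1 hsup he hκ (C := A / m) (by positivity) (hT z e he) (fun x hx => by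
    refine (he.psi_le hD hb hRD hz (half_pos hκ) (ball_sub_of_dist hx)).trans ?_
    calc A = A / m * m := by field_simp
      _ ≤ A / m * s x := by gcongr; exact hms x hx)
  set r := infDist z Dᶜ / 2 with hr
  have hr0 : 0 < r := by have := dist_pos hD hb hz; positivity
  set B := 2 * Real.pi + 2 / r * √(volume.real D) with hB
  have n1 : ∀ᶠ a in 𝓝 z, ‖a - z‖ * B < ε := by
    have : Tendsto (fun a => ‖a - z‖ * B) (𝓝 z) (𝓝 (‖z - z‖ * B)) := (by fun_prop : Continuous fun a => ‖a - z‖ * B).tendsto z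
    rw [sub_self, norm_zero, zero_mul] at this
    exact this.eventually (gt_mem_nhds hε)
  have n2 : ∀ᶠ a in 𝓝 z, a ∈ ball z r := ball_mem_nhds z hr0
  have n3 : ∀ᶠ a in 𝓝 z, a ∈ lay D κ := (lay_open hD κ).mem_nhds ⟨hz, hzκ⟩
  obtain ⟨a, h5, ⟨⟨h1, h2⟩, h3⟩, h4⟩ := (Measure.dense_of_ae hv).inter_nhds_nonempty (((n1.and n2).and n3).and hM)
  have h6 := h5 h3
  have hBa : ball a r ⊆ D := (ball_subset_ball' (by rw [mem_ball] at h2; linarith)).trans (ball_sub_of_dist (a := z) (r := 2 * r) (by rw [hr]; linarith))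
  have h7 := he.bound hD hb hr0 hBa
  rw [he.psi_eq hD hb h3.1, Complex.sub_re, Complex.ofReal_re] at h6
  have h8 := (Complex.re_le_norm ((a - z) * Cau (fun a => cj (e a)) a))
  rw [norm_mul] at h8
  have h9 : ‖a - z‖ * ‖Cau (fun a => cj (e a)) a‖ ≤ ‖a - z‖ * B := by gcongr
  have h10 : A / m * s a ≤ A / m * M := by gcongr
  linarith


def tr (u : ℂ → EReal) (x : ℂ) : ℝ := (max (u x) (-((1:ℕ) : ℝ) : EReal)).toReal

lemma tr_coe {u : ℂ → EReal} {x : ℂ} (h : u x < 0) : (tr u x : EReal) = max (u x) ((-1 : ℝ) : EReal) := by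
  have hc : (-((1:ℕ) : ℝ) : EReal) = ((-1 : ℝ) : EReal) := by simp
  rw [tr, hc, EReal.coe_toReal]
  · exact (max_lt (h.trans EReal.zero_lt_top) (EReal.coe_lt_top _)).ne
  · exact ((EReal.bot_lt_coe _).trans_le (le_max_right _ _)).ne'

lemma tr_bd {u : ℂ → EReal} {x : ℂ} (h : u x < 0) : -1 ≤ tr u x ∧ tr u x < 0 := by
  have e := tr_coe h
  constructor
  · refine EReal.coe_le_coe_iff.1 ?_
    rw [e]; exact le_max_right _ _
  · refine EReal.coe_lt_coe_iff.1 ?_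
    rw [e]; exact max_lt h (EReal.coe_lt_coe_iff.2 (by norm_num))

lemma sfun {D : Set ℂ} (hD : IsOpen D) {u : ℂ → EReal} (hu : SubharmonicOn u D) (hneg : ∀ x ∈ D, u x < 0) :
    ∃ s : ℂ → ℝ, Measurable s ∧ (∀ x, 0 ≤ s x) ∧ (∀ x, s x ≤ 1) ∧
    (∀ x r, 0 < r → closedBall x r ⊆ D → ∫ y in ball x r, s y ≤ (Real.pi * r^2) * s x) ∧
    (∀ K, IsCompact K → K ⊆ D → ∃ m > 0, ∀ x ∈ K, m ≤ s x) ∧ ∀ x ∈ D, ∀ M : ℝ, ((-M : ℝ) : EReal) ≤ u x → s x ≤ M := by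
  classical
  set s := D.indicator (fun x => - tr u x) with hs
  have hsD : ∀ x ∈ D, s x = - tr u x := fun x hx => indicator_of_mem hx _
  have hs0 : ∀ x, 0 ≤ s x := fun x => indicator_nonneg (fun x hx => by linarith [(tr_bd (hneg x hx)).2]) x
  have hs1 : ∀ x, s x ≤ 1 := fun x => by
    by_cases hx : x ∈ D
    · rw [hsD x hx]; linarith [(tr_bd (hneg x hx)).1]
    · rw [hs, indicator_of_notMem hx]; norm_num
  have hsm : Measurable s := by
    set g : ℂ → EReal := fun x => if x ∈ D then u x else ⊤ with hg
    have hgm : Measurable g := by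
      refine measurable_of_Iio fun c => IsOpen.measurableSet ?_
      rw [isOpen_iff_mem_nhds]
      intro x hx
      have hxD : x ∈ D := by
        by_contra hn
        simp [hg, hn] at hx
      have hux : u x < c := by simpa [hg, hxD] using hx
      have := hu.1 x hxD c hux
      rw [hD.nhdsWithin_eq hxD] at this
      filter_upwards [this, hD.mem_nhds hxD] with y hy hyD
      simpa [hg, hyD] using hy
    have : s = D.indicator (fun x => -(max (g x) (-((1:ℕ) : ℝ) : EReal)).toReal) := by
      ext x
      by_cases hx : x ∈ D
      · simp [hs, hx, hg, tr]
      · simp [hs, hx]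
    rw [this]
    exact ((hgm.max measurable_const).ereal_toReal.neg).indicator hD.measurableSet
  refine ⟨s, hsm, hs0, hs1, fun x r hr hB => ?_, fun K hK hKD => ?_, fun x hx M hM => ?_⟩
  · have hfin : IsFiniteMeasure (volume.restrict (ball x r)) := fin_of_bdd isBounded_ball
    have hxD : x ∈ D := hB (mem_closedBall_self hr.le)
    refine disc_mean_le hsm hr.le ?_ fun ρ hρ => ?_
    · refine Integrable.mono' (integrable_const 1) hsm.aestronglyMeasurable (Eventually.of_forall fun y => ?_)
      rw [Real.norm_of_nonneg (hs0 y)]; exact hs1 y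
    have hBρ : closedBall x ρ ⊆ D := (closedBall_subset_closedBall hρ.2.le).trans hB
    have h1 : u x ≤ (circleAvgTrunc u x ρ 1 : EReal) := (hu.2.2 x hxD ρ hρ.1 hBρ).trans (iInf_le _ 1)
    have hmem : ∀ θ : ℝ, x + ρ * Complex.exp (θ * Complex.I) ∈ D := fun θ => hBρ (by
      rw [mem_closedBall, dist_eq_norm, add_sub_cancel_left, norm_mul, Complex.norm_exp_ofReal_mul_I, mul_one, Complex.norm_real,
        Real.norm_of_nonneg hρ.1.le])
    have e1 : circleAvgTrunc u x ρ 1 = (2 * Real.pi)⁻¹ * ∫ θ in (0:ℝ)..(2 * Real.pi), tr u (x + ρ * Complex.exp (θ * Complex.I)) := rfl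
    have e2 : Real.circleAverage s x ρ = - circleAvgTrunc u x ρ 1 := by
      rw [e1, Real.circleAverage, smul_eq_mul, ← mul_neg, ← intervalIntegral.integral_neg]
      congr 2; ext θ
      exact hsD _ (hmem θ)
    have h2 : -1 ≤ circleAvgTrunc u x ρ 1 := by
      have := intervalIntegral.norm_integral_le_of_norm_le_const (a := 0) (b := 2 * Real.pi) (C := 1)
        (f := fun θ : ℝ => tr u (x + ρ * Complex.exp (θ * Complex.I))) (fun θ _ => by
          have := tr_bd (hneg _ (hmem θ))
          rw [Real.norm_eq_abs, abs_le]; constructor <;> linarith)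
      have hp : 0 < 2 * Real.pi := Real.two_pi_pos
      rw [sub_zero, abs_of_pos hp, one_mul, Real.norm_eq_abs, abs_le] at this
      rw [e1, le_inv_mul_iff₀ hp]; linarith
    rw [e2, hsD x hxD, neg_le_neg_iff]
    have : (tr u x : EReal) ≤ (circleAvgTrunc u x ρ 1 : EReal) := by
      rw [tr_coe (hneg x hxD)]
      exact max_le h1 (EReal.coe_le_coe_iff.2 h2)
    exact_mod_cast this
  · rcases K.eq_empty_or_nonempty with rfl | hne
    · exact ⟨1, one_pos, fun x hx => absurd hx (notMem_empty x)⟩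
    · obtain ⟨p, hp, hmax⟩ := (hu.1.mono hKD).exists_isMaxOn hne hK
      refine ⟨- tr u p, by linarith [(tr_bd (hneg p (hKD hp))).2], fun x hx => ?_⟩
      rw [hsD x (hKD hx), neg_le_neg_iff]
      have : (tr u x : EReal) ≤ tr u p := by
        rw [tr_coe (hneg x (hKD hx)), tr_coe (hneg p (hKD hp))]
        exact max_le_max (hmax hx) le_rfl
      exact_mod_cast this
  · rw [hsD x hx]
    have : ((-M : ℝ) : EReal) ≤ tr u x := by
      rw [tr_coe (hneg x hx)]; exact hM.trans (le_max_left _ _)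
    have : -M ≤ tr u x := by exact_mod_cast this
    linarith

lemma L6 {D : Set ℂ} (hD : IsOpen D) (hb : Bornology.IsBounded D) {w : ℂ} (hw : w ∉ D) {u : ℂ → EReal} (hu : SubharmonicOn u D)
    (hneg : ∀ x ∈ D, u x < 0) (ht : Tendsto u (𝓝[D] w) (𝓝 0)) : Tendsto (fun z => kap D z) (𝓝[D] w) atTop := by
  obtain ⟨s, a1, a2, a3, a4, a5, a6⟩ := sfun hD hu hneg
  have hp := Real.pi_pos
  rw [Filter.tendsto_atTop]
  intro N0
  set N := max N0 1 with hN
  have hN0 : 0 < N := by positivity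
  obtain ⟨κ, hκ, C, hC, h⟩ := barrier hD hb a1 a2 a3 a4 a5 (ε := (6 * Real.pi * N)⁻¹) (by positivity)
  set M := (2 * Real.pi * N * (C + 1))⁻¹ with hM
  have hM0 : 0 < M := by positivity
  have n1 : ∀ᶠ z in 𝓝[D] w, ∀ᶠ x in 𝓝[D] z, ((-M : ℝ) : EReal) < u x :=
    eventually_eventually_nhdsWithin.2 (ht.eventually (lt_mem_nhds (by exact_mod_cast (neg_lt_zero.2 hM0))))
  filter_upwards [n1, self_mem_nhdsWithin, mem_nhdsWithin_of_mem_nhds (ball_mem_nhds w hκ)] with z h1 hz h2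
  obtain ⟨e, e1, e2, e3, _, e5⟩ := exists_ez hD hb hz
  rw [hD.nhdsWithin_eq hz] at h1
  have h3 := h z hz e ⟨e1, e2, e3, e5⟩ ((infDist_le_dist_of_mem (show w ∈ Dᶜ from hw)).trans_lt h2) M (by
    filter_upwards [h1, hD.mem_nhds hz] with x hx hxD
    exact a6 x hxD M hx.le)
  have h4 : C * M ≤ (2 * Real.pi * N)⁻¹ := by
    rw [hM, mul_inv, ← mul_assoc, mul_comm C, mul_assoc]
    refine mul_le_of_le_one_right (by positivity) ?_
    rw [← div_eq_mul_inv, div_le_one (by positivity)]; linarith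
  have h5 : (Real.pi * kap D z)⁻¹ ≤ (Real.pi * N)⁻¹ := by
    refine h3.trans ((add_le_add_right h4 _).trans (le_of_eq ?_))
    field_simp; norm_num
  have h6 := (inv_le_inv₀ (mul_pos hp (kap_pos hD hb hz)) (by positivity)).1 h5
  exact (le_max_left _ _).trans (le_of_mul_le_mul_left h6 hp)

lemma SubharmonicOn_mono {u : ℂ → EReal} {A B : Set ℂ} (h : SubharmonicOn u B) (hs : A ⊆ B) : SubharmonicOn u A :=
  ⟨h.1.mono hs, fun z hz => h.2.1 z (hs hz), fun c hc R hR hB => h.2.2 c (hs hc) R hR (hB.trans hs)⟩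

theorem main (D : Set ℂ) (hopen : IsOpen D) (hbd : Bornology.IsBounded D) (w : ℂ) (hw : w ∈ frontier D) (hreg : RegularBoundaryPt D w) :
    Tendsto (fun z => bergmanMetricOne D z) (𝓝[D] w) atTop := by
  have hwD : w ∉ D := by rw [hopen.frontier_eq] at hw; exact hw.2
  obtain ⟨U, hU, hwU, u, hu, hneg, ht⟩ := hreg
  obtain ⟨R, hR, hRU⟩ := Metric.isOpen_iff.1 hU w hwU
  have hsub : D ∩ ball w R ⊆ U ∩ D := fun x hx => ⟨hRU hx.2, hx.1⟩
  have h1 := L6 (hopen.inter isOpen_ball) (hbd.subset inter_subset_left) (fun hn => hwD hn.1) (SubharmonicOn_mono hu hsub)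
    (fun x hx => hneg x (hsub hx)) (ht.mono_left (nhdsWithin_mono _ hsub))
  rw [nhdsWithin_inter_of_mem' (mem_nhdsWithin_of_mem_nhds (ball_mem_nhds w hR))] at h1
  obtain ⟨C, hC, hloc⟩ := kap_loc hopen hbd w hR
  have hk : Tendsto (fun z => kap D z) (𝓝[D] w) atTop := by
    have h2 : Tendsto (fun z => C⁻¹ * kap (D ∩ ball w R) z - 1) (𝓝[D] w) atTop :=
      tendsto_atTop_add_const_right _ (-1) (h1.const_mul_atTop (by positivity))
    refine tendsto_atTop_mono' _ ?_ h2
    filter_upwards [self_mem_nhdsWithin, mem_nhdsWithin_of_mem_nhds (ball_mem_nhds w (show 0 < R/4 by positivity))] with z hz hzB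
    have := hloc z ⟨hz, hzB⟩
    have : C⁻¹ * kap (D ∩ ball w R) z ≤ kap D z + 1 := by rwa [inv_mul_le_iff₀ hC]
    linarith
  have hex : ∀ z, ∃ e : ℂ → ℂ, z ∈ D → Hol2 D e ∧ (∀ x ∉ D, e x = 0) ∧ (∫ a in D, ‖e a‖ ^ 2) = 1 ∧
      e z = kap D z ∧ ∀ F, Hol2 D F → ∫ a in D, cj (e a) * F a = F z / kap D z := fun z => by
    by_cases hz : z ∈ D
    · obtain ⟨e, he⟩ := exists_ez hopen hbd hz
      exact ⟨e, fun _ => he⟩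
    · exact ⟨0, fun h => absurd h hz⟩
  choose e he using hex
  refine metric_tendsto hopen hbd e (fun z hz => ⟨(he z hz).1, (he z hz).2.2.1, (he z hz).2.2.2.1, (he z hz).2.2.2.2⟩) ?_
  have hC4 := L4b (l := 𝓝[D] w) hopen hbd e (by
      filter_upwards [self_mem_nhdsWithin] with z hz
      exact ⟨(he z hz).1, (he z hz).2.1, (he z hz).2.2.1⟩)
    (fun G hG => L5 hopen hbd hk e (fun z hz => ⟨(he z hz).1, (he z hz).2.2.1, (he z hz).2.2.2.2⟩) G hG)
  refine tendsto_of_tendsto_of_tendsto_of_le_of_le' tendsto_const_nhds hC4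
    (Eventually.of_forall fun z => integral_nonneg fun x => by positivity) ?_
  filter_upwards [self_mem_nhdsWithin] with z hz
  exact L4a hopen hbd (he z hz).1 (he z hz).2.1 (he z hz).2.2.2.2

end Brg
end
end BrgAux

/-- **Remark 7.** If `D ⊆ ℂ` is a bounded domain and `w ∈ ∂D` is a regular boundary point,
then the Bergman metric blows up at `w`: `β_D(z;1) → ∞` as `D ∋ z → w`. -/
theorem bergmanMetric_tendsto_atTop_of_regular (D : Set ℂ)
    (hopen : IsOpen D) (hconn : IsConnected D) (hbd : Bornology.IsBounded D)
    (w : ℂ) (hw : w ∈ frontier D) (hreg : RegularBoundaryPt D w) :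
    Tendsto (fun z => bergmanMetricOne D z) (𝓝[D] w) atTop := by
  exact Brg.main D hopen hbd w hw hreg
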